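/- arXiv:2509.01377 — 2 statements merged into one kernel-verified Lean document; each statement's English description precedes it below -/
import Mathlib

section
/- Consider the piecewise holomorphic system ż = 1/(z₁^+ (z − z₀^+)) for z ∈ Σ_+, ż = 1/(Σ_{j=0}^{n} z_j^c z^j) for z ∈ Σ_c, and ż = 1/(z₁^− (z − z₀^−)) for z ∈ Σ_−, where z₁^± ∈ ℂ∖{0}, z₀^± ∈ ℂ, and z_j^c ∈ ℂ with z_n^c ≠ 0 (so the central denominator is a polynomial of degree n, n ≥ 1). Then the system has at most n(n+1)/2 crossing limit cycles that intersect each of the lines Im z = 1 and Im z = −1 at exactly two points. -/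
open Complex Set

/-- A *crossing periodic orbit* of the piecewise system `z' = fields σ z` for `z ∈ zones σ`,
where the discontinuity set is the union of the zero sets of the functions in `curves`:
a nonconstant continuous `T`-periodic curve, satisfying the differential equation of each
zone inside that (open) zone, meeting the discontinuity set at only finitely many times per
period, and crossing it transversally there (at each such point the two one-sided vector
fields have nonzero normal component to the discontinuity curve, of the same sign; the normal
direction is given by the gradient, i.e. the Fréchet derivative, of the defining function of
the curve). -/
def IsCrossingPeriodicOrbit {ι : Type} (zones : ι → Set ℂ) (fields : ι → ℂ → ℂ)
    (curves : Set (ℂ → ℝ)) (z : ℝ → ℂ) : Prop :=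
  ∃ T : ℝ, 0 < T ∧
    Continuous z ∧ Function.Periodic z T ∧ (∃ s t : ℝ, z s ≠ z t) ∧
    (∀ (t : ℝ) (σ : ι), z t ∈ zones σ → HasDerivAt z (fields σ (z t)) t) ∧
    {t ∈ Set.Ico (0:ℝ) T | ∃ g ∈ curves, g (z t) = 0}.Finite ∧
    (∀ t : ℝ, (∃ g ∈ curves, g (z t) = 0) →
      ∃ σ₁ σ₂ : ι, σ₁ ≠ σ₂ ∧
        (∃ ε > 0, (∀ s ∈ Set.Ioo (t - ε) t, z s ∈ zones σ₁) ∧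
                  (∀ s ∈ Set.Ioo t (t + ε), z s ∈ zones σ₂)) ∧
        (∀ g ∈ curves, g (z t) = 0 →
          fderiv ℝ g (z t) (fields σ₁ (z t)) ≠ 0 ∧
          fderiv ℝ g (z t) (fields σ₂ (z t)) ≠ 0 ∧
          (0 < fderiv ℝ g (z t) (fields σ₁ (z t)) ↔
           0 < fderiv ℝ g (z t) (fields σ₂ (z t)))))

/-- A *crossing limit cycle*: a crossing periodic orbit whose image is isolated among
the images of crossing periodic orbits. -/
def IsCrossingLimitCycle {ι : Type} (zones : ι → Set ℂ) (fields : ι → ℂ → ℂ)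
    (curves : Set (ℂ → ℝ)) (z : ℝ → ℂ) : Prop :=
  IsCrossingPeriodicOrbit zones fields curves z ∧
  ∃ U : Set ℂ, IsOpen U ∧ Set.range z ⊆ U ∧
    ∀ w : ℝ → ℂ, IsCrossingPeriodicOrbit zones fields curves w →
      Set.range w ⊆ U → Set.range w = Set.range z

/-- The three zones separated by the parallel lines `Im z = 1` and `Im z = -1`:
`Σ₊ = {Im z > 1}`, `Σ_c = {|Im z| < 1}`, `Σ₋ = {Im z < -1}`. -/
def zonesLines : Fin 3 → Set ℂ :=
  ![{z : ℂ | 1 < z.im}, {z : ℂ | |z.im| < 1}, {z : ℂ | z.im < -1}]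

/-- The discontinuity curves `Im z = 1` and `Im z = -1`, given by level functions. -/
def curvesLines : Set (ℂ → ℝ) :=
  {fun z => z.im - 1, fun z => z.im + 1}

/-! ### Section 1: Bezout's inequality in the plane -/

section Bezout

open MvPolynomial

lemma finrank_restrict (m : ℕ) :
    Module.Finite ℝ (restrictTotalDegree (Fin 2) ℝ m) ∧
    2 * Module.finrank ℝ (restrictTotalDegree (Fin 2) ℝ m) = (m + 1) * (m + 2) := by
  let F : Finset (Σ _ : ℕ, ℕ) := (Finset.range (m+1)).sigma fun a => Finset.range (m+1-a)
  let e : {n : Fin 2 →₀ ℕ | (n.sum fun _ e => e) ≤ m} ≃ F :=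
    { toFun := fun n => ⟨⟨n.1 0, n.1 1⟩, by
        have := n.2
        simp only [Set.mem_ofPred_eq] at this
        rw [Finsupp.sum_fintype _ _ (by simp)] at this
        simp only [Fin.sum_univ_two] at this
        simp only [F, Finset.mem_sigma, Finset.mem_range]
        omega⟩
      invFun := fun x => ⟨Finsupp.equivFunOnFinite.symm ![x.1.1, x.1.2], by
        have := x.2
        simp only [F, Finset.mem_sigma, Finset.mem_range] at this
        simp only [Set.mem_ofPred_eq]
        rw [Finsupp.sum_fintype _ _ (by simp)]
        simp [Fin.sum_univ_two]
        omega⟩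
      left_inv := by
        intro n
        ext i
        fin_cases i <;> simp
      right_inv := by
        intro x
        simp }
  let b := (basisRestrictSupport ℝ {n : Fin 2 →₀ ℕ | (n.sum fun _ e => e) ≤ m}).reindex e
  constructor
  · exact Module.Finite.of_basis b
  · have h1 : Module.finrank ℝ (restrictTotalDegree (Fin 2) ℝ m) = Fintype.card F :=
      Module.finrank_eq_card_basis b
    rw [h1]
    simp only [Fintype.card_coe, F, Finset.card_sigma, Finset.card_range]
    have h2 : ∀ m : ℕ, 2 * ∑ a ∈ Finset.range (m+1), (m+1-a) = (m+1)*(m+2) := by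
      intro m
      have := Finset.sum_range_reflect (fun a => m + 1 - a) (m+1)
      rw [← this]
      have h3 : ∀ j ∈ Finset.range (m+1), m + 1 - (m + 1 - 1 - j) = j + 1 := by
        intro j hj
        simp at hj
        omega
      rw [Finset.sum_congr rfl h3]
      clear this h3
      induction m with
      | zero => simp
      | succ k ih => rw [Finset.sum_range_succ, mul_add, ih]; ring
    exact h2 m

lemma exists_interp (S : Finset (Fin 2 → ℝ)) (p : Fin 2 → ℝ) :
    ∃ f : MvPolynomial (Fin 2) ℝ, f.totalDegree ≤ S.card ∧ eval p f = 1 ∧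
      ∀ q ∈ S, q ≠ p → eval q f = 0 := by
  classical
  induction S using Finset.induction_on with
  | empty => exact ⟨1, by simp, by simp, by simp⟩
  | insert q S hq ih =>
    obtain ⟨f, h1, h2, h3⟩ := ih
    by_cases hqp : q = p
    · refine ⟨f, ?_, h2, ?_⟩
      · rw [Finset.card_insert_of_notMem hq]; omega
      · intro r hr hrp
        rcases Finset.mem_insert.1 hr with h | h
        · exact absurd (h.trans hqp) hrp
        · exact h3 r h hrp
    · obtain ⟨i, hi⟩ : ∃ i, q i ≠ p i := by
        by_contra! h
        exact hqp (funext h)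
      have hi' : p i - q i ≠ 0 := sub_ne_zero.2 (Ne.symm hi)
      refine ⟨f * (C (p i - q i)⁻¹ * (X i - C (q i))), ?_, ?_, ?_⟩
      · rw [Finset.card_insert_of_notMem hq]
        refine (totalDegree_mul _ _).trans (add_le_add h1 ?_)
        refine (totalDegree_mul _ _).trans ?_
        rw [totalDegree_C, zero_add]
        refine (totalDegree_sub _ _).trans ?_
        simp
      · simp [h2, hi']
      · intro r hr hrp
        rcases Finset.mem_insert.1 hr with h | h
        · subst h; simp
        · simp [h3 r h hrp]

lemma bezout_bound (f g : MvPolynomial (Fin 2) ℝ) (hg : g ≠ 0)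
    (hfg : IsRelPrime f g) (S : Finset (Fin 2 → ℝ))
    (hS : ∀ p ∈ S, eval p f = 0 ∧ eval p g = 0) :
    S.card ≤ f.totalDegree * g.totalDegree := by
  classical
  set e1 := f.totalDegree with he1
  set e2 := g.totalDegree with he2
  set c := S.card with hcdef
  let V : ℕ → Submodule ℝ (MvPolynomial (Fin 2) ℝ) := fun k => restrictTotalDegree (Fin 2) ℝ k
  have : ∀ k, Module.Finite ℝ (V k) := fun k => (finrank_restrict k).1
  have hV : ∀ k, 2 * Module.finrank ℝ (V k) = (k+1)*(k+2) := fun k => (finrank_restrict k).2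
  have memV : ∀ k p, p ∈ V k ↔ p.totalDegree ≤ k := fun k p =>
    mem_restrictTotalDegree (Fin 2) k p
  -- the linear maps
  let φ : (V (c + e2)) × (V (c + e1)) →ₗ[ℝ] MvPolynomial (Fin 2) ℝ :=
    ((LinearMap.mulRight ℝ f).comp (V (c+e2)).subtype).coprod
      ((LinearMap.mulRight ℝ g).comp (V (c+e1)).subtype)
  have hφ : ∀ x, φ x = x.1.1 * f + x.2.1 * g := by
    intro x; simp [φ]
  let ev : V (c + e1 + e2) →ₗ[ℝ] (S → ℝ) :=
    LinearMap.pi fun p => ((aeval (R := ℝ) p.1).toLinearMap).comp (V (c+e1+e2)).subtype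
  have hev : ∀ x p, ev x p = eval p.1 x.1 := by
    intro x p
    simp [ev, aeval_eq_eval]
  have hsurj : Function.Surjective ev := by
    intro y
    choose F hF1 hF2 hF3 using exists_interp S
    refine ⟨⟨∑ p : S, C (y p) * F p.1, ?_⟩, ?_⟩
    · rw [memV]
      refine (totalDegree_finsetSum _ _).trans ?_
      refine Finset.sup_le fun p _ => ?_
      refine (totalDegree_mul _ _).trans ?_
      rw [totalDegree_C]
      have := hF1 p.1
      omega
    · funext q
      rw [hev]
      simp only [map_sum, map_mul, eval_C]
      rw [Finset.sum_eq_single q]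
      · simp [hF2]
      · intro p _ hpq
        rw [hF3 p.1 q.1 q.2 (fun h => hpq (Subtype.ext h.symm)), mul_zero]
      · simp
  have hrange : LinearMap.range φ ≤ (LinearMap.ker ev).map (V (c+e1+e2)).subtype := by
    rintro _ ⟨x, rfl⟩
    have hx1 := (memV _ _).1 x.1.2
    have hx2 := (memV _ _).1 x.2.2
    refine ⟨⟨φ x, ?_⟩, ?_, rfl⟩
    · rw [memV, hφ]
      refine (totalDegree_add _ _).trans (max_le ?_ ?_)
      · refine (totalDegree_mul _ _).trans ?_
        omega
      · refine (totalDegree_mul _ _).trans ?_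
        omega
    · simp only [SetLike.mem_coe, LinearMap.mem_ker]
      funext p
      rw [hev]
      simp only [hφ]
      have := hS p.1 p.2
      simp [this.1, this.2]
  have hker : Module.finrank ℝ (LinearMap.ker φ) ≤ Module.finrank ℝ (V c) := by
    let ψ : V c →ₗ[ℝ] MvPolynomial (Fin 2) ℝ × MvPolynomial (Fin 2) ℝ :=
      ((LinearMap.mulRight ℝ g).comp (V c).subtype).prod
        ((LinearMap.mulRight ℝ (-f)).comp (V c).subtype)
    have hψ : ∀ x, ψ x = (x.1 * g, x.1 * (-f)) := by intro x; rfl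
    let ι : ((V (c + e2)) × (V (c + e1))) →ₗ[ℝ]
        MvPolynomial (Fin 2) ℝ × MvPolynomial (Fin 2) ℝ :=
      (V (c+e2)).subtype.prodMap (V (c+e1)).subtype
    have hι : Function.Injective ι := by
      intro x y h
      simp [ι] at h
      exact Prod.ext h.1 h.2
    have hle : (LinearMap.ker φ).map ι ≤ LinearMap.range ψ := by
      rintro _ ⟨x, hx, rfl⟩
      have hx' : x.1.1 * f + x.2.1 * g = 0 := by
        rw [← hφ]; exact hx
      have hdvd : g ∣ f * x.1.1 := ⟨-x.2.1, by linear_combination hx'⟩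
      obtain ⟨a, ha⟩ := hfg.symm.dvd_of_dvd_mul_left hdvd
      have hb : x.2.1 = a * (-f) := by
        have : g * (x.2.1 - a * (-f)) = 0 := by
          linear_combination hx' - f * ha
        rcases mul_eq_zero.1 this with h | h
        · exact absurd h hg
        · exact sub_eq_zero.1 h
      have hadeg : a ∈ V c := by
        rw [memV]
        by_cases ha0 : a = 0
        · simp [ha0]
        · have h1 := (memV _ _).1 x.1.2
          rw [ha, totalDegree_mul_of_isDomain hg ha0] at h1
          omega
      refine ⟨⟨a, hadeg⟩, ?_⟩
      rw [hψ]
      refine Prod.ext ?_ ?_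
      · change a * g = x.1.1
        rw [ha, mul_comm]
      · change a * (-f) = x.2.1
        rw [hb]
    calc Module.finrank ℝ (LinearMap.ker φ)
        = Module.finrank ℝ ((LinearMap.ker φ).map ι) :=
          (LinearEquiv.finrank_eq (Submodule.equivMapOfInjective ι hι _))
      _ ≤ Module.finrank ℝ (LinearMap.range ψ) := Submodule.finrank_mono hle
      _ ≤ Module.finrank ℝ (V c) := LinearMap.finrank_range_le ψ
  have hA : Module.finrank ℝ (LinearMap.range φ) ≤ Module.finrank ℝ (LinearMap.ker ev) := by
    refine (Submodule.finrank_mono hrange).trans ?_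
    exact Submodule.finrank_map_le _ _
  have hB := LinearMap.finrank_range_add_finrank_ker ev
  rw [LinearMap.range_eq_top.2 hsurj, finrank_top, Module.finrank_fintype_fun_eq_card,
    Fintype.card_coe] at hB
  have hC := LinearMap.finrank_range_add_finrank_ker φ
  rw [Module.finrank_prod] at hC
  have k1 := hV (c+e1+e2)
  have k2 := hV (c+e1)
  have k3 := hV (c+e2)
  have k4 := hV c
  zify at *
  nlinarith

lemma hasDerivAt_eval_fst (h : MvPolynomial (Fin 2) ℝ) (x y : ℝ) :
    HasDerivAt (fun x => eval ![x, y] h) (eval ![x, y] (pderiv 0 h)) x := by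
  induction h using MvPolynomial.induction_on with
  | C a => simpa using hasDerivAt_const x a
  | add a b ha hb => simpa using ha.fun_add hb
  | mul_X a i ha =>
    have hX : HasDerivAt (fun x : ℝ => (![x, y] : Fin 2 → ℝ) i)
        (eval ![x, y] (pderiv 0 (X i : MvPolynomial (Fin 2) ℝ))) x := by
      fin_cases i
      · simpa using hasDerivAt_id' x
      · simpa [pderiv_X] using hasDerivAt_const x y
    have := ha.fun_mul hX
    simp only [map_mul, eval_X, Derivation.leibniz, smul_eq_mul, map_add]
    refine this.congr_deriv ?_
    ring

lemma sign_change_of_deriv (φ : ℝ → ℝ) (x d : ℝ) (hφ : HasDerivAt φ d x) (hd : d ≠ 0)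
    (h0 : φ x = 0) (r : ℝ) (hr : 0 < r) :
    ∃ u v : ℝ, |u - x| < r ∧ |v - x| < r ∧ φ u < 0 ∧ 0 < φ v := by
  have hs := hasDerivAt_iff_tendsto_slope.1 hφ
  have hr1 : ∀ᶠ t in nhdsWithin x (Set.Ioi x), |t - x| < r := by
    apply nhdsWithin_le_nhds
    exact Metric.eventually_nhds_iff.2 ⟨r, hr, fun {y} hy => by rwa [Real.dist_eq] at hy⟩
  have hr2 : ∀ᶠ t in nhdsWithin x (Set.Iio x), |t - x| < r := by
    apply nhdsWithin_le_nhds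
    exact Metric.eventually_nhds_iff.2 ⟨r, hr, fun {y} hy => by rwa [Real.dist_eq] at hy⟩
  have hR : Filter.Tendsto (slope φ x) (nhdsWithin x (Set.Ioi x)) (nhds d) :=
    hs.mono_left (nhdsWithin_mono _ (fun t ht => ne_of_gt ht))
  have hL : Filter.Tendsto (slope φ x) (nhdsWithin x (Set.Iio x)) (nhds d) :=
    hs.mono_left (nhdsWithin_mono _ (fun t ht => ne_of_lt ht))
  have hval : ∀ t, t ≠ x → φ t = slope φ x t * (t - x) := by
    intro t ht
    rw [slope_def_field, h0, sub_zero, div_mul_cancel₀ _ (sub_ne_zero.2 ht)]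
  rcases lt_or_gt_of_ne hd with hd | hd
  · obtain ⟨u, hu1, hu2, hu3⟩ :=
      ((hR.eventually_lt_const hd).and (hr1.and self_mem_nhdsWithin)).exists
    obtain ⟨v, hv1, hv2, hv3⟩ :=
      ((hL.eventually_lt_const hd).and (hr2.and self_mem_nhdsWithin)).exists
    refine ⟨u, v, hu2, hv2, ?_, ?_⟩
    · rw [hval u (ne_of_gt hu3)]
      exact mul_neg_of_neg_of_pos hu1 (sub_pos.2 hu3)
    · rw [hval v (ne_of_lt hv3)]
      exact mul_pos_of_neg_of_neg hv1 (sub_neg.2 hv3)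
  · obtain ⟨u, hu1, hu2, hu3⟩ :=
      ((hR.eventually_const_lt hd).and (hr1.and self_mem_nhdsWithin)).exists
    obtain ⟨v, hv1, hv2, hv3⟩ :=
      ((hL.eventually_const_lt hd).and (hr2.and self_mem_nhdsWithin)).exists
    refine ⟨v, u, hv2, hu2, ?_, ?_⟩
    · rw [hval v (ne_of_lt hv3)]
      exact mul_neg_of_pos_of_neg hv1 (sub_neg.2 hv3)
    · rw [hval u (ne_of_gt hu3)]
      exact mul_pos hu1 (sub_pos.2 hu3)

lemma bezout_isolated (F G : MvPolynomial (Fin 2) ℝ) (d1 d2 : ℕ)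
    (hF : F.totalDegree ≤ d1) (hG : G.totalDegree ≤ d2) (S : Finset (Fin 2 → ℝ))
    (hS0 : ∀ p ∈ S, eval p F = 0 ∧ eval p G = 0)
    (hS1 : ∀ p ∈ S, eval p (pderiv 0 F) ≠ 0)
    (hS2 : ∀ p ∈ S, ∀ᶠ q in nhds p, eval q F = 0 → eval q G = 0 → q = p) :
    S.card ≤ d1 * d2 := by
  classical
  rcases S.eq_empty_or_nonempty with h | ⟨p0, hp0⟩
  · simp [h]
  have hF0 : F ≠ 0 := by
    rintro rfl
    exact hS1 p0 hp0 (by simp)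
  obtain ⟨f, g, h, hrel, hf, hg⟩ := UniqueFactorizationMonoid.exists_reduced_factors F hF0 G
  have hh0 : h ≠ 0 := by rintro rfl; simp at hf; exact hF0 hf.symm
  have hf0 : f ≠ 0 := by rintro rfl; simp at hf; exact hF0 hf.symm
  have key : ∀ p ∈ S, eval p h ≠ 0 := by
    intro p hp hph
    have hd : eval p (pderiv 0 h) ≠ 0 := by
      intro hd
      apply hS1 p hp
      rw [← hf, Derivation.leibniz]
      simp [hph, hd]
    have hderiv : ∀ x y : ℝ, HasDerivAt (fun x => eval ![x, y] h)
        (eval ![x, y] (pderiv 0 h)) x := fun x y => hasDerivAt_eval_fst h x y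
    have hcont : Continuous fun q : Fin 2 → ℝ => eval q h := MvPolynomial.continuous_eval h
    have hpp : p = ![p 0, p 1] := by ext i; fin_cases i <;> rfl
    obtain ⟨r, hr, hball⟩ := Metric.eventually_nhds_iff.1 (hS2 p hp)
    have hsol : ∀ x y : ℝ, |x - p 0| < r → |y - p 1| < r → eval ![x, y] h = 0 → y = p 1 := by
      intro x y hx hy hxy
      have := @hball ![x, y] (by
        rw [dist_pi_lt_iff hr]
        intro i
        fin_cases i
        · simpa [Real.dist_eq] using hx
        · simpa [Real.dist_eq] using hy) (by rw [← hf]; simp [hxy]) (by rw [← hg]; simp [hxy])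
      have h1 := congrFun this 1
      simpa using h1
    -- a sign change
    have hsign : ∃ u v : ℝ, |u - p 0| < r ∧ |v - p 0| < r ∧
        eval ![u, p 1] h < 0 ∧ 0 < eval ![v, p 1] h := by
      have hd0 := hderiv (p 0) (p 1)
      rw [← hpp] at hd0
      have hz : (fun x => eval ![x, p 1] h) (p 0) = 0 := by
        simp only []; rw [← hpp]; exact hph
      exact sign_change_of_deriv _ _ _ hd0 hd hz r hr
    obtain ⟨u, v, hu, hv, hu0, hv0⟩ := hsign
    have hcu : ∀ x : ℝ, Continuous fun y : ℝ => eval ![x, y] h := by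
      intro x
      refine hcont.comp ?_
      refine continuous_pi fun i => ?_
      fin_cases i
      · exact continuous_const
      · exact continuous_id
    have ev1 : ∀ᶠ y in nhds (p 1), eval ![u, y] h < 0 := (hcu u).continuousAt.eventually_lt_const hu0
    have ev2 : ∀ᶠ y in nhds (p 1), 0 < eval ![v, y] h := (hcu v).continuousAt.eventually_const_lt hv0
    obtain ⟨r', hr', hb'⟩ := Metric.eventually_nhds_iff.1 (ev1.and ev2)
    set y := p 1 + min r r' / 2 with hy
    have hm : 0 < min r r' := lt_min hr hr'
    have hyr : |y - p 1| < r := by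
      rw [hy, add_sub_cancel_left, abs_of_pos (by positivity)]
      have := min_le_left r r'
      linarith
    have hyr' : dist y (p 1) < r' := by
      rw [Real.dist_eq, hy, add_sub_cancel_left, abs_of_pos (by positivity)]
      have := min_le_right r r'
      linarith
    obtain ⟨h1, h2⟩ := hb' hyr'
    have hcx : Continuous fun x : ℝ => eval ![x, y] h :=
      continuous_iff_continuousAt.2 fun x => (hderiv x y).continuousAt
    obtain ⟨x, hx, hx0⟩ := intermediate_value_uIcc (a := u) (b := v) hcx.continuousOn
      (show (0:ℝ) ∈ Set.uIcc _ _ from Set.mem_uIcc.2 (Or.inl ⟨h1.le, h2.le⟩))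
    have hxr : |x - p 0| < r := by
      rw [abs_lt] at *
      rcases Set.mem_uIcc.1 hx with hx | hx <;> constructor <;> linarith [hx.1, hx.2]
    have := hsol x y hxr hyr hx0
    rw [hy] at this
    linarith
  have hSfg : ∀ p ∈ S, eval p f = 0 ∧ eval p g = 0 := by
    intro p hp
    obtain ⟨h1, h2⟩ := hS0 p hp
    rw [← hf, map_mul] at h1
    rw [← hg, map_mul] at h2
    exact ⟨(mul_eq_zero.1 h1).resolve_left (key p hp), (mul_eq_zero.1 h2).resolve_left (key p hp)⟩
  by_cases hg0 : g = 0
  · exfalso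
    have hu : IsUnit f := hrel dvd_rfl (by rw [hg0]; exact dvd_zero _)
    have h2 := hu.map (eval p0)
    rw [(hSfg p0 hp0).1] at h2
    exact not_isUnit_zero h2
  · refine (bezout_bound f g hg0 hrel S hSfg).trans ?_
    refine Nat.mul_le_mul ?_ ?_
    · rw [← hf, totalDegree_mul_of_isDomain hh0 hf0] at hF
      omega
    · rw [← hg, totalDegree_mul_of_isDomain hh0 hg0] at hG
      omega

end Bezout

section Alg

open Polynomial

lemma totalDegree_aeval_X (i : Fin 2) (A : ℝ[X]) :
    (aeval (MvPolynomial.X i : MvPolynomial (Fin 2) ℝ) A).totalDegree ≤ A.natDegree := by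
  rw [aeval_eq_sum_range]
  refine (MvPolynomial.totalDegree_finsetSum _ _).trans ?_
  refine Finset.sup_le fun j hj => ?_
  refine (MvPolynomial.totalDegree_smul_le _ _).trans ?_
  rw [MvPolynomial.totalDegree_X_pow]
  simp at hj
  omega

lemma eval_aeval_X (i : Fin 2) (A : ℝ[X]) (p : Fin 2 → ℝ) :
    MvPolynomial.eval p (aeval (MvPolynomial.X i : MvPolynomial (Fin 2) ℝ) A) = A.eval (p i) := by
  rw [aeval_eq_sum_range, eval_eq_sum_range]
  simp [MvPolynomial.smul_eval]

lemma natDegree_reflect (n : ℕ) (A : ℝ[X]) (hA : A.natDegree ≤ n + 1) (s : ℝ) :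
    (A - C ((-1 : ℝ)^(n+1)) * A.comp (C s - X)).natDegree ≤ n := by
  have hlin : (C s - X : ℝ[X]).natDegree = 1 := by
    rw [natDegree_sub, natDegree_X_sub_C]
  have hlead : (C s - X : ℝ[X]).leadingCoeff = -1 := by
    rw [leadingCoeff, hlin]; simp
  have hcomp : (A.comp (C s - X)).natDegree = A.natDegree := by
    rw [natDegree_comp, hlin, mul_one]
  have hle : (A - C ((-1 : ℝ)^(n+1)) * A.comp (C s - X)).natDegree ≤ A.natDegree := by
    refine (natDegree_sub_le _ _).trans (max_le le_rfl ?_)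
    exact (natDegree_C_mul_le _ _).trans hcomp.le
  rcases hA.lt_or_eq with h | h
  · omega
  · rw [natDegree_le_iff_coeff_eq_zero]
    intro N hN
    rcases Nat.lt_or_ge (n+1) N with h1 | h1
    · exact coeff_eq_zero_of_natDegree_lt (by omega)
    · have hN1 : N = n + 1 := by omega
      have := coeff_comp_degree_mul_degree (p := A) (q := C s - X) (by rw [hlin]; simp)
      rw [hlin, mul_one, hlead, h] at this
      rw [hN1, coeff_sub, coeff_C_mul, this, leadingCoeff, h]
      have h2 : ((-1 : ℝ)^(n+1)) * ((-1 : ℝ)^(n+1)) = 1 := by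
        rw [← mul_pow]; simp
      linear_combination (-A.coeff (n+1)) * h2

lemma alg_bound (n : ℕ) (A B : ℝ[X]) (hA : A.natDegree ≤ n + 1) (hB : B.natDegree ≤ n + 1)
    (s s' : ℝ) (S : Finset (Fin 2 → ℝ))
    (hS0 : ∀ p ∈ S, A.eval (p 0) = B.eval (p 1) ∧ A.eval (s - p 0) = B.eval (s' - p 1))
    (hS1 : ∀ p ∈ S, A.derivative.eval (p 0) ≠ 0)
    (hS2 : ∀ p ∈ S, ∀ᶠ q in nhds p, A.eval (q 0) = B.eval (q 1) →
      A.eval (s - q 0) = B.eval (s' - q 1) → q = p) :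
    S.card ≤ (n + 1) * n := by
  set ε : ℝ := (-1 : ℝ)^(n+1) with hε
  have hε0 : ε ≠ 0 := by rw [hε]; positivity
  let F : MvPolynomial (Fin 2) ℝ := aeval (MvPolynomial.X 0) A - aeval (MvPolynomial.X 1) B
  let G : MvPolynomial (Fin 2) ℝ := aeval (MvPolynomial.X 0) (A - C ε * A.comp (C s - X)) -
    aeval (MvPolynomial.X 1) (B - C ε * B.comp (C s' - X))
  have hFe : ∀ p, MvPolynomial.eval p F = A.eval (p 0) - B.eval (p 1) := by
    intro p; simp [F, eval_aeval_X]
  have hGe : ∀ p, MvPolynomial.eval p G = (A.eval (p 0) - B.eval (p 1)) -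
      ε * (A.eval (s - p 0) - B.eval (s' - p 1)) := by
    intro p
    simp only [G, map_sub (MvPolynomial.eval p), eval_aeval_X]
    simp only [eval_sub, eval_mul, eval_C, eval_comp, eval_X]
    ring
  refine bezout_isolated F G (n+1) n ?_ ?_ S ?_ ?_ ?_
  · refine (MvPolynomial.totalDegree_sub _ _).trans (max_le ?_ ?_)
    · exact (totalDegree_aeval_X _ _).trans hA
    · exact (totalDegree_aeval_X _ _).trans hB
  · refine (MvPolynomial.totalDegree_sub _ _).trans (max_le ?_ ?_)
    · exact (totalDegree_aeval_X _ _).trans (natDegree_reflect n A hA s)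
    · exact (totalDegree_aeval_X _ _).trans (natDegree_reflect n B hB s')
  · intro p hp
    obtain ⟨h1, h2⟩ := hS0 p hp
    rw [hFe, hGe, h1, h2]
    simp
  · intro p hp
    have : MvPolynomial.pderiv 0 F = aeval (MvPolynomial.X 0) A.derivative := by
      simp [F, Derivation.map_aeval, MvPolynomial.pderiv_X]
    rw [this, eval_aeval_X]
    exact hS1 p hp
  · intro p hp
    filter_upwards [hS2 p hp] with q hq h1 h2
    rw [hFe] at h1
    rw [hGe, h1, zero_sub, neg_eq_zero] at h2
    exact hq (sub_eq_zero.1 h1) (sub_eq_zero.1 ((mul_eq_zero.1 h2).resolve_left hε0))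

lemma exists_im_poly (R : ℂ[X]) : ∃ A : ℝ[X], A.natDegree ≤ R.natDegree ∧
    ∀ x : ℝ, A.eval x = (R.eval (x : ℂ)).im := by
  refine ⟨∑ i ∈ Finset.range (R.natDegree + 1), C (R.coeff i).im * X ^ i, ?_, ?_⟩
  · refine natDegree_sum_le_of_forall_le _ _ fun i hi => ?_
    refine (natDegree_C_mul_X_pow_le _ _).trans ?_
    simp at hi
    omega
  · intro x
    rw [eval_finsetSum, eval_eq_sum_range, Complex.im_sum]
    refine Finset.sum_congr rfl fun i _ => ?_
    rw [← Complex.ofReal_pow, Complex.im_mul_ofReal]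
    simp

/-- the primitive of the central denominator -/
noncomputable def primC (n : ℕ) (zc : ℕ → ℂ) : ℂ → ℂ :=
  fun w => ∑ j ∈ Finset.range (n+1), zc j / ((j : ℂ) + 1) * w ^ (j + 1)

lemma hasDerivAt_primC (n : ℕ) (zc : ℕ → ℂ) (w : ℂ) :
    HasDerivAt (primC n zc) (∑ j ∈ Finset.range (n+1), zc j * w ^ j) w := by
  unfold primC
  refine HasDerivAt.fun_sum fun j _ => ?_
  refine ((hasDerivAt_pow (j+1) w).const_mul (zc j / ((j : ℂ) + 1))).congr_deriv ?_
  have : (j : ℂ) + 1 ≠ 0 := by exact_mod_cast Nat.succ_ne_zero j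
  push_cast
  field_simp

lemma exists_line_poly (n : ℕ) (zc : ℕ → ℂ) (c : ℂ) :
    ∃ A : ℝ[X], A.natDegree ≤ n + 1 ∧ (∀ x : ℝ, A.eval x = (primC n zc (x + c)).im) ∧
      ∀ x : ℝ, A.derivative.eval x = (∑ j ∈ Finset.range (n+1), zc j * ((x : ℂ) + c) ^ j).im := by
  let R : ℂ[X] := (∑ j ∈ Finset.range (n+1), C (zc j / ((j : ℂ) + 1)) * X ^ (j + 1)).comp (X + C c)
  have hR : R.natDegree ≤ n + 1 := by
    simp only [R]
    rw [natDegree_comp, natDegree_X_add_C, mul_one]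
    refine natDegree_sum_le_of_forall_le _ _ fun i hi => ?_
    refine (natDegree_C_mul_X_pow_le _ _).trans ?_
    simp at hi
    omega
  obtain ⟨A, hA, hA2⟩ := exists_im_poly R
  have hA3 : ∀ x : ℝ, A.eval x = (primC n zc (x + c)).im := by
    intro x
    rw [hA2]
    simp [R, primC, eval_finsetSum]
  refine ⟨A, hA.trans hR, hA3, fun x => ?_⟩
  have h1 := A.hasDerivAt x
  have h2 : HasDerivAt (fun x : ℝ => primC n zc ((x : ℂ) + c))
      (∑ j ∈ Finset.range (n+1), zc j * ((x : ℂ) + c) ^ j) x := by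
    have := (hasDerivAt_primC n zc ((x:ℂ) + c)).scomp x
      ((Complex.ofRealCLM.hasDerivAt (x := x)).add_const c)
    simpa [Function.comp_def] using this
  have h3 := Complex.imCLM.hasFDerivAt.comp_hasDerivAt x h2
  have h4 : (fun x => A.eval x) = Complex.imCLM ∘ fun x : ℝ => primC n zc ((x : ℂ) + c) := by
    funext x; simp [hA3]
  rw [h4] at h1
  exact h1.unique h3

end Alg

/-! ### Section 2: arcs and their perturbation -/

section Arcs

open Filter Topology

def IsArc (Z U : Set ℂ) (f : ℂ → ℂ) (p q : ℂ) : Prop :=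
  ∃ τ : ℝ, 0 < τ ∧ ∃ γ : ℝ → ℂ, ContinuousOn γ (Set.Icc 0 τ) ∧ γ 0 = p ∧ γ τ = q ∧
    (∀ t ∈ Set.Ioo 0 τ, γ t ∈ Z ∧ HasDerivAt γ (f (γ t)) t) ∧ ∀ t ∈ Set.Icc 0 τ, γ t ∈ U

lemma prim_eq (Q P : ℂ → ℂ) (hQ : ∀ z, HasDerivAt Q (P z) z) (γ : ℝ → ℂ) (a b : ℝ) (hab : a < b)
    (hc : ContinuousOn γ (Set.Icc a b))
    (hd : ∀ t ∈ Set.Ioo a b, HasDerivAt γ (1 / P (γ t)) t)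
    (hne : ∀ t ∈ Set.Ioo a b, P (γ t) ≠ 0) :
    ∀ t ∈ Set.Icc a b, Q (γ t) = Q (γ a) + ((t - a : ℝ) : ℂ) := by
  have hQc : Continuous Q := continuous_iff_continuousAt.2 fun z => (hQ z).continuousAt
  set φ : ℝ → ℂ := fun t => Q (γ t) - (t : ℂ) with hφ
  have hφc : ContinuousOn φ (Set.Icc a b) :=
    (hQc.comp_continuousOn hc).sub Complex.continuous_ofReal.continuousOn
  have hφd : ∀ t ∈ Set.Ioo a b, HasDerivAt φ 0 t := by
    intro t ht
    have h1 := (hQ (γ t)).scomp t (hd t ht)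
    have h2 := h1.sub (Complex.ofRealCLM.hasDerivAt (x := t))
    refine h2.congr_deriv ?_
    simp [hne t ht]
  obtain ⟨c, hcc⟩ : ∃ c, ∀ t ∈ Set.Ioo a b, φ t = c :=
    isOpen_Ioo.exists_is_const_of_deriv_eq_zero isPreconnected_Ioo
      (fun t ht => (hφd t ht).differentiableAt.differentiableWithinAt)
      (fun t ht => (hφd t ht).deriv)
  have heq : Set.EqOn φ (fun _ => c) (Set.Icc a b) :=
    Set.EqOn.of_subset_closure (fun t ht => hcc t ht) hφc continuousOn_const
      Set.Ioo_subset_Icc_self (by rw [closure_Ioo hab.ne])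
  intro t ht
  have h1 := heq ht
  have h2 := heq (Set.left_mem_Icc.2 hab.le)
  simp only [hφ] at h1 h2
  push_cast
  linear_combination h1 - h2

lemma mono_ball (Ψ g : ℂ → ℂ) (ℓ : ℂ →L[ℝ] ℝ) (c : ℂ) (r : ℝ)
    (hd : ∀ w ∈ Metric.ball c r, HasDerivAt Ψ (g w) w)
    (hpos : ∀ w ∈ Metric.ball c r, 0 < ℓ (g w)) (w : ℂ) (u : ℝ) (hu : 0 < u)
    (hw : w ∈ Metric.ball c r) (hwu : w + (u : ℂ) ∈ Metric.ball c r) :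
    ℓ (Ψ w) < ℓ (Ψ (w + (u : ℂ))) := by
  have hmem : ∀ t ∈ Set.Icc (0:ℝ) u, w + (t : ℂ) ∈ Metric.ball c r := by
    intro t ht
    have := (convex_ball c r).add_smul_mem hw hwu (t := t / u)
      ⟨div_nonneg ht.1 hu.le, (div_le_one hu).2 ht.2⟩
    convert this using 2
    have : (u : ℂ) ≠ 0 := by exact_mod_cast hu.ne'
    rw [Complex.real_smul]
    push_cast
    field_simp
  have hder : ∀ t ∈ Set.Icc (0:ℝ) u, HasDerivAt (fun t : ℝ => ℓ (Ψ (w + (t : ℂ))))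
      (ℓ (g (w + (t : ℂ)))) t := by
    intro t ht
    have h1 : HasDerivAt (fun t : ℝ => w + (t : ℂ)) 1 t := by
      simpa using (Complex.ofRealCLM.hasDerivAt (x := t)).const_add w
    have h2 := (hd _ (hmem t ht)).scomp t h1
    have h3 := ℓ.hasFDerivAt.comp_hasDerivAt t h2
    simpa [Function.comp_def] using h3
  have hmono : StrictMonoOn (fun t : ℝ => ℓ (Ψ (w + (t : ℂ)))) (Set.Icc 0 u) := by
    refine strictMonoOn_of_deriv_pos (convex_Icc _ _)
      (fun t ht => (hder t ht).continuousAt.continuousWithinAt) fun t ht => ?_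
    rw [interior_Icc] at ht
    have ht' := Set.Ioo_subset_Icc_self ht
    rw [(hder t ht').deriv]
    exact hpos _ (hmem t ht')
  have := hmono (Set.left_mem_Icc.2 hu.le) (Set.right_mem_Icc.2 hu.le) hu
  simpa using this

lemma exists_inverse (Q P : ℂ → ℂ) (hQ : ∀ z, HasStrictDerivAt Q (P z) z) (hP : Continuous P)
    (K U : Set ℂ) (hK : IsCompact K) (hU : IsOpen U) (hKU : K ⊆ U) (hinj : Set.InjOn Q K)
    (hne : ∀ z ∈ K, P z ≠ 0) :
    ∃ (O W : Set ℂ) (Ψ : ℂ → ℂ), IsOpen O ∧ IsOpen W ∧ K ⊆ O ∧ O ⊆ U ∧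
      (∀ z ∈ O, Q z ∈ W ∧ Ψ (Q z) = z) ∧ (∀ w ∈ W, Ψ w ∈ O ∧ Q (Ψ w) = w) ∧
      (∀ w ∈ W, HasDerivAt Ψ (1 / P (Ψ w)) w) ∧ ∀ z ∈ O, P z ≠ 0 := by
  obtain ⟨t, ht, hti⟩ := hinj.exists_mem_nhdsSet hK
    (fun x _ => (hQ x).hasDerivAt.continuousAt)
    (fun x hx => by
      let e := (hQ x).hasStrictFDerivAt_equiv (hne x hx)
      exact ⟨(e.toOpenPartialHomeomorph Q).source,
        (e.toOpenPartialHomeomorph Q).open_source.mem_nhds e.mem_toOpenPartialHomeomorph_source,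
        (e.toOpenPartialHomeomorph Q).injOn⟩)
  obtain ⟨O0, hO0, hKO0, hO0t⟩ := mem_nhdsSet_iff_exists.1 ht
  have hPo : IsOpen {z | P z ≠ 0} := isOpen_ne_fun hP continuous_const
  set O := O0 ∩ U ∩ {z | P z ≠ 0} with hO
  have hOo : IsOpen O := (hO0.inter hU).inter hPo
  have hOne : ∀ z ∈ O, P z ≠ 0 := fun z hz => hz.2
  have hOi : Set.InjOn Q O := hti.mono (fun z hz => hO0t hz.1.1)
  have himg : ∀ z ∈ O, ∀ N ∈ 𝓝 z, Q '' N ∈ 𝓝 (Q z) := by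
    intro z hz N hN
    rw [← (hQ z).map_nhds_eq (hOne z hz)]
    exact Filter.image_mem_map hN
  set Ψ := Function.invFunOn Q O with hΨ
  have hl : Set.LeftInvOn Ψ Q O := hOi.leftInvOn_invFunOn
  have hWo : IsOpen (Q '' O) := by
    rw [isOpen_iff_mem_nhds]
    rintro _ ⟨z, hz, rfl⟩
    exact himg z hz O (hOo.mem_nhds hz)
  have hW2 : ∀ w ∈ Q '' O, Ψ w ∈ O ∧ Q (Ψ w) = w := by
    rintro _ ⟨z, hz, rfl⟩
    rw [hl hz]
    exact ⟨hz, rfl⟩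
  refine ⟨O, Q '' O, Ψ, hOo, hWo, ?_, fun z hz => hz.1.2, fun z hz => ⟨⟨z, hz, rfl⟩, hl hz⟩,
    hW2, ?_, hOne⟩
  · exact fun z hz => ⟨⟨hKO0 hz, hKU hz⟩, hne z hz⟩
  · intro w hw
    have hcont : ContinuousAt Ψ w := by
      obtain ⟨z, hz, rfl⟩ := hw
      intro N hN
      rw [hl hz] at hN
      have := himg z hz (N ∩ O) (Filter.inter_mem hN (hOo.mem_nhds hz))
      rw [Filter.mem_map]
      refine Filter.mem_of_superset this ?_
      rintro _ ⟨y, hy, rfl⟩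
      change Ψ (Q y) ∈ N
      rw [hl hy.2]
      exact hy.1
    rw [one_div]
    refine HasDerivAt.of_local_left_inverse hcont (hQ _).hasDerivAt (hOne _ (hW2 w hw).1) ?_
    filter_upwards [hWo.mem_nhds hw] with y hy using (hW2 y hy).2

lemma arc_perturb (Q P : ℂ → ℂ) (hQ : ∀ z, HasDerivAt Q (P z) z) (hP : Continuous P)
    (Z U : Set ℂ) (hZ : IsOpen Z) (hU : IsOpen U) (γ : ℝ → ℂ) (a b : ℝ) (hab : a < b)
    (hc : ContinuousOn γ (Set.Icc a b))
    (hd : ∀ t ∈ Set.Ioo a b, HasDerivAt γ (1 / P (γ t)) t)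
    (hγZ : ∀ t ∈ Set.Ioo a b, γ t ∈ Z)
    (hne : ∀ t ∈ Set.Icc a b, P (γ t) ≠ 0) (hγU : ∀ t ∈ Set.Icc a b, γ t ∈ U)
    (ℓp ℓq : ℂ →L[ℝ] ℝ)
    (hZp : ∀ᶠ w in 𝓝 (γ a), ℓp (γ a) < ℓp w → w ∈ Z) (hlp : 0 < ℓp (1 / P (γ a)))
    (hZq : ∀ᶠ w in 𝓝 (γ b), ℓq w < ℓq (γ b) → w ∈ Z) (hlq : 0 < ℓq (1 / P (γ b))) :
    ∀ᶠ x in 𝓝 (γ a, γ b), ℓp x.1 = ℓp (γ a) → ℓq x.2 = ℓq (γ b) →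
      (Q x.1).im = (Q x.2).im → IsArc Z U (fun w => 1 / P w) x.1 x.2 := by
  have hQc : Continuous Q := continuous_iff_continuousAt.2 fun z => (hQ z).continuousAt
  have hQs : ∀ z, HasStrictDerivAt Q (P z) z := fun z =>
    hasStrictDerivAt_of_hasDerivAt_of_continuousAt (Filter.Eventually.of_forall hQ)
      hP.continuousAt
  have hprim := prim_eq Q P hQ γ a b hab hc hd (fun t ht => hne t (Set.Ioo_subset_Icc_self ht))
  obtain ⟨O, W, Ψ, hOo, hWo, hKO, hOU, hO1, hW1, hΨd, hOne⟩ :=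
    exists_inverse Q P hQs hP (γ '' Set.Icc a b) U (isCompact_Icc.image_of_continuousOn hc) hU
      (by rintro _ ⟨t, ht, rfl⟩; exact hγU t ht)
      (by
        rintro _ ⟨t, ht, rfl⟩ _ ⟨s, hs, rfl⟩ h
        rw [hprim t ht, hprim s hs, add_right_inj] at h
        have h' := Complex.ofReal_injective h
        rw [show t = s by linarith])
      (by rintro _ ⟨t, ht, rfl⟩; exact hne t ht)
  have hγO : ∀ t ∈ Set.Icc a b, γ t ∈ O := fun t ht => hKO ⟨t, ht, rfl⟩
  have haI : a ∈ Set.Icc a b := Set.left_mem_Icc.2 hab.le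
  have hbI : b ∈ Set.Icc a b := Set.right_mem_Icc.2 hab.le
  have hτ := hprim b hbI
  have hΨc : ∀ w ∈ W, ContinuousAt Ψ w := fun w hw => (hΨd w hw).continuousAt
  set m : (ℂ × ℂ) × ℝ → ℂ := fun x => Q x.1.1 + (x.2 : ℂ) * (Q x.1.2 - Q x.1.1) with hm
  have hmc : Continuous m := by
    rw [hm]
    fun_prop
  set x0 : ℂ × ℂ := (γ a, γ b) with hx0
  have hm0 : ∀ θ ∈ Set.Icc (0:ℝ) 1, a + θ * (b - a) ∈ Set.Icc a b ∧
      m (x0, θ) = Q (γ (a + θ * (b - a))) := by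
    intro θ hθ
    have hmem : a + θ * (b - a) ∈ Set.Icc a b := by
      constructor <;> nlinarith [hθ.1, hθ.2]
    refine ⟨hmem, ?_⟩
    rw [hprim _ hmem]
    simp only [hm, hx0, hτ]
    push_cast
    ring
  have hm0W : ∀ θ ∈ Set.Icc (0:ℝ) 1, m (x0, θ) ∈ W := by
    intro θ hθ
    rw [(hm0 θ hθ).2]
    exact (hO1 _ (hγO _ (hm0 θ hθ).1)).1
  have evW : ∀ᶠ x in 𝓝 x0, ∀ θ ∈ Set.Icc (0:ℝ) 1, m (x, θ) ∈ W := by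
    refine isCompact_Icc.eventually_forall_of_forall_eventually fun θ hθ => ?_
    exact hmc.continuousAt.eventually (hWo.mem_nhds (hm0W θ hθ))
  have evτ : ∀ᶠ x in 𝓝 x0, 0 < (Q x.2 - Q x.1).re := by
    have h1 : Continuous fun x : ℂ × ℂ => (Q x.2 - Q x.1).re := by fun_prop
    refine h1.continuousAt.eventually_const_lt ?_
    simp [hx0, hτ, hab]
  have evO : ∀ᶠ x in 𝓝 x0, x.1 ∈ O ∧ x.2 ∈ O := by
    refine Filter.Eventually.and ?_ ?_
    · exact continuous_fst.continuousAt.eventually (hOo.mem_nhds (hγO a haI))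
    · exact continuous_snd.continuousAt.eventually (hOo.mem_nhds (hγO b hbI))
  -- good balls
  have ball : ∀ (ℓ : ℂ →L[ℝ] ℝ) (c : ℂ), c ∈ O → 0 < ℓ (1 / P c) → ∀ N ∈ 𝓝 c,
      ∃ r > 0, (∀ w ∈ Metric.ball (Q c) r, HasDerivAt Ψ (1 / P (Ψ w)) w) ∧
        (∀ w ∈ Metric.ball (Q c) r, 0 < ℓ (1 / P (Ψ w))) ∧
        (∀ w ∈ Metric.ball (Q c) r, Ψ w ∈ N) := by
    intro ℓ c hcO hpos N hN
    obtain ⟨hcW, hcΨ⟩ := hO1 c hcO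
    have h1 : ∀ᶠ w in 𝓝 (Q c), HasDerivAt Ψ (1 / P (Ψ w)) w :=
      Filter.mem_of_superset (hWo.mem_nhds hcW) (fun w hw => hΨd w hw)
    have h2 : ∀ᶠ w in 𝓝 (Q c), 0 < ℓ (1 / P (Ψ w)) := by
      have hcont : ContinuousAt (fun w => ℓ (1 / P (Ψ w))) (Q c) := by
        refine ℓ.continuous.continuousAt.comp ?_
        refine continuousAt_const.div (hP.continuousAt.comp (hΨc _ hcW)) ?_
        rw [hcΨ]; exact hOne c hcO
      refine hcont.eventually_const_lt ?_
      simp only [hcΨ]; exact hpos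
    have h3 : ∀ᶠ w in 𝓝 (Q c), Ψ w ∈ N := by
      refine (hΨc _ hcW).eventually ?_
      rw [hcΨ]; exact hN
    obtain ⟨r, hr, hb⟩ := Metric.eventually_nhds_iff_ball.1 (h1.and (h2.and h3))
    exact ⟨r, hr, fun w hw => (hb w hw).1, fun w hw => (hb w hw).2.1, fun w hw => (hb w hw).2.2⟩
  have evZ : ∀ᶠ x in 𝓝 x0, ∀ θ ∈ Set.Icc (0:ℝ) 1, (x.1 ∈ O ∧ x.2 ∈ O) → 0 < (Q x.2 - Q x.1).re →
      ℓp x.1 = ℓp (γ a) → ℓq x.2 = ℓq (γ b) →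
      (Q x.1).im = (Q x.2).im → 0 < θ → θ < 1 → Ψ (m (x, θ)) ∈ Z := by
    refine isCompact_Icc.eventually_forall_of_forall_eventually fun θ hθ => ?_
    have hreal : ∀ x : ℂ × ℂ, (Q x.1).im = (Q x.2).im →
        Q x.2 - Q x.1 = (((Q x.2 - Q x.1).re : ℝ) : ℂ) := by
      intro x hx
      apply Complex.ext <;> simp [hx]
    rcases hθ.1.eq_or_lt with h0 | h0
    · -- near the start
      subst h0
      obtain ⟨r, hr, hb1, hb2, hb3⟩ := ball ℓp (γ a) (hγO a haI) hlp _ hZp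
      have e1 : ∀ᶠ x in 𝓝 (x0, (0:ℝ)), m x ∈ Metric.ball (Q (γ a)) r := by
        refine hmc.continuousAt.eventually (Metric.isOpen_ball.mem_nhds ?_)
        simp [hm, hx0, hr]
      have e2 : ∀ᶠ x in 𝓝 (x0, (0:ℝ)), Q x.1.1 ∈ Metric.ball (Q (γ a)) r := by
        have : Continuous fun x : (ℂ × ℂ) × ℝ => Q x.1.1 := by fun_prop
        refine this.continuousAt.eventually (Metric.isOpen_ball.mem_nhds ?_)
        simp [hx0, hr]
      filter_upwards [e1, e2] with x h1 h2 hO' hτ' hp' hq' him hpos hlt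
      have hmx : m x = Q x.1.1 + ((x.2 * (Q x.1.2 - Q x.1.1).re : ℝ) : ℂ) := by
        simp only [hm]
        rw [Complex.ofReal_mul, ← hreal x.1 him]
      have hlt' := mono_ball Ψ _ ℓp _ r hb1 hb2 (Q x.1.1) (x.2 * (Q x.1.2 - Q x.1.1).re)
        (mul_pos hpos hτ') h2 (by rw [← hmx]; exact h1)
      rw [← hmx, (hO1 _ hO'.1).2, hp'] at hlt'
      exact hb3 _ h1 hlt'
    · rcases hθ.2.eq_or_lt with h1 | h1
      · subst h1
        obtain ⟨r, hr, hb1, hb2, hb3⟩ := ball ℓq (γ b) (hγO b hbI) hlq _ hZq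
        have e1 : ∀ᶠ x in 𝓝 (x0, (1:ℝ)), m x ∈ Metric.ball (Q (γ b)) r := by
          refine hmc.continuousAt.eventually (Metric.isOpen_ball.mem_nhds ?_)
          simp [hm, hx0, hr]
        have e2 : ∀ᶠ x in 𝓝 (x0, (1:ℝ)), Q x.1.2 ∈ Metric.ball (Q (γ b)) r := by
          have : Continuous fun x : (ℂ × ℂ) × ℝ => Q x.1.2 := by fun_prop
          refine this.continuousAt.eventually (Metric.isOpen_ball.mem_nhds ?_)
          simp [hx0, hr]
        filter_upwards [e1, e2] with x h1 h2 hO' hτ' hp' hq' him hpos hlt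
        have hmx : m x + (((1 - x.2) * (Q x.1.2 - Q x.1.1).re : ℝ) : ℂ) = Q x.1.2 := by
          simp only [hm]
          rw [Complex.ofReal_mul, ← hreal x.1 him]
          push_cast
          ring
        have hlt' := mono_ball Ψ _ ℓq _ r hb1 hb2 (m x) ((1 - x.2) * (Q x.1.2 - Q x.1.1).re)
          (mul_pos (by linarith) hτ') h1 (by rw [hmx]; exact h2)
        rw [hmx, (hO1 _ hO'.2).2, hq'] at hlt'
        exact hb3 _ h1 hlt'
      · have hcm : ContinuousAt (fun x => Ψ (m x)) (x0, θ) :=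
          ContinuousAt.comp (hΨc _ (hm0W θ hθ)) hmc.continuousAt
        have hin : Ψ (m (x0, θ)) ∈ Z := by
          rw [(hm0 θ hθ).2, (hO1 _ (hγO _ (hm0 θ hθ).1)).2]
          apply hγZ
          constructor <;> nlinarith
        filter_upwards [hcm.eventually (hZ.mem_nhds hin)] with x hx _ _ _ _ _ _ _
        exact hx
  filter_upwards [evW, evτ, evO, evZ] with x hxW hxτ hxO hxZ hp' hq' him
  set τ := (Q x.2 - Q x.1).re with hτdef
  have hreal : Q x.2 - Q x.1 = (τ : ℂ) := by
    apply Complex.ext <;> simp [him, hτdef]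
  have hmt : ∀ t : ℝ, m (x, t / τ) = Q x.1 + (t : ℂ) := by
    intro t
    simp only [hm]
    have : (τ : ℂ) ≠ 0 := by exact_mod_cast hxτ.ne'
    rw [hreal]
    push_cast
    field_simp
  have hIcc : ∀ t ∈ Set.Icc 0 τ, t / τ ∈ Set.Icc (0:ℝ) 1 := fun t ht =>
    ⟨div_nonneg ht.1 hxτ.le, (div_le_one hxτ).2 ht.2⟩
  have hWt : ∀ t ∈ Set.Icc 0 τ, Q x.1 + (t : ℂ) ∈ W := by
    intro t ht
    rw [← hmt]
    exact hxW _ (hIcc t ht)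
  have hdt : ∀ t ∈ Set.Icc 0 τ, HasDerivAt (fun t : ℝ => Ψ (Q x.1 + (t : ℂ)))
      (1 / P (Ψ (Q x.1 + (t : ℂ)))) t := by
    intro t ht
    have h1 : HasDerivAt (fun t : ℝ => Q x.1 + (t : ℂ)) 1 t := by
      simpa using (Complex.ofRealCLM.hasDerivAt (x := t)).const_add (Q x.1)
    have h2 := (hΨd _ (hWt t ht)).scomp t h1
    simpa [Function.comp_def] using h2
  refine ⟨τ, hxτ, fun t => Ψ (Q x.1 + (t : ℂ)), ?_, ?_, ?_, ?_, ?_⟩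
  · exact fun t ht => (hdt t ht).continuousAt.continuousWithinAt
  · simp [(hO1 _ hxO.1).2]
  · have : Q x.1 + (τ : ℂ) = Q x.2 := by rw [← hreal]; ring
    simp only [this, (hO1 _ hxO.2).2]
  · intro t ht
    refine ⟨?_, hdt t (Set.Ioo_subset_Icc_self ht)⟩
    simp only [← hmt]
    exact hxZ _ (hIcc t (Set.Ioo_subset_Icc_self ht)) hxO hxτ hp' hq' him
      (div_pos ht.1 hxτ) ((div_lt_one hxτ).2 ht.2)
  · intro t ht
    exact hOU (hW1 _ (hWt t ht)).1

end Arcs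

/-! ### Section 3: gluing arcs into a crossing periodic orbit -/

section Glue

open Filter Topology

variable {ι : Type} (zones : ι → Set ℂ) (fields : ι → ℂ → ℂ) (curves : Set (ℂ → ℝ))

def Transv (σ₁ σ₂ : ι) (p : ℂ) : Prop :=
  ∀ g ∈ curves, g p = 0 →
    fderiv ℝ g p (fields σ₁ p) ≠ 0 ∧ fderiv ℝ g p (fields σ₂ p) ≠ 0 ∧
    (0 < fderiv ℝ g p (fields σ₁ p) ↔ 0 < fderiv ℝ g p (fields σ₂ p))

def GoodAt (γ : ℝ → ℂ) (t : ℝ) : Prop :=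
  (∀ σ : ι, γ t ∈ zones σ → HasDerivAt γ (fields σ (γ t)) t) ∧
  ((∃ g ∈ curves, g (γ t) = 0) → ∃ σ₁ σ₂ : ι, σ₁ ≠ σ₂ ∧
        (∃ ε > 0, (∀ s ∈ Set.Ioo (t - ε) t, γ s ∈ zones σ₁) ∧
                  (∀ s ∈ Set.Ioo t (t + ε), γ s ∈ zones σ₂)) ∧
        Transv fields curves σ₁ σ₂ (γ t))

structure GoodPath (U : Set ℂ) (p q : ℂ) (σs σe : ι) (τ : ℝ) (γ : ℝ → ℂ) : Prop where
  pos : 0 < τ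
  cont : ContinuousOn γ (Set.Icc 0 τ)
  start : γ 0 = p
  endEq : γ τ = q
  good : ∀ t ∈ Set.Ioo 0 τ, GoodAt zones fields curves γ t
  fin : {t ∈ Set.Icc 0 τ | ∃ g ∈ curves, g (γ t) = 0}.Finite
  zs : ∃ ε > 0, ε ≤ τ ∧ ∀ s ∈ Set.Ioo 0 ε, γ s ∈ zones σs
  ze : ∃ ε > 0, ε ≤ τ ∧ ∀ s ∈ Set.Ioo (τ - ε) τ, γ s ∈ zones σe
  inU : ∀ t ∈ Set.Icc 0 τ, γ t ∈ U

variable {zones fields curves}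

lemma GoodAt.congr {γ γ' : ℝ → ℂ} {t c : ℝ} (h : GoodAt zones fields curves γ' (t - c))
    (he : ∀ᶠ s in 𝓝 t, γ s = γ' (s - c)) : GoodAt zones fields curves γ t := by
  have h0 : γ t = γ' (t - c) := he.self_of_nhds
  refine ⟨fun σ hσ => ?_, fun hg => ?_⟩
  · rw [h0] at hσ ⊢
    have h1 := h.1 σ hσ
    have h2 := HasDerivAt.comp_sub_const t c h1
    exact h2.congr_of_eventuallyEq he
  · rw [h0] at hg ⊢
    obtain ⟨σ₁, σ₂, hne, ⟨ε, hε, h1, h2⟩, htr⟩ := h.2 hg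
    obtain ⟨δ, hδ, hb⟩ := Metric.eventually_nhds_iff.1 he
    refine ⟨σ₁, σ₂, hne, ⟨min ε δ, lt_min hε hδ, ?_, ?_⟩, htr⟩
    · intro s hs
      have hm1 := min_le_left ε δ
      have hm2 := min_le_right ε δ
      rw [hb (by rw [Real.dist_eq, abs_lt]; constructor <;> linarith [hs.1, hs.2])]
      exact h1 _ ⟨by linarith [hs.1], by linarith [hs.2]⟩
    · intro s hs
      have hm1 := min_le_left ε δ
      have hm2 := min_le_right ε δ
      rw [hb (by rw [Real.dist_eq, abs_lt]; constructor <;> linarith [hs.1, hs.2])]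
      exact h2 _ ⟨by linarith [hs.1], by linarith [hs.2]⟩

noncomputable def catPath (τ : ℝ) (γ₁ γ₂ : ℝ → ℂ) : ℝ → ℂ :=
  fun t => if t ≤ τ then γ₁ t else γ₂ (t - τ)

lemma IsArc.goodPath (hz : ∀ σ σ' w, w ∈ zones σ → w ∈ zones σ' → σ = σ')
    (hzc : ∀ σ, ∀ w ∈ zones σ, ∀ g ∈ curves, g w ≠ 0) {U : Set ℂ} {p q : ℂ} {σ : ι}
    (h : IsArc (zones σ) U (fields σ) p q) :
    ∃ τ γ, GoodPath zones fields curves U p q σ σ τ γ := by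
  obtain ⟨τ, hτ, γ, hc, h0, h1, hd, hU⟩ := h
  refine ⟨τ, γ, hτ, hc, h0, h1, ?_, ?_, ⟨τ, hτ, le_rfl, fun s hs => (hd s hs).1⟩,
    ⟨τ, hτ, le_rfl, fun s hs => (hd s (by simpa using hs)).1⟩, hU⟩
  · intro t ht
    refine ⟨fun σ' hσ' => ?_, ?_⟩
    · rw [hz σ' σ _ hσ' (hd t ht).1]
      exact (hd t ht).2
    · rintro ⟨g, hg, hg0⟩
      exact absurd hg0 (hzc σ _ (hd t ht).1 g hg)
  · refine Set.Finite.subset (Set.toFinite {0, τ}) ?_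
    rintro t ⟨ht, g, hg, hg0⟩
    by_contra hne
    simp only [Set.mem_insert_iff, Set.mem_singleton_iff, not_or] at hne
    refine hzc σ _ (hd t ⟨lt_of_le_of_ne ht.1 (Ne.symm hne.1), lt_of_le_of_ne ht.2 hne.2⟩).1 g hg hg0

lemma GoodPath.cat (hzc : ∀ σ, ∀ w ∈ zones σ, ∀ g ∈ curves, g w ≠ 0)
    {U : Set ℂ} {p q r : ℂ} {σ₁ σ₂ σ₃ σ₄ : ι}
    {τ₁ τ₂ : ℝ} {γ₁ γ₂ : ℝ → ℂ} (h1 : GoodPath zones fields curves U p q σ₁ σ₂ τ₁ γ₁)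
    (h2 : GoodPath zones fields curves U q r σ₃ σ₄ τ₂ γ₂) (hne : σ₂ ≠ σ₃)
    (hq : ∃ g ∈ curves, g q = 0) (htr : Transv fields curves σ₂ σ₃ q) :
    GoodPath zones fields curves U p r σ₁ σ₄ (τ₁ + τ₂) (catPath τ₁ γ₁ γ₂) := by
  have hp1 := h1.pos
  have hp2 := h2.pos
  have e1 : ∀ t, t ≤ τ₁ → catPath τ₁ γ₁ γ₂ t = γ₁ t := fun t ht => if_pos ht
  have e2 : ∀ t, τ₁ ≤ t → catPath τ₁ γ₁ γ₂ t = γ₂ (t - τ₁) := by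
    intro t ht
    rcases ht.eq_or_lt with h | h
    · rw [← h, e1 _ le_rfl, sub_self, h1.endEq, h2.start]
    · exact if_neg (not_le.2 h)
  obtain ⟨ε1, hε1, hε1', hs1⟩ := h1.zs
  obtain ⟨ε2, hε2, hε2', hs2⟩ := h1.ze
  obtain ⟨ε3, hε3, hε3', hs3⟩ := h2.zs
  obtain ⟨ε4, hε4, hε4', hs4⟩ := h2.ze
  refine ⟨by linarith, ?_, ?_, ?_, ?_, ?_, ?_, ?_, ?_⟩
  · rw [← Set.Icc_union_Icc_eq_Icc hp1.le (show τ₁ ≤ τ₁ + τ₂ by linarith)]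
    refine ContinuousOn.union_of_isClosed ?_ ?_ isClosed_Icc isClosed_Icc
    · exact h1.cont.congr fun t ht => e1 t ht.2
    · refine ContinuousOn.congr (f := fun t => γ₂ (t - τ₁)) ?_ fun t ht => e2 t ht.1
      refine h2.cont.comp (by fun_prop) fun t ht => ?_
      exact ⟨by linarith [ht.1], by linarith [ht.2]⟩
  · rw [e1 _ hp1.le, h1.start]
  · rw [e2 _ (by linarith), add_sub_cancel_left, h2.endEq]
  · intro t ht
    rcases lt_trichotomy t τ₁ with hlt | heq | hgt
    · have hg := h1.good t ⟨ht.1, hlt⟩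
      refine GoodAt.congr (c := 0) (γ' := γ₁) (by simpa using hg) ?_
      filter_upwards [Iio_mem_nhds hlt] with s hs
      rw [e1 s (le_of_lt hs), sub_zero]
    · subst heq
      have hval : catPath t γ₁ γ₂ t = q := by rw [e1 _ le_rfl, h1.endEq]
      refine ⟨fun σ hσ => ?_, fun _ => ⟨σ₂, σ₃, hne, ⟨min ε2 ε3, lt_min hε2 hε3, ?_, ?_⟩, ?_⟩⟩
      · rw [hval] at hσ
        obtain ⟨g, hg, hg0⟩ := hq
        exact absurd hg0 (hzc σ q hσ g hg)
      · intro s hs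
        rw [e1 s hs.2.le]
        exact hs2 s ⟨by linarith [hs.1, min_le_left ε2 ε3], hs.2⟩
      · intro s hs
        rw [e2 s hs.1.le]
        exact hs3 _ ⟨by linarith [hs.1], by linarith [hs.2, min_le_right ε2 ε3]⟩
      · rw [hval]; exact htr
    · have hg := h2.good (t - τ₁) ⟨by linarith, by linarith [ht.2]⟩
      refine GoodAt.congr (c := τ₁) (γ' := γ₂) hg ?_
      filter_upwards [Ioi_mem_nhds hgt] with s hs
      rw [e2 s (le_of_lt hs)]
  · refine Set.Finite.subset (h1.fin.union (h2.fin.image (fun t => t + τ₁))) ?_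
    rintro t ⟨ht, hg⟩
    rcases le_total t τ₁ with h | h
    · left
      rw [e1 t h] at hg
      exact ⟨⟨ht.1, h⟩, hg⟩
    · right
      rw [e2 t h] at hg
      exact ⟨t - τ₁, ⟨⟨by linarith, by linarith [ht.2]⟩, hg⟩, by simp⟩
  · refine ⟨ε1, hε1, by linarith, fun s hs => ?_⟩
    rw [e1 s (by linarith [hs.2])]
    exact hs1 s hs
  · refine ⟨ε4, hε4, by linarith, fun s hs => ?_⟩
    rw [e2 s (by linarith [hs.1])]
    exact hs4 _ ⟨by linarith [hs.1], by linarith [hs.2]⟩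
  · intro t ht
    rcases le_total t τ₁ with h | h
    · rw [e1 t h]; exact h1.inU t ⟨ht.1, h⟩
    · rw [e2 t h]; exact h2.inU _ ⟨by linarith, by linarith [ht.2]⟩

lemma GoodPath.close (hzc : ∀ σ, ∀ w ∈ zones σ, ∀ g ∈ curves, g w ≠ 0)
    {U : Set ℂ} {p : ℂ} {σ₁ σ₂ : ι} {τ : ℝ} {γ : ℝ → ℂ}
    (h : GoodPath zones fields curves U p p σ₁ σ₂ τ γ) (hne : σ₂ ≠ σ₁)
    (hp : ∃ g ∈ curves, g p = 0) (htr : Transv fields curves σ₂ σ₁ p) :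
    ∃ w : ℝ → ℂ, IsCrossingPeriodicOrbit zones fields curves w ∧ Set.range w ⊆ U ∧
      p ∈ Set.range w := by
  have hτ := h.pos
  have H := h.cat hzc h hne hp htr
  set Γ := catPath τ γ γ with hΓ
  set w : ℝ → ℂ := fun t => γ (toIcoMod hτ 0 t) with hw
  have hmem : ∀ t, toIcoMod hτ 0 t ∈ Set.Icc 0 τ := by
    intro t
    have := toIcoMod_mem_Ico hτ 0 t
    rw [zero_add] at this
    exact Set.Ico_subset_Icc_self this
  have hIco : ∀ t ∈ Set.Ico 0 τ, w t = γ t := by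
    intro t ht
    have : toIcoMod hτ 0 t = t := (toIcoMod_eq_self hτ).2 (by simpa using ht)
    simp only [hw, this]
  have hper : Function.Periodic w τ := by
    intro t
    simp only [hw, toIcoMod_add_right]
  have hwΓ : ∀ (k : ℤ) (s : ℝ), s - k * τ ∈ Set.Ico 0 (2 * τ) → w s = Γ (s - k * τ) := by
    intro k s hs
    have hshift : w s = w (s - k * τ) := by
      have := hper.sub_zsmul_eq (x := s) k
      rw [zsmul_eq_mul] at this
      exact this.symm
    rw [hshift]
    set u := s - k * τ with hu
    rcases lt_or_ge u τ with hlt | hge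
    · rw [hIco u ⟨hs.1, hlt⟩]
      exact (if_pos hlt.le).symm
    · have h1 : w u = w (u - τ) := (hper.sub_eq u).symm
      rw [h1, hIco _ ⟨by linarith, by linarith [hs.2]⟩]
      rcases hge.eq_or_lt with h2 | h2
      · simp only [hΓ, catPath]
        rw [if_pos h2.symm.le, ← h2, sub_self, h.start, h.endEq]
      · exact (if_neg (not_le.2 h2)).symm
  have hloc : ∀ t : ℝ, ∃ c : ℝ, t - c ∈ Set.Ioo 0 (τ + τ) ∧ ∀ᶠ s in 𝓝 t, w s = Γ (s - c) := by
    intro t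
    have h1 := sub_toIcoDiv_zsmul_mem_Ico hτ (τ/2) t
    set k := toIcoDiv hτ (τ/2) t
    rw [zsmul_eq_mul] at h1
    have h2 : t - k * τ ∈ Set.Ioo 0 (τ + τ) := ⟨by linarith [h1.1], by linarith [h1.2]⟩
    refine ⟨k * τ, h2, ?_⟩
    have hcont : Continuous fun s : ℝ => s - k * τ := by fun_prop
    filter_upwards [hcont.continuousAt.eventually (isOpen_Ioo.mem_nhds h2)] with s hs
    exact hwΓ k s ⟨hs.1.le, by linarith [hs.2]⟩
  have hgood : ∀ t, GoodAt zones fields curves w t := by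
    intro t
    obtain ⟨c, hc, he⟩ := hloc t
    exact GoodAt.congr (H.good _ hc) he
  have hw0 : w 0 = p := by rw [hIco 0 ⟨le_rfl, hτ⟩, h.start]
  refine ⟨w, ⟨τ, hτ, ?_, hper, ?_, fun t σ => (hgood t).1 σ, ?_, fun t => (hgood t).2⟩, ?_,
    ⟨0, hw0⟩⟩
  · rw [continuous_iff_continuousAt]
    intro t
    obtain ⟨c, hc, he⟩ := hloc t
    have h1 : ContinuousAt Γ (t - c) := H.cont.continuousAt (Icc_mem_nhds hc.1 hc.2)
    have h2 : ContinuousAt (fun s => Γ (s - c)) t :=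
      ContinuousAt.comp (g := Γ) (f := fun s => s - c) h1 (by fun_prop)
    exact h2.congr (he.mono fun s hs => hs.symm)
  · obtain ⟨ε, hε, hε', hs⟩ := h.zs
    refine ⟨0, ε / 2, fun heq => ?_⟩
    rw [hw0, hIco _ ⟨by linarith, by linarith⟩] at heq
    obtain ⟨g, hg, hg0⟩ := hp
    have := hs (ε/2) ⟨by linarith, by linarith⟩
    rw [← heq] at this
    exact hzc _ _ this g hg hg0
  · refine h.fin.subset ?_
    rintro t ⟨ht, hg⟩
    rw [hIco t ht] at hg
    exact ⟨Set.Ico_subset_Icc_self ht, hg⟩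
  · rintro _ ⟨t, rfl⟩
    exact h.inU _ (hmem t)

end Glue

/-! ### Section 4: structure of the crossing periodic orbits -/

section Orbits

open Filter Topology

structure Orb (P : Fin 3 → ℂ → ℂ) (z : ℝ → ℂ) : Prop where
  orb : IsCrossingPeriodicOrbit zonesLines (fun σ w => 1 / P σ w) curvesLines z
  ne0 : ∀ t, 1 ≤ (z t).im → P 0 (z t) ≠ 0
  ne1 : ∀ t, |(z t).im| ≤ 1 → P 1 (z t) ≠ 0
  ne2 : ∀ t, (z t).im ≤ -1 → P 2 (z t) ≠ 0

lemma mem_zone0 (w : ℂ) : w ∈ zonesLines 0 ↔ 1 < w.im := Iff.rfl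
lemma mem_zone1 (w : ℂ) : w ∈ zonesLines 1 ↔ |w.im| < 1 := Iff.rfl
lemma mem_zone2 (w : ℂ) : w ∈ zonesLines 2 ↔ w.im < -1 := Iff.rfl

lemma zones_disj : ∀ (σ σ' : Fin 3) (w : ℂ), w ∈ zonesLines σ → w ∈ zonesLines σ' → σ = σ' := by
  intro σ σ' w h h'
  fin_cases σ <;> fin_cases σ' <;>
    simp only [Fin.zero_eta, Fin.mk_one, Fin.reduceFinMk, mem_zone0, mem_zone1, mem_zone2,
      abs_lt] at h h' ⊢ <;> exfalso <;>
    first | linarith | linarith [h.1] | linarith [h.2] | linarith [h'.1] | linarith [h'.2]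

lemma zones_open : ∀ σ : Fin 3, IsOpen (zonesLines σ) := by
  intro σ
  fin_cases σ
  · exact isOpen_lt continuous_const Complex.continuous_im
  · exact isOpen_lt (continuous_abs.comp Complex.continuous_im) continuous_const
  · exact isOpen_lt Complex.continuous_im continuous_const

lemma zones_curves : ∀ σ : Fin 3, ∀ w ∈ zonesLines σ, ∀ g ∈ curvesLines, g w ≠ 0 := by
  intro σ w hw g hg
  rcases hg with rfl | rfl <;> fin_cases σ <;>
    simp only [Fin.zero_eta, Fin.mk_one, Fin.reduceFinMk, mem_zone0, mem_zone1, mem_zone2,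
      abs_lt] at hw ⊢ <;> intro h0 <;>
    first | linarith | linarith [hw.1] | linarith [hw.2]

lemma curve_iff (w : ℂ) : (∃ g ∈ curvesLines, g w = 0) ↔ (w.im = 1 ∨ w.im = -1) := by
  constructor
  · rintro ⟨g, rfl | rfl, h⟩
    · left; simp only [] at h; linarith
    · right; simp only [] at h; linarith
  · rintro (h | h)
    · exact ⟨fun z => z.im - 1, Or.inl rfl, by simp [h]⟩
    · exact ⟨fun z => z.im + 1, Or.inr rfl, by simp [h]⟩

lemma fderiv_curve (g : ℂ → ℝ) (hg : g ∈ curvesLines) (p v : ℂ) : fderiv ℝ g p v = v.im := by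
  rcases hg with rfl | rfl
  · have : HasFDerivAt (fun z : ℂ => z.im - 1) Complex.imCLM p :=
      (Complex.imCLM.hasFDerivAt (x := p)).sub_const 1
    rw [this.fderiv]; rfl
  · have : HasFDerivAt (fun z : ℂ => z.im + 1) Complex.imCLM p :=
      (Complex.imCLM.hasFDerivAt (x := p)).add_const 1
    rw [this.fderiv]; rfl

variable {P Q : Fin 3 → ℂ → ℂ} {z : ℝ → ℂ}

lemma Orb.cont (h : Orb P z) : Continuous z := by
  obtain ⟨T, _, hc, _⟩ := h.orb
  exact hc

lemma Orb.ode (h : Orb P z) (t : ℝ) (σ : Fin 3) (ht : z t ∈ zonesLines σ) :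
    HasDerivAt z (1 / P σ (z t)) t := by
  obtain ⟨T, _, _, _, _, ho, _⟩ := h.orb
  exact ho t σ ht

lemma Orb.ne_zone (h : Orb P z) (t : ℝ) (σ : Fin 3) (ht : z t ∈ zonesLines σ) :
    P σ (z t) ≠ 0 := by
  fin_cases σ
  · exact h.ne0 t (le_of_lt ht)
  · exact h.ne1 t (le_of_lt ht)
  · exact h.ne2 t (le_of_lt ht)

lemma sign_after (hP : ∀ σ, Continuous (P σ)) (h : Orb P z) (t ε : ℝ) (hε : 0 < ε) (σ : Fin 3)
    (hz : ∀ s ∈ Set.Ioo t (t + ε), z s ∈ zonesLines σ) (hne : P σ (z t) ≠ 0)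
    (ℓ : ℂ →L[ℝ] ℝ) (hℓ : ∀ s ∈ Set.Ioo t (t + ε), ℓ (z t) < ℓ (z s)) :
    0 ≤ ℓ (1 / P σ (z t)) := by
  by_contra! hlt
  have hcont : ContinuousAt (fun s => ℓ (1 / P σ (z s))) t := by
    refine ℓ.continuous.continuousAt.comp ?_
    exact continuousAt_const.div ((hP σ).continuousAt.comp h.cont.continuousAt) hne
  obtain ⟨δ, hδ, hb⟩ := Metric.eventually_nhds_iff.1 (hcont.eventually_lt_const hlt)
  set η := min ε δ / 2 with hη
  have hm : 0 < min ε δ := lt_min hε hδ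
  have hη0 : 0 < η := by positivity
  have hη1 : η < ε := by have := min_le_left ε δ; linarith
  have hη2 : η < δ := by have := min_le_right ε δ; linarith
  have hanti : StrictAntiOn (fun s => ℓ (z s)) (Set.Icc t (t + η)) := by
    refine strictAntiOn_of_deriv_neg (convex_Icc _ _)
      (ℓ.continuous.comp h.cont).continuousOn fun s hs => ?_
    rw [interior_Icc] at hs
    have hd := h.ode s σ (hz s ⟨hs.1, by linarith [hs.2]⟩)
    have hd' : HasDerivAt (fun s => ℓ (z s)) (ℓ (1 / P σ (z s))) s :=
      ℓ.hasFDerivAt.comp_hasDerivAt s hd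
    rw [hd'.deriv]
    apply hb
    rw [Real.dist_eq, abs_lt]
    constructor <;> linarith [hs.1, hs.2]
  have h1 := hanti (Set.left_mem_Icc.2 (by linarith)) (Set.right_mem_Icc.2 (by linarith))
    (show t < t + η by linarith)
  have h2 := hℓ (t + η) ⟨by linarith, by linarith⟩
  simp only [] at h1
  linarith

lemma Orb.cross (h : Orb P z) (t : ℝ) (ht : (z t).im = 1 ∨ (z t).im = -1) :
    ∃ σ₁ σ₂ : Fin 3, σ₁ ≠ σ₂ ∧ ∃ ε > 0, (∀ s ∈ Set.Ioo (t - ε) t, z s ∈ zonesLines σ₁) ∧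
      (∀ s ∈ Set.Ioo t (t + ε), z s ∈ zonesLines σ₂) ∧
      (∀ s ∈ Set.Ioo (t - ε) (t + ε), |(z s).im - (z t).im| < 1) ∧
      (1 / P σ₁ (z t)).im ≠ 0 ∧ (1 / P σ₂ (z t)).im ≠ 0 ∧
      (0 < (1 / P σ₁ (z t)).im ↔ 0 < (1 / P σ₂ (z t)).im) := by
  obtain ⟨T, _, _, _, _, _, _, hcr⟩ := h.orb
  obtain ⟨g, hg, hg0⟩ := (curve_iff (z t)).2 ht
  obtain ⟨σ₁, σ₂, hne, ⟨ε, hε, h1, h2⟩, htr⟩ := hcr t ⟨g, hg, hg0⟩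
  have hh := htr g hg hg0
  simp only [fderiv_curve g hg] at hh
  have hcont : Continuous fun s => (z s).im := Complex.continuous_im.comp h.cont
  obtain ⟨δ, hδ, hb⟩ := Metric.continuous_iff.1 hcont t 1 one_pos
  have hm1 := min_le_left ε δ
  have hm2 := min_le_right ε δ
  refine ⟨σ₁, σ₂, hne, min ε δ, lt_min hε hδ, ?_, ?_, ?_, hh⟩
  · intro s hs; exact h1 s ⟨by linarith [hs.1], hs.2⟩
  · intro s hs; exact h2 s ⟨hs.1, by linarith [hs.2]⟩
  · intro s hs
    have := hb s (by rw [Real.dist_eq, abs_lt]; constructor <;> linarith [hs.1, hs.2])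
    rwa [Real.dist_eq] at this

lemma Orb.crossTop (hP : ∀ σ, Continuous (P σ)) (h : Orb P z) (t : ℝ) (ht : (z t).im = 1) :
    ∃ ε > 0, (0 < (1 / P 1 (z t)).im ∧ 0 < (1 / P 0 (z t)).im ∧
        (∀ s ∈ Set.Ioo (t - ε) t, z s ∈ zonesLines 1) ∧
        (∀ s ∈ Set.Ioo t (t + ε), z s ∈ zonesLines 0)) ∨
      ((1 / P 1 (z t)).im < 0 ∧ (1 / P 0 (z t)).im < 0 ∧
        (∀ s ∈ Set.Ioo (t - ε) t, z s ∈ zonesLines 0) ∧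
        (∀ s ∈ Set.Ioo t (t + ε), z s ∈ zonesLines 1)) := by
  obtain ⟨σ₁, σ₂, hne, ε, hε, h1, h2, h3, h4, h5, h6⟩ := h.cross t (Or.inl ht)
  have hs1 : t - ε / 2 ∈ Set.Ioo (t - ε) t := ⟨by linarith, by linarith⟩
  have hs2 : t + ε / 2 ∈ Set.Ioo t (t + ε) := ⟨by linarith, by linarith⟩
  have hn1 : σ₁ ≠ 2 := by
    rintro rfl
    have a := h1 _ hs1
    have b := abs_lt.1 (h3 (t - ε/2) ⟨by linarith, by linarith⟩)
    rw [mem_zone2] at a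
    linarith [b.1]
  have hn2 : σ₂ ≠ 2 := by
    rintro rfl
    have a := h2 _ hs2
    have b := abs_lt.1 (h3 (t + ε/2) ⟨by linarith, by linarith⟩)
    rw [mem_zone2] at a
    linarith [b.1]
  refine ⟨ε, hε, ?_⟩
  have hcase : (σ₁ = 1 ∧ σ₂ = 0) ∨ (σ₁ = 0 ∧ σ₂ = 1) := by
    revert hne hn1 hn2
    clear * -
    revert σ₁ σ₂
    decide
  rcases hcase with ⟨rfl, rfl⟩ | ⟨rfl, rfl⟩
  · left
    have hsg : 0 ≤ (1 / P 0 (z t)).im := by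
      refine sign_after hP h t ε hε 0 h2 (h.ne0 t ht.ge) Complex.imCLM fun s hs => ?_
      have := h2 s hs
      rw [mem_zone0] at this
      simpa [ht] using this
    have h0 : 0 < (1 / P 0 (z t)).im := lt_of_le_of_ne hsg (Ne.symm h5)
    exact ⟨h6.2 h0, h0, h1, h2⟩
  · right
    have hsg : 0 ≤ -(1 / P 1 (z t)).im := by
      refine sign_after hP h t ε hε 1 h2 (h.ne1 t (by rw [ht]; simp)) (-Complex.imCLM)
        fun s hs => ?_
      have := h2 s hs
      rw [mem_zone1, abs_lt] at this
      simpa [ht] using this.2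
    have h0 : (1 / P 1 (z t)).im < 0 := lt_of_le_of_ne (by linarith) h5
    refine ⟨h0, ?_, h1, h2⟩
    rcases lt_or_gt_of_ne h4 with h7 | h7
    · exact h7
    · exact absurd (h6.1 h7) (not_lt.2 h0.le)

lemma Orb.crossBot (hP : ∀ σ, Continuous (P σ)) (h : Orb P z) (t : ℝ) (ht : (z t).im = -1) :
    ∃ ε > 0, (0 < (1 / P 1 (z t)).im ∧ 0 < (1 / P 2 (z t)).im ∧
        (∀ s ∈ Set.Ioo (t - ε) t, z s ∈ zonesLines 2) ∧
        (∀ s ∈ Set.Ioo t (t + ε), z s ∈ zonesLines 1)) ∨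
      ((1 / P 1 (z t)).im < 0 ∧ (1 / P 2 (z t)).im < 0 ∧
        (∀ s ∈ Set.Ioo (t - ε) t, z s ∈ zonesLines 1) ∧
        (∀ s ∈ Set.Ioo t (t + ε), z s ∈ zonesLines 2)) := by
  obtain ⟨σ₁, σ₂, hne, ε, hε, h1, h2, h3, h4, h5, h6⟩ := h.cross t (Or.inr ht)
  have hs1 : t - ε / 2 ∈ Set.Ioo (t - ε) t := ⟨by linarith, by linarith⟩
  have hs2 : t + ε / 2 ∈ Set.Ioo t (t + ε) := ⟨by linarith, by linarith⟩
  have hn1 : σ₁ ≠ 0 := by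
    rintro rfl
    have a := h1 _ hs1
    have b := abs_lt.1 (h3 (t - ε/2) ⟨by linarith, by linarith⟩)
    rw [mem_zone0] at a
    linarith [b.2]
  have hn2 : σ₂ ≠ 0 := by
    rintro rfl
    have a := h2 _ hs2
    have b := abs_lt.1 (h3 (t + ε/2) ⟨by linarith, by linarith⟩)
    rw [mem_zone0] at a
    linarith [b.2]
  refine ⟨ε, hε, ?_⟩
  have hcase : (σ₁ = 2 ∧ σ₂ = 1) ∨ (σ₁ = 1 ∧ σ₂ = 2) := by
    revert hne hn1 hn2
    clear * -
    revert σ₁ σ₂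
    decide
  rcases hcase with ⟨rfl, rfl⟩ | ⟨rfl, rfl⟩
  · left
    have hsg : 0 ≤ (1 / P 1 (z t)).im := by
      refine sign_after hP h t ε hε 1 h2 (h.ne1 t (by rw [ht]; simp)) Complex.imCLM fun s hs => ?_
      have := h2 s hs
      rw [mem_zone1, abs_lt] at this
      simpa [ht] using this.1
    have h0 : 0 < (1 / P 1 (z t)).im := lt_of_le_of_ne hsg (Ne.symm h5)
    exact ⟨h0, h6.2 h0, h1, h2⟩
  · right
    have hsg : 0 ≤ -(1 / P 2 (z t)).im := by
      refine sign_after hP h t ε hε 2 h2 (h.ne2 t ht.le) (-Complex.imCLM)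
        fun s hs => ?_
      have := h2 s hs
      rw [mem_zone2] at this
      simp [ht]
      linarith
    have h0 : (1 / P 2 (z t)).im < 0 := lt_of_le_of_ne (by linarith) h5
    refine ⟨?_, h0, h1, h2⟩
    rcases lt_or_gt_of_ne h4 with h7 | h7
    · exact h7
    · exact absurd (h6.1 h7) (not_lt.2 h0.le)

open Classical in
/-- the zone entered right after the point `w` -/
noncomputable def nextZ (P : Fin 3 → ℂ → ℂ) (w : ℂ) : Fin 3 :=
  if 1 < w.im then 0 else if w.im = 1 then (if 0 < (1 / P 1 w).im then 0 else 1)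
  else if -1 < w.im then 1 else if w.im = -1 then (if 0 < (1 / P 1 w).im then 1 else 2) else 2

open Classical in
/-- the zone left right before the point `w` -/
noncomputable def prevZ (P : Fin 3 → ℂ → ℂ) (w : ℂ) : Fin 3 :=
  if 1 < w.im then 0 else if w.im = 1 then (if 0 < (1 / P 1 w).im then 1 else 0)
  else if -1 < w.im then 1 else if w.im = -1 then (if 0 < (1 / P 1 w).im then 2 else 1) else 2

lemma Orb.step (hP : ∀ σ, Continuous (P σ)) (h : Orb P z) (t : ℝ) :
    ∃ ε > 0, (∀ s ∈ Set.Ioo t (t + ε), z s ∈ zonesLines (nextZ P (z t))) ∧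
      (∀ s ∈ Set.Ioo (t - ε) t, z s ∈ zonesLines (prevZ P (z t))) ∧
      P (nextZ P (z t)) (z t) ≠ 0 ∧ P (prevZ P (z t)) (z t) ≠ 0 := by
  have key : ∀ σ, z t ∈ zonesLines σ → nextZ P (z t) = σ → prevZ P (z t) = σ →
      ∃ ε > 0, (∀ s ∈ Set.Ioo t (t + ε), z s ∈ zonesLines (nextZ P (z t))) ∧
      (∀ s ∈ Set.Ioo (t - ε) t, z s ∈ zonesLines (prevZ P (z t))) ∧
      P (nextZ P (z t)) (z t) ≠ 0 ∧ P (prevZ P (z t)) (z t) ≠ 0 := by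
    intro σ hσ hn hp
    rw [hn, hp]
    obtain ⟨δ, hδ, hb⟩ := Metric.eventually_nhds_iff.1
      (h.cont.continuousAt.eventually ((zones_open σ).mem_nhds hσ))
    refine ⟨δ, hδ, fun s hs => ?_, fun s hs => ?_, h.ne_zone t σ hσ, h.ne_zone t σ hσ⟩
    · exact hb (by rw [Real.dist_eq, abs_lt]; constructor <;> linarith [hs.1, hs.2])
    · exact hb (by rw [Real.dist_eq, abs_lt]; constructor <;> linarith [hs.1, hs.2])
  rcases lt_trichotomy (z t).im 1 with h1 | h1 | h1
  · rcases lt_trichotomy (z t).im (-1) with h2 | h2 | h2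
    · refine key 2 h2 ?_ ?_
      · rw [nextZ, if_neg h1.le.not_gt, if_neg h1.ne, if_neg h2.le.not_gt, if_neg h2.ne]
      · rw [prevZ, if_neg h1.le.not_gt, if_neg h1.ne, if_neg h2.le.not_gt, if_neg h2.ne]
    · have e1 : nextZ P (z t) = if 0 < (1 / P 1 (z t)).im then 1 else 2 := by
        rw [nextZ, if_neg h1.le.not_gt, if_neg h1.ne, if_neg h2.le.not_gt, if_pos h2]
      have e2 : prevZ P (z t) = if 0 < (1 / P 1 (z t)).im then 2 else 1 := by
        rw [prevZ, if_neg h1.le.not_gt, if_neg h1.ne, if_neg h2.le.not_gt, if_pos h2]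
      obtain ⟨ε, hε, ⟨a, b, c, d⟩ | ⟨a, b, c, d⟩⟩ := h.crossBot hP t h2
      · rw [if_pos a] at e1 e2
        rw [e1, e2]
        exact ⟨ε, hε, d, c, h.ne1 t (by rw [h2]; simp), h.ne2 t h2.le⟩
      · rw [if_neg a.not_gt] at e1 e2
        rw [e1, e2]
        exact ⟨ε, hε, d, c, h.ne2 t h2.le, h.ne1 t (by rw [h2]; simp)⟩
    · refine key 1 (abs_lt.2 ⟨h2, h1⟩) ?_ ?_
      · rw [nextZ, if_neg h1.le.not_gt, if_neg h1.ne, if_pos h2]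
      · rw [prevZ, if_neg h1.le.not_gt, if_neg h1.ne, if_pos h2]
  · have e1 : nextZ P (z t) = if 0 < (1 / P 1 (z t)).im then 0 else 1 := by
      rw [nextZ, if_neg h1.le.not_gt, if_pos h1]
    have e2 : prevZ P (z t) = if 0 < (1 / P 1 (z t)).im then 1 else 0 := by
      rw [prevZ, if_neg h1.le.not_gt, if_pos h1]
    obtain ⟨ε, hε, ⟨a, b, c, d⟩ | ⟨a, b, c, d⟩⟩ := h.crossTop hP t h1
    · rw [if_pos a] at e1 e2
      rw [e1, e2]
      exact ⟨ε, hε, d, c, h.ne0 t h1.ge, h.ne1 t (by rw [h1]; simp)⟩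
    · rw [if_neg a.not_gt] at e1 e2
      rw [e1, e2]
      exact ⟨ε, hε, d, c, h.ne1 t (by rw [h1]; simp), h.ne0 t h1.ge⟩
  · refine key 0 h1 ?_ ?_
    · rw [nextZ, if_pos h1]
    · rw [prevZ, if_pos h1]

lemma loc_inj (Q P : ℂ → ℂ) (hQ : ∀ z, HasDerivAt Q (P z) z) (hP : Continuous P) (p : ℂ)
    (hp : P p ≠ 0) : ∃ N ∈ 𝓝 p, Set.InjOn Q N := by
  have hs : HasStrictDerivAt Q (P p) p :=
    hasStrictDerivAt_of_hasDerivAt_of_continuousAt (Filter.Eventually.of_forall hQ)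
      hP.continuousAt
  let e := hs.hasStrictFDerivAt_equiv hp
  exact ⟨(e.toOpenPartialHomeomorph Q).source,
    (e.toOpenPartialHomeomorph Q).open_source.mem_nhds e.mem_toOpenPartialHomeomorph_source,
    (e.toOpenPartialHomeomorph Q).injOn⟩

lemma Orb.prim (hQ : ∀ σ z, HasDerivAt (Q σ) (P σ z) z) (h : Orb P z) (σ : Fin 3) (a b : ℝ)
    (hab : a < b) (hz : ∀ s ∈ Set.Ioo a b, z s ∈ zonesLines σ) :
    Q σ (z b) = Q σ (z a) + ((b - a : ℝ) : ℂ) :=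
  prim_eq (Q σ) (P σ) (hQ σ) z a b hab h.cont.continuousOn
    (fun t ht => h.ode t σ (hz t ht)) (fun t ht => h.ne_zone t σ (hz t ht)) b
    (Set.right_mem_Icc.2 hab.le)

lemma Orb.unique (hP : ∀ σ, Continuous (P σ)) (hQ : ∀ σ z, HasDerivAt (Q σ) (P σ z) z)
    {w : ℝ → ℂ} (h : Orb P z) (h' : Orb P w) (t₀ t₁ : ℝ) (heq : z t₀ = w t₁) :
    ∀ s, z (t₀ + s) = w (t₁ + s) := by
  have hcl : IsClosed {s | z (t₀ + s) = w (t₁ + s)} :=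
    isClosed_eq (h.cont.comp (by fun_prop)) (h'.cont.comp (by fun_prop))
  have hop : IsOpen {s | z (t₀ + s) = w (t₁ + s)} := by
    rw [isOpen_iff_mem_nhds]
    intro s hs
    have hs' : z (t₀ + s) = w (t₁ + s) := hs
    obtain ⟨ε, hε, hn, hpv, hne1, hne2⟩ := h.step hP (t₀ + s)
    obtain ⟨ε', hε', hn', hpv', _, _⟩ := h'.step hP (t₁ + s)
    rw [← hs'] at hn' hpv'
    set σ := nextZ P (z (t₀ + s))
    set σ' := prevZ P (z (t₀ + s))
    obtain ⟨N, hN, hi⟩ := loc_inj (Q σ) (P σ) (hQ σ) (hP σ) _ hne1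
    obtain ⟨N', hN', hi'⟩ := loc_inj (Q σ') (P σ') (hQ σ') (hP σ') _ hne2
    have c1 : ContinuousAt (fun s => z (t₀ + s)) s :=
      (h.cont.comp (continuous_const.add continuous_id)).continuousAt
    have c2 : ContinuousAt (fun s => w (t₁ + s)) s :=
      (h'.cont.comp (continuous_const.add continuous_id)).continuousAt
    have f1 := c1.eventually (Filter.inter_mem hN hN')
    have f2 := c2.eventually (show N ∩ N' ∈ 𝓝 (w (t₁ + s)) by
      rw [← hs']; exact Filter.inter_mem hN hN')
    filter_upwards [f1, f2, Ioo_mem_nhds (show s - ε < s by linarith) (show s < s + ε by linarith),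
      Ioo_mem_nhds (show s - ε' < s by linarith) (show s < s + ε' by linarith)] with u g1 g2 g3 g4
    rcases lt_trichotomy u s with hlt | rfl | hgt
    · apply hi' g1.2 g2.2
      have a1 := h.prim hQ σ' (t₀ + u) (t₀ + s) (by linarith)
        (fun r hr => hpv r ⟨by linarith [hr.1, g3.1], hr.2⟩)
      have a2 := h'.prim hQ σ' (t₁ + u) (t₁ + s) (by linarith)
        (fun r hr => hpv' r ⟨by linarith [hr.1, g4.1], hr.2⟩)
      rw [hs'] at a1
      rw [a1] at a2
      push_cast at a2
      linear_combination a2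
    · exact hs'
    · apply hi g1.1 g2.1
      have a1 := h.prim hQ σ (t₀ + s) (t₀ + u) (by linarith)
        (fun r hr => hn r ⟨hr.1, by linarith [hr.2, g3.2]⟩)
      have a2 := h'.prim hQ σ (t₁ + s) (t₁ + u) (by linarith)
        (fun r hr => hn' r ⟨hr.1, by linarith [hr.2, g4.2]⟩)
      rw [a1, a2, hs']
      push_cast
      ring
  have huniv := IsClopen.eq_univ ⟨hcl, hop⟩ ⟨0, by simpa using heq⟩
  intro s
  have : s ∈ {s | z (t₀ + s) = w (t₁ + s)} := by rw [huniv]; trivial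
  exact this

lemma Orb.recur (hP : ∀ σ, Continuous (P σ)) (hQ : ∀ σ z, HasDerivAt (Q σ) (P σ z) z)
    (h : Orb P z) (t t' : ℝ) (hlt : t < t') (heq : z t = z t') :
    ∀ u, ∃ s ∈ Set.Ico t t', z u = z s := by
  have hu := h.unique hP hQ h t t' heq
  have hper : Function.Periodic z (t' - t) := by
    intro x
    have := hu (x - t)
    rw [show t + (x - t) = x by ring, show t' + (x - t) = x + (t' - t) by ring] at this
    exact this.symm
  intro u
  obtain ⟨y, hy, hy'⟩ := hper.exists_mem_Ico (sub_pos.2 hlt) u t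
  exact ⟨y, by simpa using hy, hy'⟩

/-- the next hitting time of the discontinuity set -/
lemma Orb.hit (hP : ∀ σ, Continuous (P σ)) (h : Orb P z) (t : ℝ)
    (ht : (z t).im = 1 ∨ (z t).im = -1) :
    ∃ t' > t, ((z t').im = 1 ∨ (z t').im = -1) ∧
      (∀ s ∈ Set.Ioo t t', z s ∈ zonesLines (nextZ P (z t))) ∧
      prevZ P (z t') = nextZ P (z t) := by
  obtain ⟨ε, hε, hn, -, -, -⟩ := h.step hP t
  set σ := nextZ P (z t)
  obtain ⟨T, hT, _, hper, _⟩ := h.orb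
  have hnot : ∀ w : ℂ, w ∈ zonesLines σ → ¬ (w.im = 1 ∨ w.im = -1) := by
    intro w hw hc
    obtain ⟨g, hg, hg0⟩ := (curve_iff w).2 hc
    exact zones_curves σ w hw g hg hg0
  set D : Set ℝ := {s | (z s).im = 1 ∨ (z s).im = -1} with hD
  have hic : Continuous fun s => (z s).im := Complex.continuous_im.comp h.cont
  have hDc : IsClosed D :=
    (isClosed_eq hic continuous_const).union (isClosed_eq hic continuous_const)
  have hεT : ε ≤ T := by
    by_contra! hlt
    refine hnot _ (hn (t + T) ⟨by linarith, by linarith⟩) ?_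
    rw [hper t]; exact ht
  set K := D ∩ Set.Icc (t + ε / 2) (t + T) with hK
  have hKc : IsCompact K := isCompact_Icc.inter_left hDc
  have hKn : K.Nonempty := ⟨t + T, by
    change _ ∨ _
    rw [hper t]; exact ht, by linarith, le_rfl⟩
  obtain ⟨t', ht', hleast⟩ := hKc.exists_isLeast hKn
  have htt : t < t' := by linarith [ht'.2.1]
  have hnoD : ∀ s ∈ Set.Ioo t t', s ∉ D := by
    intro s hs hsD
    rcases lt_or_ge s (t + ε/2) with h1 | h1
    · exact hnot _ (hn s ⟨hs.1, by linarith⟩) hsD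
    · have := hleast ⟨hsD, h1, by linarith [hs.2, ht'.2.2]⟩
      linarith [hs.2]
  have hcover : ∀ w : ℂ, ¬ (w.im = 1 ∨ w.im = -1) → ∃ σ, w ∈ zonesLines σ := by
    intro w hw
    push Not at hw
    rcases lt_or_gt_of_ne hw.1 with h1 | h1
    · rcases lt_or_gt_of_ne hw.2 with h2 | h2
      · exact ⟨2, h2⟩
      · exact ⟨1, abs_lt.2 ⟨h2, h1⟩⟩
    · exact ⟨0, h1⟩
  have hzone : ∀ s ∈ Set.Ioo t t', z s ∈ zonesLines σ := by
    have hpre : IsPreconnected (z '' Set.Ioo t t') :=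
      isPreconnected_Ioo.image _ h.cont.continuousOn
    have hsub : z '' Set.Ioo t t' ⊆ zonesLines σ := by
      refine hpre.subset_left_of_subset_union (v := ⋃ σ' ∈ {σ' | σ' ≠ σ}, zonesLines σ')
        (zones_open σ) (isOpen_biUnion fun _ _ => zones_open _) ?_ ?_ ?_
      · rw [Set.disjoint_left]
        intro w hw hw'
        simp only [Set.mem_iUnion] at hw'
        obtain ⟨σ', hσ', hw'⟩ := hw'
        exact hσ' (zones_disj _ _ w hw' hw)
      · rintro _ ⟨s, hs, rfl⟩
        obtain ⟨σ', hσ'⟩ := hcover (z s) (hnoD s hs)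
        by_cases he : σ' = σ
        · left; rw [← he]; exact hσ'
        · right
          simp only [Set.mem_iUnion]
          exact ⟨σ', he, hσ'⟩
      · set η := min ε (t' - t) / 2
        have hm : 0 < min ε (t' - t) := lt_min hε (by linarith)
        have hm1 := min_le_left ε (t' - t)
        have hm2 := min_le_right ε (t' - t)
        refine ⟨z (t + η), ⟨t + η, ⟨?_, ?_⟩, rfl⟩, hn _ ⟨?_, ?_⟩⟩ <;> simp only [η] <;> linarith
    exact fun s hs => hsub ⟨s, hs, rfl⟩
  refine ⟨t', htt, ht'.1, hzone, ?_⟩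
  obtain ⟨ε', hε', -, hpv, -, -⟩ := h.step hP t'
  set η := min ε' (t' - t) / 2 with hη
  have hm : 0 < min ε' (t' - t) := lt_min hε' (by linarith)
  have hm1 := min_le_left ε' (t' - t)
  have hm2 := min_le_right ε' (t' - t)
  exact zones_disj _ _ (z (t' - η)) (hpv _ ⟨by linarith, by linarith⟩)
    (hzone _ ⟨by linarith, by linarith⟩)

end Orbits

section Cycle

open Filter Topology

variable {P Q : Fin 3 → ℂ → ℂ} {z : ℝ → ℂ}

lemma nextZ_up1 {w : ℂ} (h : w.im = 1) (h' : 0 < (1 / P 1 w).im) : nextZ P w = 0 := by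
  rw [nextZ, if_neg (by rw [h]; simp), if_pos h, if_pos h']

lemma nextZ_dn1 {w : ℂ} (h : w.im = 1) (h' : (1 / P 1 w).im < 0) : nextZ P w = 1 := by
  rw [nextZ, if_neg (by rw [h]; simp), if_pos h, if_neg h'.not_gt]

lemma nextZ_up2 {w : ℂ} (h : w.im = -1) (h' : 0 < (1 / P 1 w).im) : nextZ P w = 1 := by
  rw [nextZ, if_neg (by rw [h]; norm_num), if_neg (by rw [h]; norm_num),
    if_neg (by rw [h]; norm_num), if_pos h, if_pos h']

lemma nextZ_dn2 {w : ℂ} (h : w.im = -1) (h' : (1 / P 1 w).im < 0) : nextZ P w = 2 := by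
  rw [nextZ, if_neg (by rw [h]; norm_num), if_neg (by rw [h]; norm_num),
    if_neg (by rw [h]; norm_num), if_pos h, if_neg h'.not_gt]

lemma Orb.prev_cases (hP : ∀ σ, Continuous (P σ)) (h : Orb P z) (t : ℝ)
    (ht : (z t).im = 1 ∨ (z t).im = -1) :
    (prevZ P (z t) = 0 → (z t).im = 1 ∧ (1 / P 1 (z t)).im < 0) ∧
    (prevZ P (z t) = 1 → ((z t).im = 1 ∧ 0 < (1 / P 1 (z t)).im) ∨
      ((z t).im = -1 ∧ (1 / P 1 (z t)).im < 0)) ∧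
    (prevZ P (z t) = 2 → (z t).im = -1 ∧ 0 < (1 / P 1 (z t)).im) := by
  rcases ht with h1 | h1
  · have e2 : prevZ P (z t) = if 0 < (1 / P 1 (z t)).im then 1 else 0 := by
      rw [prevZ, if_neg (by rw [h1]; simp), if_pos h1]
    obtain ⟨ε, hε, ⟨a, b, c, d⟩ | ⟨a, b, c, d⟩⟩ := h.crossTop hP t h1
    · rw [if_pos a] at e2
      rw [e2]
      exact ⟨by intro hh; simp at hh, fun _ => Or.inl ⟨h1, a⟩, by intro hh; simp at hh⟩
    · rw [if_neg a.not_gt] at e2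
      rw [e2]
      exact ⟨fun _ => ⟨h1, a⟩, by intro hh; simp at hh, by intro hh; simp at hh⟩
  · have e2 : prevZ P (z t) = if 0 < (1 / P 1 (z t)).im then 2 else 1 := by
      rw [prevZ, if_neg (by rw [h1]; norm_num), if_neg (by rw [h1]; norm_num),
        if_neg (by rw [h1]; norm_num), if_pos h1]
    obtain ⟨ε, hε, ⟨a, b, c, d⟩ | ⟨a, b, c, d⟩⟩ := h.crossBot hP t h1
    · rw [if_pos a] at e2
      rw [e2]
      exact ⟨by intro hh; simp at hh, by intro hh; simp at hh, fun _ => ⟨h1, a⟩⟩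
    · rw [if_neg a.not_gt] at e2
      rw [e2]
      exact ⟨by intro hh; simp at hh, fun _ => Or.inr ⟨h1, a⟩, by intro hh; simp at hh⟩

lemma Orb.hit_up1 (hP : ∀ σ, Continuous (P σ)) (h : Orb P z) (t : ℝ)
    (h1 : (z t).im = 1) (h2 : 0 < (1 / P 1 (z t)).im) :
    ∃ t' > t, (∀ s ∈ Set.Ioo t t', z s ∈ zonesLines 0) ∧
      (z t').im = 1 ∧ (1 / P 1 (z t')).im < 0 := by
  obtain ⟨t', htt, hl, hz, hp⟩ := h.hit hP t (Or.inl h1)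
  rw [nextZ_up1 h1 h2] at hz hp
  exact ⟨t', htt, hz, (h.prev_cases hP t' hl).1 hp⟩

lemma Orb.hit_dn2 (hP : ∀ σ, Continuous (P σ)) (h : Orb P z) (t : ℝ)
    (h1 : (z t).im = -1) (h2 : (1 / P 1 (z t)).im < 0) :
    ∃ t' > t, (∀ s ∈ Set.Ioo t t', z s ∈ zonesLines 2) ∧
      (z t').im = -1 ∧ 0 < (1 / P 1 (z t')).im := by
  obtain ⟨t', htt, hl, hz, hp⟩ := h.hit hP t (Or.inr h1)
  rw [nextZ_dn2 h1 h2] at hz hp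
  exact ⟨t', htt, hz, (h.prev_cases hP t' hl).2.2 hp⟩

lemma Orb.hit_dn1 (hP : ∀ σ, Continuous (P σ)) (h : Orb P z) (t : ℝ)
    (h1 : (z t).im = 1) (h2 : (1 / P 1 (z t)).im < 0) :
    ∃ t' > t, (∀ s ∈ Set.Ioo t t', z s ∈ zonesLines 1) ∧
      (((z t').im = 1 ∧ 0 < (1 / P 1 (z t')).im) ∨
      ((z t').im = -1 ∧ (1 / P 1 (z t')).im < 0)) := by
  obtain ⟨t', htt, hl, hz, hp⟩ := h.hit hP t (Or.inl h1)
  rw [nextZ_dn1 h1 h2] at hz hp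
  exact ⟨t', htt, hz, (h.prev_cases hP t' hl).2.1 hp⟩

lemma Orb.hit_up2 (hP : ∀ σ, Continuous (P σ)) (h : Orb P z) (t : ℝ)
    (h1 : (z t).im = -1) (h2 : 0 < (1 / P 1 (z t)).im) :
    ∃ t' > t, (∀ s ∈ Set.Ioo t t', z s ∈ zonesLines 1) ∧
      (((z t').im = 1 ∧ 0 < (1 / P 1 (z t')).im) ∨
      ((z t').im = -1 ∧ (1 / P 1 (z t')).im < 0)) := by
  obtain ⟨t', htt, hl, hz, hp⟩ := h.hit hP t (Or.inr h1)
  rw [nextZ_up2 h1 h2] at hz hp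
  exact ⟨t', htt, hz, (h.prev_cases hP t' hl).2.1 hp⟩

lemma two_point {S : Set ℂ} (hS : S.encard = 2) {a b c : ℂ} (ha : a ∈ S) (hb : b ∈ S)
    (hc : c ∈ S) (hab : a ≠ b) (hcb : c ≠ b) : c = a := by
  obtain ⟨x, y, hxy, rfl⟩ := Set.encard_eq_two.1 hS
  simp only [Set.mem_insert_iff, Set.mem_singleton_iff] at ha hb hc
  rcases ha with rfl | rfl <;> rcases hb with rfl | rfl <;> rcases hc with rfl | rfl <;>
    first | rfl | exact absurd rfl hab | exact absurd rfl hcb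

lemma ne_of_sign {f : ℂ → ℂ} {a b : ℂ} (ha : 0 < (f a).im) (hb : (f b).im < 0) : a ≠ b := by
  rintro rfl
  exact absurd ha hb.not_gt

/-- the four arcs making up a cycle which meets each line in two points -/
structure Cyc (P : Fin 3 → ℂ → ℂ) (z : ℝ → ℂ) (t0 t1 t2 t3 t4 : ℝ) : Prop where
  h01 : t0 < t1
  h12 : t1 < t2
  h23 : t2 < t3
  h34 : t3 < t4
  i0 : (z t0).im = 1
  i1 : (z t1).im = 1
  i2 : (z t2).im = -1
  i3 : (z t3).im = -1
  s0 : 0 < (1 / P 1 (z t0)).im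
  s1 : (1 / P 1 (z t1)).im < 0
  s2 : (1 / P 1 (z t2)).im < 0
  s3 : 0 < (1 / P 1 (z t3)).im
  r0 : 0 < (1 / P 0 (z t0)).im
  r1 : (1 / P 0 (z t1)).im < 0
  r2 : (1 / P 2 (z t2)).im < 0
  r3 : 0 < (1 / P 2 (z t3)).im
  e : z t4 = z t0
  z01 : ∀ s ∈ Set.Ioo t0 t1, z s ∈ zonesLines 0
  z12 : ∀ s ∈ Set.Ioo t1 t2, z s ∈ zonesLines 1
  z23 : ∀ s ∈ Set.Ioo t2 t3, z s ∈ zonesLines 2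
  z34 : ∀ s ∈ Set.Ioo t3 t4, z s ∈ zonesLines 1

lemma Orb.exists_cyc (hP : ∀ σ, Continuous (P σ)) (hQ : ∀ σ z, HasDerivAt (Q σ) (P σ z) z)
    (h : Orb P z) (hT : (Set.range z ∩ {w : ℂ | w.im = 1}).encard = 2)
    (hB : (Set.range z ∩ {w : ℂ | w.im = -1}).encard = 2) :
    ∃ t0 t1 t2 t3 t4, Cyc P z t0 t1 t2 t3 t4 := by
  have hexT : ∃ t, (z t).im = 1 := by
    have : (Set.range z ∩ {w : ℂ | w.im = 1}).Nonempty := by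
      rw [Set.nonempty_iff_ne_empty]; intro h0; rw [h0] at hT; simp at hT
    obtain ⟨_, ⟨t, rfl⟩, ht⟩ := this
    exact ⟨t, ht⟩
  have hexB : ∃ t, (z t).im = -1 := by
    have : (Set.range z ∩ {w : ℂ | w.im = -1}).Nonempty := by
      rw [Set.nonempty_iff_ne_empty]; intro h0; rw [h0] at hB; simp at hB
    obtain ⟨_, ⟨t, rfl⟩, ht⟩ := this
    exact ⟨t, ht⟩
  have noTop : ∀ t0 t1 t2, t0 < t1 → t1 < t2 → (z t0).im = 1 → 0 < (1 / P 1 (z t0)).im →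
      (∀ s ∈ Set.Ioo t0 t1, z s ∈ zonesLines 0) → (z t1).im = 1 → (1 / P 1 (z t1)).im < 0 →
      (∀ s ∈ Set.Ioo t1 t2, z s ∈ zonesLines 1) → (z t2).im = 1 →
      0 < (1 / P 1 (z t2)).im → False := by
    intro t0 t1 t2 h01 h12 a0 b0 z0 a1 b1 z1 a2 b2
    have he : z t2 = z t0 := two_point hT ⟨⟨_, rfl⟩, a0⟩ ⟨⟨t1, rfl⟩, a1⟩ ⟨⟨_, rfl⟩, a2⟩
      (ne_of_sign (f := fun w => 1 / P 1 w) b0 b1) (ne_of_sign (f := fun w => 1 / P 1 w) b2 b1)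
    obtain ⟨u, hu⟩ := hexB
    obtain ⟨s, hs, hus⟩ := h.recur hP hQ t0 t2 (by linarith) he.symm u
    rw [hus] at hu
    rcases eq_or_lt_of_le hs.1 with rfl | h1
    · linarith
    rcases lt_trichotomy s t1 with h2 | rfl | h2
    · have := z0 s ⟨h1, h2⟩
      rw [mem_zone0] at this; linarith
    · linarith
    · have := z1 s ⟨h2, hs.2⟩
      rw [mem_zone1, abs_lt] at this; linarith [this.1]
  have noBot : ∀ t0 t1 t2, t0 < t1 → t1 < t2 → (z t0).im = -1 → (1 / P 1 (z t0)).im < 0 →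
      (∀ s ∈ Set.Ioo t0 t1, z s ∈ zonesLines 2) → (z t1).im = -1 → 0 < (1 / P 1 (z t1)).im →
      (∀ s ∈ Set.Ioo t1 t2, z s ∈ zonesLines 1) → (z t2).im = -1 →
      (1 / P 1 (z t2)).im < 0 → False := by
    intro t0 t1 t2 h01 h12 a0 b0 z0 a1 b1 z1 a2 b2
    have he : z t2 = z t0 := two_point hB ⟨⟨_, rfl⟩, a0⟩ ⟨⟨t1, rfl⟩, a1⟩ ⟨⟨_, rfl⟩, a2⟩
      (ne_of_sign (f := fun w => 1 / P 1 w) b1 b0).symm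
      (ne_of_sign (f := fun w => 1 / P 1 w) b1 b2).symm
    obtain ⟨u, hu⟩ := hexT
    obtain ⟨s, hs, hus⟩ := h.recur hP hQ t0 t2 (by linarith) he.symm u
    rw [hus] at hu
    rcases eq_or_lt_of_le hs.1 with rfl | h1
    · linarith
    rcases lt_trichotomy s t1 with h2 | rfl | h2
    · have := z0 s ⟨h1, h2⟩
      rw [mem_zone2] at this; linarith
    · linarith
    · have := z1 s ⟨h2, hs.2⟩
      rw [mem_zone1, abs_lt] at this; linarith [this.2]
  have fromDn2 : ∀ t2, (z t2).im = -1 → (1 / P 1 (z t2)).im < 0 → ∃ t3 t4, t2 < t3 ∧ t3 < t4 ∧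
      (∀ s ∈ Set.Ioo t2 t3, z s ∈ zonesLines 2) ∧ (z t3).im = -1 ∧ 0 < (1 / P 1 (z t3)).im ∧
      (∀ s ∈ Set.Ioo t3 t4, z s ∈ zonesLines 1) ∧ (z t4).im = 1 ∧ 0 < (1 / P 1 (z t4)).im := by
    intro t2 a2 b2
    obtain ⟨t3, h23, z23, a3, b3⟩ := h.hit_dn2 hP t2 a2 b2
    obtain ⟨t4, h34, z34, ⟨a4, b4⟩ | ⟨a4, b4⟩⟩ := h.hit_up2 hP t3 a3 b3
    · exact ⟨t3, t4, h23, h34, z23, a3, b3, z34, a4, b4⟩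
    · exact (noBot t2 t3 t4 h23 h34 a2 b2 z23 a3 b3 z34 a4 b4).elim
  have hup : ∃ t, (z t).im = 1 ∧ 0 < (1 / P 1 (z t)).im := by
    obtain ⟨t, ht⟩ := hexT
    obtain ⟨ε, hε, ⟨a, -⟩ | ⟨a, -⟩⟩ := h.crossTop hP t ht
    · exact ⟨t, ht, a⟩
    · obtain ⟨t2, -, -, hh | ⟨a2, b2⟩⟩ := h.hit_dn1 hP t ht a
      · exact ⟨t2, hh⟩
      · obtain ⟨t3, t4, -, -, -, -, -, -, hh⟩ := fromDn2 t2 a2 b2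
        exact ⟨t4, hh⟩
  obtain ⟨t0, a0, b0⟩ := hup
  obtain ⟨t1, h01, z01, a1, b1⟩ := h.hit_up1 hP t0 a0 b0
  obtain ⟨t2, h12, z12, ⟨a2, b2⟩ | ⟨a2, b2⟩⟩ := h.hit_dn1 hP t1 a1 b1
  · exact (noTop t0 t1 t2 h01 h12 a0 b0 z01 a1 b1 z12 a2 b2).elim
  obtain ⟨t3, t4, h23, h34, z23, a3, b3, z34, a4, b4⟩ := fromDn2 t2 a2 b2
  have he : z t4 = z t0 := two_point hT ⟨⟨_, rfl⟩, a0⟩ ⟨⟨t1, rfl⟩, a1⟩ ⟨⟨_, rfl⟩, a4⟩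
      (ne_of_sign (f := fun w => 1 / P 1 w) b0 b1) (ne_of_sign (f := fun w => 1 / P 1 w) b4 b1)
  refine ⟨t0, t1, t2, t3, t4, h01, h12, h23, h34, a0, a1, a2, a3, b0, b1, b2, b3, ?_, ?_, ?_, ?_,
    he, z01, z12, z23, z34⟩
  · obtain ⟨ε, hε, ⟨c, d, -⟩ | ⟨c, d, -⟩⟩ := h.crossTop hP t0 a0
    · exact d
    · exact absurd c b0.not_gt
  · obtain ⟨ε, hε, ⟨c, d, -⟩ | ⟨c, d, -⟩⟩ := h.crossTop hP t1 a1
    · exact absurd c b1.not_gt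
    · exact d
  · obtain ⟨ε, hε, ⟨c, d, -⟩ | ⟨c, d, -⟩⟩ := h.crossBot hP t2 a2
    · exact absurd c b2.not_gt
    · exact d
  · obtain ⟨ε, hε, ⟨c, d, -⟩ | ⟨c, d, -⟩⟩ := h.crossBot hP t3 a3
    · exact d
    · exact absurd c b3.not_gt

end Cycle

section Perturb

open Filter Topology

variable {P Q : Fin 3 → ℂ → ℂ} {z : ℝ → ℂ}

lemma transv_pos {σ₁ σ₂ : Fin 3} {p : ℂ} (h1 : 0 < (1 / P σ₁ p).im) (h2 : 0 < (1 / P σ₂ p).im) :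
    Transv (fun σ w => 1 / P σ w) curvesLines σ₁ σ₂ p := by
  intro g hg _
  simp only [fderiv_curve g hg]
  exact ⟨h1.ne', h2.ne', fun _ => h2, fun _ => h1⟩

lemma transv_neg {σ₁ σ₂ : Fin 3} {p : ℂ} (h1 : (1 / P σ₁ p).im < 0) (h2 : (1 / P σ₂ p).im < 0) :
    Transv (fun σ w => 1 / P σ w) curvesLines σ₁ σ₂ p := by
  intro g hg _
  simp only [fderiv_curve g hg]
  exact ⟨h1.ne, h2.ne, fun h => absurd h h1.not_gt, fun h => absurd h h2.not_gt⟩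

lemma pos_near (hP : ∀ σ, Continuous (P σ)) {σ : Fin 3} {p : ℂ} (h : 0 < (1 / P σ p).im) :
    ∀ᶠ w in 𝓝 p, 0 < (1 / P σ w).im := by
  have hne : P σ p ≠ 0 := by intro h0; rw [h0] at h; simp at h
  have hc : ContinuousAt (fun w => (1 / P σ w).im) p :=
    Complex.continuous_im.continuousAt.comp (continuousAt_const.div (hP σ).continuousAt hne)
  exact hc.eventually (lt_mem_nhds h)

lemma neg_near (hP : ∀ σ, Continuous (P σ)) {σ : Fin 3} {p : ℂ} (h : (1 / P σ p).im < 0) :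
    ∀ᶠ w in 𝓝 p, (1 / P σ w).im < 0 := by
  have hne : P σ p ≠ 0 := by intro h0; rw [h0] at h; simp at h
  have hc : ContinuousAt (fun w => (1 / P σ w).im) p :=
    Complex.continuous_im.continuousAt.comp (continuousAt_const.div (hP σ).continuousAt hne)
  exact hc.eventually (gt_mem_nhds h)

lemma ne_of_im {p : ℂ} {σ : Fin 3} (h : (1 / P σ p).im ≠ 0) : P σ p ≠ 0 := by
  intro h0; rw [h0] at h; simp at h

lemma Orb.arc (hP : ∀ σ, Continuous (P σ)) (hQ : ∀ σ z, HasDerivAt (Q σ) (P σ z) z)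
    (h : Orb P z) (U : Set ℂ) (hU : IsOpen U) (hzU : Set.range z ⊆ U) (σ : Fin 3) (a b : ℝ)
    (hab : a < b) (hz : ∀ s ∈ Set.Ioo a b, z s ∈ zonesLines σ)
    (ℓp ℓq : ℂ →L[ℝ] ℝ)
    (hZp : ∀ᶠ w in 𝓝 (z a), ℓp (z a) < ℓp w → w ∈ zonesLines σ) (hlp : 0 < ℓp (1 / P σ (z a)))
    (hZq : ∀ᶠ w in 𝓝 (z b), ℓq w < ℓq (z b) → w ∈ zonesLines σ) (hlq : 0 < ℓq (1 / P σ (z b))) :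
    ∀ᶠ x in 𝓝 (z a, z b), ℓp x.1 = ℓp (z a) → ℓq x.2 = ℓq (z b) →
      (Q σ x.1).im = (Q σ x.2).im → IsArc (zonesLines σ) U (fun w => 1 / P σ w) x.1 x.2 := by
  refine arc_perturb (Q σ) (P σ) (hQ σ) (hP σ) (zonesLines σ) U (zones_open σ) hU z a b hab
    h.cont.continuousOn (fun t ht => h.ode t σ (hz t ht)) hz ?_ (fun t _ => hzU ⟨t, rfl⟩)
    ℓp ℓq hZp hlp hZq hlq
  intro t ht
  rcases eq_or_lt_of_le ht.1 with rfl | h1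
  · intro h0; rw [h0] at hlp; simp at hlp
  rcases eq_or_lt_of_le ht.2 with rfl | h2
  · intro h0; rw [h0] at hlq; simp at hlq
  exact h.ne_zone t σ (hz t ⟨h1, h2⟩)

lemma cyc_perturb (hP : ∀ σ, Continuous (P σ)) (hQ : ∀ σ z, HasDerivAt (Q σ) (P σ z) z)
    (h : Orb P z) {t0 t1 t2 t3 t4 : ℝ} (C : Cyc P z t0 t1 t2 t3 t4)
    (U : Set ℂ) (hU : IsOpen U) (hzU : Set.range z ⊆ U) :
    ∀ᶠ x in 𝓝 (z t0, z t1, z t2, z t3), x.1.im = 1 → x.2.1.im = 1 → x.2.2.1.im = -1 →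
      x.2.2.2.im = -1 → (Q 0 x.1).im = (Q 0 x.2.1).im → (Q 1 x.2.1).im = (Q 1 x.2.2.1).im →
      (Q 2 x.2.2.1).im = (Q 2 x.2.2.2).im → (Q 1 x.2.2.2).im = (Q 1 x.1).im →
      ∃ w, IsCrossingPeriodicOrbit zonesLines (fun σ w => 1 / P σ w) curvesLines w ∧
        Set.range w ⊆ U ∧ x.2.2.1 ∈ Set.range w := by
  have lo : ∀ p : ℂ, p.im = 1 → ∀ᶠ w : ℂ in 𝓝 p, -1 < w.im := fun p hp =>
    Complex.continuous_im.continuousAt.eventually (lt_mem_nhds (by rw [hp]; norm_num))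
  have hi : ∀ p : ℂ, p.im = -1 → ∀ᶠ w : ℂ in 𝓝 p, w.im < 1 := fun p hp =>
    Complex.continuous_im.continuousAt.eventually (gt_mem_nhds (by rw [hp]; norm_num))
  have A01 := h.arc hP hQ U hU hzU 0 t0 t1 C.h01 C.z01 Complex.imCLM (-Complex.imCLM)
    (Eventually.of_forall fun w hw => by
      simp only [Complex.imCLM_apply, C.i0] at hw; exact hw) C.r0
    (Eventually.of_forall fun w hw => by
      simp only [_root_.neg_apply, Complex.imCLM_apply, C.i1] at hw
      rw [mem_zone0]; linarith)
    (by simpa only [_root_.neg_apply, Complex.imCLM_apply] using neg_pos.2 C.r1)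
  have A12 := h.arc hP hQ U hU hzU 1 t1 t2 C.h12 C.z12 (-Complex.imCLM) (-Complex.imCLM)
    ((lo _ C.i1).mono fun w hw' hw => by
      simp only [_root_.neg_apply, Complex.imCLM_apply, C.i1] at hw
      rw [mem_zone1, abs_lt]; constructor <;> linarith)
    (by simpa only [_root_.neg_apply, Complex.imCLM_apply] using neg_pos.2 C.s1)
    ((hi _ C.i2).mono fun w hw' hw => by
      simp only [_root_.neg_apply, Complex.imCLM_apply, C.i2] at hw
      rw [mem_zone1, abs_lt]; constructor <;> linarith)
    (by simpa only [_root_.neg_apply, Complex.imCLM_apply] using neg_pos.2 C.s2)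
  have A23 := h.arc hP hQ U hU hzU 2 t2 t3 C.h23 C.z23 (-Complex.imCLM) (Complex.imCLM)
    (Eventually.of_forall fun w hw => by
      simp only [_root_.neg_apply, Complex.imCLM_apply, C.i2] at hw
      rw [mem_zone2]; linarith)
    (by simpa only [_root_.neg_apply, Complex.imCLM_apply] using neg_pos.2 C.r2)
    (Eventually.of_forall fun w hw => by
      simp only [Complex.imCLM_apply, C.i3] at hw
      exact hw) C.r3
  have A34 := h.arc hP hQ U hU hzU 1 t3 t4 C.h34 C.z34 (Complex.imCLM) (Complex.imCLM)
    ((hi _ C.i3).mono fun w hw' hw => by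
      simp only [Complex.imCLM_apply, C.i3] at hw
      rw [mem_zone1, abs_lt]; constructor <;> linarith) C.s3
    ((lo _ (by rw [C.e]; exact C.i0)).mono fun w hw' hw => by
      simp only [Complex.imCLM_apply, C.e, C.i0] at hw
      rw [mem_zone1, abs_lt]; constructor <;> linarith) (by rw [C.e]; exact C.s0)
  rw [C.e] at A34
  have p0 : Tendsto (fun x : ℂ × ℂ × ℂ × ℂ => x.1) (𝓝 (z t0, z t1, z t2, z t3)) (𝓝 (z t0)) :=
    Continuous.tendsto' (by fun_prop) _ _ rfl
  have p1 : Tendsto (fun x : ℂ × ℂ × ℂ × ℂ => x.2.1) (𝓝 (z t0, z t1, z t2, z t3)) (𝓝 (z t1)) :=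
    Continuous.tendsto' (by fun_prop) _ _ rfl
  have p2 : Tendsto (fun x : ℂ × ℂ × ℂ × ℂ => x.2.2.1) (𝓝 (z t0, z t1, z t2, z t3)) (𝓝 (z t2)) :=
    Continuous.tendsto' (by fun_prop) _ _ rfl
  have p3 : Tendsto (fun x : ℂ × ℂ × ℂ × ℂ => x.2.2.2) (𝓝 (z t0, z t1, z t2, z t3)) (𝓝 (z t3)) :=
    Continuous.tendsto' (by fun_prop) _ _ rfl
  filter_upwards [(p0.prodMk_nhds p1).eventually A01, (p1.prodMk_nhds p2).eventually A12,
    (p2.prodMk_nhds p3).eventually A23, (p3.prodMk_nhds p0).eventually A34,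
    p0.eventually (pos_near hP C.s0), p0.eventually (pos_near hP C.r0),
    p1.eventually (neg_near hP C.s1), p1.eventually (neg_near hP C.r1),
    p2.eventually (neg_near hP C.s2), p2.eventually (neg_near hP C.r2),
    p3.eventually (pos_near hP C.s3), p3.eventually (pos_near hP C.r3)]
  rintro ⟨x0, x1, x2, x3⟩ B01 B12 B23 B34 s0 r0 s1 r1 s2 r2 s3 r3 i0 i1 i2 i3 q01 q12 q23 q30
  simp only [_root_.neg_apply, Complex.imCLM_apply, C.i0, C.i1, C.i2, C.i3]
    at i0 i1 i2 i3 B01 B12 B23 B34 q01 q12 q23 q30 s0 r0 s1 r1 s2 r2 s3 r3 ⊢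
  have D01 := B01 i0 (by rw [i1]) q01
  have D12 := B12 (by rw [i1]) (by rw [i2]) q12
  have D23 := B23 (by rw [i2]) i3 q23
  have D34 := B34 i3 i0 q30
  have cl : ∀ {w : ℂ}, w.im = 1 ∨ w.im = -1 → ∃ g ∈ curvesLines, g w = 0 :=
    fun {w} hw => (curve_iff w).2 hw
  obtain ⟨τ0, γ0, G0⟩ := IsArc.goodPath (fields := fun σ w => 1 / P σ w) zones_disj zones_curves D01
  obtain ⟨τ1, γ1, G1⟩ := IsArc.goodPath (fields := fun σ w => 1 / P σ w) zones_disj zones_curves D12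
  obtain ⟨τ2, γ2, G2⟩ := IsArc.goodPath (fields := fun σ w => 1 / P σ w) zones_disj zones_curves D23
  obtain ⟨τ3, γ3, G3⟩ := IsArc.goodPath (fields := fun σ w => 1 / P σ w) zones_disj zones_curves D34
  have E1 := GoodPath.cat zones_curves G2 G3 (by decide) (cl (Or.inr i3)) (transv_pos r3 s3)
  have E2 := GoodPath.cat zones_curves E1 G0 (by decide) (cl (Or.inl i0)) (transv_pos s0 r0)
  have E3 := GoodPath.cat zones_curves E2 G1 (by decide) (cl (Or.inl i1)) (transv_neg r1 s1)
  exact GoodPath.close zones_curves E3 (by decide) (cl (Or.inr i2)) (transv_neg s2 r2)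

end Perturb

section Final

open Filter Topology Polynomial

variable {P Q : Fin 3 → ℂ → ℂ} {z : ℝ → ℂ}

lemma Orb.range_eq (hP : ∀ σ, Continuous (P σ)) (hQ : ∀ σ z, HasDerivAt (Q σ) (P σ z) z)
    {w : ℝ → ℂ} (h : Orb P z) (h' : Orb P w) {p : ℂ} (hp : p ∈ Set.range z)
    (hp' : p ∈ Set.range w) : Set.range z = Set.range w := by
  obtain ⟨t, rfl⟩ := hp
  obtain ⟨t', ht'⟩ := hp'
  have hu := h.unique hP hQ h' t t' ht'.symm
  ext x
  constructor
  · rintro ⟨r, rfl⟩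
    exact ⟨t' + (r - t), by rw [← hu]; congr 1; ring⟩
  · rintro ⟨r, rfl⟩
    exact ⟨t + (r - t'), by rw [hu]; congr 1; ring⟩

/-- the reflection `x ↦ s - x` on the line `Im = k` given by the half-return map of a linear
zone -/
def HasRefl (Q P : ℂ → ℂ) (k s : ℝ) : Prop :=
  ∀ p q : ℂ, p.im = k → q.im = k → p ≠ q → (Q p).im = (Q q).im → (1 / P p).im ≠ 0 →
    p.re + q.re = s ∧
    ∀ p q : ℂ, p.im = k → q.im = k → p.re + q.re = s → (Q p).im = (Q q).im

lemma quad_im (z1 z0 p : ℂ) : (z1 * (p - z0) ^ 2 / 2).im =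
    z1.re * (p.re - z0.re) * (p.im - z0.im) +
      z1.im * ((p.re - z0.re) ^ 2 - (p.im - z0.im) ^ 2) / 2 := by
  have : (z1 * (p - z0) ^ 2 / 2).im = (z1 * (p - z0) ^ 2).im / 2 := by
    rw [show (2 : ℂ) = ((2 : ℝ) : ℂ) by norm_num, Complex.div_ofReal_im]
  rw [this]
  simp only [pow_two, Complex.mul_im, Complex.mul_re, Complex.sub_re, Complex.sub_im]
  ring

lemma im_inv_ne {w : ℂ} : (1 / w).im ≠ 0 → w.im ≠ 0 := by
  intro h h0
  apply h
  rw [one_div, Complex.inv_im, h0]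
  simp

lemma hasRefl_quad (z1 z0 : ℂ) (k : ℝ) :
    HasRefl (fun w => z1 * (w - z0) ^ 2 / 2) (fun w => z1 * (w - z0)) k
      (2 * z0.re - 2 * z1.re * (k - z0.im) / z1.im) := by
  intro p q hp hq hne heq him
  have him' := im_inv_ne him
  simp only [quad_im, hp, hq] at heq
  simp only [Complex.mul_im, Complex.sub_re, Complex.sub_im, hp] at him'
  have hre : p.re - q.re ≠ 0 := by
    intro h0
    exact hne (Complex.ext (by linarith) (by rw [hp, hq]))
  have hk : z1.re * (k - z0.im) + z1.im * (p.re + q.re - 2 * z0.re) / 2 = 0 := by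
    apply mul_left_cancel₀ hre
    linear_combination heq
  have hβ : z1.im ≠ 0 := by
    intro h0
    rw [h0] at hk him'
    apply him'
    linear_combination hk
  refine ⟨?_, ?_⟩
  · field_simp
    linear_combination 2 * hk
  · intro p q hp hq hs
    simp only [quad_im, hp, hq]
    have hs' : z1.re * (k - z0.im) + z1.im * (p.re + q.re - 2 * z0.re) / 2 = 0 := by
      rw [hs]; field_simp; ring
    linear_combination (p.re - q.re) * hs'

def Isol (A B : ℝ[X]) (s s' : ℝ) (p : Fin 2 → ℝ) : Prop :=
  ∀ᶠ q in 𝓝 p, A.eval (q 0) = B.eval (q 1) → A.eval (s - q 0) = B.eval (s' - q 1) → q = p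

lemma isol_refl (A B : ℝ[X]) (s s' b c : ℝ) (h : Isol A B s s' ![b, c]) :
    Isol A B s s' ![s - b, s' - c] := by
  have ht : Tendsto (fun q : Fin 2 → ℝ => (![s - q 0, s' - q 1] : Fin 2 → ℝ))
      (𝓝 ![s - b, s' - c]) (𝓝 ![b, c]) := by
    refine Continuous.tendsto' ?_ _ _ ?_
    · refine continuous_pi fun i => ?_
      fin_cases i
      · exact continuous_const.sub (continuous_apply 0)
      · exact continuous_const.sub (continuous_apply 1)
    · ext i; fin_cases i <;> simp
  filter_upwards [ht.eventually h] with q hq h1 h2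
  simp only [Matrix.cons_val_zero, Matrix.cons_val_one, sub_sub_cancel] at hq
  have hq' := hq h2 h1
  have e0 := congrFun hq' 0
  have e1 := congrFun hq' 1
  simp only [Matrix.cons_val_zero, Matrix.cons_val_one] at e0 e1
  ext i; fin_cases i
  · simp only [Fin.zero_eta, Matrix.cons_val_zero]; linarith
  · change q 1 = s' - c
    linarith

structure Dat (P : Fin 3 → ℂ → ℂ) (A B : ℝ[X]) (s s' : ℝ) (L : Set ℂ) (b c : ℝ) : Prop where
  orb : ∃ z, Orb P z ∧ Set.range z = L
  mb : (b : ℂ) + I ∈ L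
  ma : ((s - b : ℝ) : ℂ) + I ∈ L
  sb : (1 / P 1 ((b : ℂ) + I)).im < 0
  sa : 0 < (1 / P 1 (((s - b : ℝ) : ℂ) + I)).im
  e1 : A.eval b = B.eval c
  e2 : A.eval (s - b) = B.eval (s' - c)
  isol : Isol A B s s' ![b, c]

lemma cycle_data (hP : ∀ σ, Continuous (P σ)) (hQ : ∀ σ z, HasDerivAt (Q σ) (P σ z) z)
    (s s' : ℝ) (hr0 : HasRefl (Q 0) (P 0) 1 s) (hr2 : HasRefl (Q 2) (P 2) (-1) s')
    (A B : ℝ[X]) (hA : ∀ x : ℝ, A.eval x = (Q 1 ((x : ℂ) + I)).im)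
    (hB : ∀ x : ℝ, B.eval x = (Q 1 ((x : ℂ) + -I)).im)
    (hA' : ∀ x : ℝ, A.derivative.eval x = (P 1 ((x : ℂ) + I)).im)
    (h : Orb P z)
    (hl : IsCrossingLimitCycle zonesLines (fun σ w => 1 / P σ w) curvesLines z)
    (hT2 : (Set.range z ∩ {w : ℂ | w.im = 1}).encard = 2)
    (hB2 : (Set.range z ∩ {w : ℂ | w.im = -1}).encard = 2) :
    ∃ b c, Dat P A B s s' (Set.range z) b c := by
  obtain ⟨t0, t1, t2, t3, t4, C⟩ := h.exists_cyc hP hQ hT2 hB2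
  have top : ∀ w : ℂ, w.im = 1 → (w.re : ℂ) + I = w := fun w hw =>
    Complex.ext (by simp) (by simp [hw])
  have bot : ∀ w : ℂ, w.im = -1 → (w.re : ℂ) + -I = w := fun w hw =>
    Complex.ext (by simp) (by simp [hw])
  have q01 : (Q 0 (z t0)).im = (Q 0 (z t1)).im := by
    rw [h.prim hQ 0 t0 t1 C.h01 C.z01]; simp [-Complex.ofReal_sub]
  have q12 : (Q 1 (z t1)).im = (Q 1 (z t2)).im := by
    rw [h.prim hQ 1 t1 t2 C.h12 C.z12]; simp [-Complex.ofReal_sub]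
  have q23 : (Q 2 (z t2)).im = (Q 2 (z t3)).im := by
    rw [h.prim hQ 2 t2 t3 C.h23 C.z23]; simp [-Complex.ofReal_sub]
  have q34 : (Q 1 (z t3)).im = (Q 1 (z t0)).im := by
    rw [← C.e, h.prim hQ 1 t3 t4 C.h34 C.z34]; simp [-Complex.ofReal_sub]
  obtain ⟨hs, hsQ⟩ := hr0 (z t0) (z t1) C.i0 C.i1
    (ne_of_sign (f := fun w => 1 / P 1 w) C.s0 C.s1) q01 C.r0.ne'
  have hne23 : z t2 ≠ z t3 := (ne_of_sign (f := fun w => 1 / P 1 w) C.s3 C.s2).symm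
  obtain ⟨hs', hsQ'⟩ := hr2 (z t2) (z t3) C.i2 C.i3 hne23 q23 C.r2.ne
  have ea : s - (z t1).re = (z t0).re := by linarith
  have ed : s' - (z t2).re = (z t3).re := by linarith
  have e1 : A.eval (z t1).re = B.eval (z t2).re := by
    rw [hA, hB, top _ C.i1, bot _ C.i2, q12]
  have e2 : A.eval (z t0).re = B.eval (z t3).re := by
    rw [hA, hB, top _ C.i0, bot _ C.i3, q34]
  refine ⟨(z t1).re, (z t2).re, ⟨z, h, rfl⟩, ?_, ?_, ?_, ?_, e1, ?_, ?_⟩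
  · rw [top _ C.i1]; exact ⟨_, rfl⟩
  · rw [ea, top _ C.i0]; exact ⟨_, rfl⟩
  · rw [top _ C.i1]; exact C.s1
  · rw [ea, top _ C.i0]; exact C.s0
  · rw [ea, ed]; exact e2
  obtain ⟨-, U, hU, hzU, hiso⟩ := hl
  have hpert := cyc_perturb hP hQ h C U hU hzU
  have hΦ : Tendsto (fun q : Fin 2 → ℝ => ((((s - q 0 : ℝ) : ℂ) + I, (q 0 : ℂ) + I,
      (q 1 : ℂ) + -I, ((s' - q 1 : ℝ) : ℂ) + -I) : ℂ × ℂ × ℂ × ℂ))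
      (𝓝 ![(z t1).re, (z t2).re]) (𝓝 (z t0, z t1, z t2, z t3)) := by
    refine Continuous.tendsto' (by fun_prop) _ _ ?_
    simp only [Matrix.cons_val_zero, Matrix.cons_val_one, ea, ed, top _ C.i0, top _ C.i1,
      bot _ C.i2, bot _ C.i3]
  have c0 : Tendsto (fun q : Fin 2 → ℝ => q 0) (𝓝 ![(z t1).re, (z t2).re]) (𝓝 (z t1).re) :=
    Continuous.tendsto' (continuous_apply 0) _ _ rfl
  have c1 : Tendsto (fun q : Fin 2 → ℝ => q 1) (𝓝 ![(z t1).re, (z t2).re]) (𝓝 (z t2).re) :=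
    Continuous.tendsto' (continuous_apply 1) _ _ rfl
  have hcd : (z t2).re ≠ (z t3).re := fun h0 =>
    hne23 (Complex.ext h0 (by rw [C.i2, C.i3]))
  have hder : A.derivative.eval (z t1).re ≠ 0 := by
    rw [hA', top _ C.i1]; exact im_inv_ne C.s1.ne
  have hloc : ∀ᶠ x in 𝓝 (z t1).re, A.eval x = A.eval (z t1).re → x = (z t1).re := by
    have := (A.hasDerivAt (z t1).re).eventually_ne hder (c := A.eval (z t1).re)
    rw [eventually_nhdsWithin_iff] at this
    filter_upwards [this] with x hx he
    by_contra hne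
    exact hx hne he
  filter_upwards [hΦ.eventually hpert, c0.eventually hloc, c1.eventually_ne hcd]
    with q hq hql hqd h1 h2
  obtain ⟨w, hw, hwU, hmem⟩ := hq (by simp) (by simp) (by simp) (by simp)
    (hsQ _ _ (by simp) (by simp) (by simp)) (by rw [← hA, ← hB, h1])
    (hsQ' _ _ (by simp) (by simp) (by simp)) (by rw [← hA, ← hB, h2])
  rw [hiso w hw hwU] at hmem
  have hy : (q 1 : ℂ) + -I = z t2 := by
    refine two_point hB2 ⟨⟨_, rfl⟩, C.i2⟩ ⟨⟨t3, rfl⟩, C.i3⟩ ⟨hmem, by simp⟩ hne23 ?_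
    intro h0
    apply hqd
    rw [← h0]; simp
  have hy' : q 1 = (z t2).re := by rw [← hy]; simp
  rw [hy', ← e1] at h1
  have hx := hql h1
  ext i; fin_cases i
  · exact hx
  · exact hy'

lemma count (hP : ∀ σ, Continuous (P σ)) (hQ : ∀ σ z, HasDerivAt (Q σ) (P σ z) z)
    (n : ℕ) (A B : ℝ[X]) (hA : A.natDegree ≤ n + 1) (hB : B.natDegree ≤ n + 1) (s s' : ℝ)
    (hA' : ∀ x : ℝ, A.derivative.eval x = (P 1 ((x : ℂ) + I)).im)
    (S : Set (Set ℂ)) (hS : ∀ L ∈ S, ∃ b c, Dat P A B s s' L b c) :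
    S.encard ≤ (n * (n + 1) / 2 : ℕ) := by
  classical
  by_contra! hlt
  obtain ⟨T, hTS, hT⟩ := Set.exists_subset_encard_eq
    (show ((n * (n + 1) / 2 + 1 : ℕ) : ℕ∞) ≤ S.encard by
      push_cast
      exact Order.add_one_le_of_lt hlt)
  have hTf : T.Finite := Set.finite_of_encard_eq_coe hT
  obtain ⟨F, rfl⟩ := hTf.exists_finset_coe
  rw [Set.encard_coe_eq_coe_finsetCard] at hT
  have hT' : F.card = n * (n + 1) / 2 + 1 := by exact_mod_cast hT
  have hS' : ∀ L, ∃ b c, L ∈ S → Dat P A B s s' L b c := by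
    intro L
    by_cases hL : L ∈ S
    · obtain ⟨b, c, h⟩ := hS L hL
      exact ⟨b, c, fun _ => h⟩
    · exact ⟨0, 0, fun h => absurd h hL⟩
  choose b c hbc using hS'
  have hD : ∀ L ∈ F, Dat P A B s s' L (b L) (c L) := fun L hL => hbc L (hTS hL)
  set f : Set ℂ → Fin 2 → ℝ := fun L => ![b L, c L] with hf
  set g : Set ℂ → Fin 2 → ℝ := fun L => ![s - b L, s' - c L] with hg
  have hinj : ∀ L ∈ F, ∀ L' ∈ F, b L = b L' → L = L' := by
    intro L hL L' hL' he
    obtain ⟨z, hz, hzL⟩ := (hD L hL).orb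
    obtain ⟨w, hw, hwL⟩ := (hD L' hL').orb
    have m1 := (hD L hL).mb
    have m2 := (hD L' hL').mb
    rw [← he] at m2
    rw [← hzL, ← hwL]
    exact hz.range_eq hP hQ hw (by rw [hzL]; exact m1) (by rw [hwL]; exact m2)
  have hfi : Set.InjOn f F := fun L hL L' hL' he => hinj L hL L' hL' (congrFun he 0)
  have hgi : Set.InjOn g F := fun L hL L' hL' he => hinj L hL L' hL' (by
    have : s - b L = s - b L' := congrFun he 0
    linarith)
  have hdisj : Disjoint (F.image f) (F.image g) := by
    rw [Finset.disjoint_left]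
    intro p hp hp'
    obtain ⟨L, hL, rfl⟩ := Finset.mem_image.1 hp
    obtain ⟨L', hL', he⟩ := Finset.mem_image.1 hp'
    have e : s - b L' = b L := congrFun he 0
    have h1 := (hD L hL).sb
    have h2 := (hD L' hL').sa
    rw [e] at h2
    linarith
  have hcard : (F.image f ∪ F.image g).card = 2 * (n * (n + 1) / 2 + 1) := by
    rw [Finset.card_union_of_disjoint hdisj, Finset.card_image_of_injOn hfi,
      Finset.card_image_of_injOn hgi, hT']
    ring
  have hle := alg_bound n A B hA hB s s' (F.image f ∪ F.image g) ?_ ?_ ?_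
  · rw [hcard, mul_comm (n + 1) n] at hle
    omega
  · intro p hp
    rcases Finset.mem_union.1 hp with hp | hp
    · obtain ⟨L, hL, rfl⟩ := Finset.mem_image.1 hp
      exact ⟨(hD L hL).e1, (hD L hL).e2⟩
    · obtain ⟨L, hL, rfl⟩ := Finset.mem_image.1 hp
      refine ⟨(hD L hL).e2, ?_⟩
      simp only [hg, Matrix.cons_val_zero, Matrix.cons_val_one, sub_sub_cancel]
      exact (hD L hL).e1
  · intro p hp
    rcases Finset.mem_union.1 hp with hp | hp
    · obtain ⟨L, hL, rfl⟩ := Finset.mem_image.1 hp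
      rw [hA']
      exact im_inv_ne (hD L hL).sb.ne
    · obtain ⟨L, hL, rfl⟩ := Finset.mem_image.1 hp
      rw [hA']
      exact im_inv_ne (hD L hL).sa.ne'
  · intro p hp
    rcases Finset.mem_union.1 hp with hp | hp
    · obtain ⟨L, hL, rfl⟩ := Finset.mem_image.1 hp
      exact (hD L hL).isol
    · obtain ⟨L, hL, rfl⟩ := Finset.mem_image.1 hp
      exact isol_refl A B s s' _ _ (hD L hL).isol

end Final
/-- **Theorem D(a).** The system `ż = 1/(z₁⁺(z - z₀⁺))` in `Σ₊`,
`ż = 1/(∑_{j=0}^{n} z_j^c z^j)` in `Σ_c`, `ż = 1/(z₁⁻(z - z₀⁻))` in `Σ₋`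
(with `z₁^± ≠ 0`, `z_n^c ≠ 0`, `n ≥ 1`) has at most `n(n+1)/2` crossing limit cycles that
intersect each of the lines `Im z = 1` and `Im z = -1` at exactly two points, the denominators
being nonvanishing on the closures of the respective zones along the orbits considered. -/
theorem at_most_limit_cycles_C1 (n : ℕ) (hn : 1 ≤ n)
    (z1p z1m z0p z0m : ℂ) (hp : z1p ≠ 0) (hm : z1m ≠ 0)
    (zc : ℕ → ℂ) (hc : zc n ≠ 0) :
    {s : Set ℂ | ∃ z : ℝ → ℂ,
        IsCrossingLimitCycle zonesLines
          ![fun w => 1 / (z1p * (w - z0p)),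
            fun w => 1 / (∑ j ∈ Finset.range (n+1), zc j * w ^ j),
            fun w => 1 / (z1m * (w - z0m))]
          curvesLines z ∧
        Set.range z = s ∧
        (s ∩ {w : ℂ | w.im = 1}).encard = 2 ∧
        (s ∩ {w : ℂ | w.im = -1}).encard = 2 ∧
        (∀ w ∈ s, 1 ≤ w.im → z1p * (w - z0p) ≠ 0) ∧
        (∀ w ∈ s, |w.im| ≤ 1 → (∑ j ∈ Finset.range (n+1), zc j * w ^ j) ≠ 0) ∧
        (∀ w ∈ s, w.im ≤ -1 → z1m * (w - z0m) ≠ 0)}.encard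
      ≤ (n * (n + 1) / 2 : ℕ) := by
  set P : Fin 3 → ℂ → ℂ := ![fun w => z1p * (w - z0p),
    fun w => ∑ j ∈ Finset.range (n+1), zc j * w ^ j, fun w => z1m * (w - z0m)] with hPdef
  set Q : Fin 3 → ℂ → ℂ := ![fun w => z1p * (w - z0p) ^ 2 / 2, primC n zc,
    fun w => z1m * (w - z0m) ^ 2 / 2] with hQdef
  have hfields : (![fun w => 1 / (z1p * (w - z0p)),
            fun w => 1 / (∑ j ∈ Finset.range (n+1), zc j * w ^ j),
            fun w => 1 / (z1m * (w - z0m))] : Fin 3 → ℂ → ℂ) = fun σ w => 1 / P σ w := by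
    funext σ w
    fin_cases σ <;> rfl
  have hquad : ∀ a b w : ℂ, HasDerivAt (fun w => a * (w - b) ^ 2 / 2) (a * (w - b)) w := by
    intro a b w
    have h1 : HasDerivAt (fun w : ℂ => w - b) 1 w := (hasDerivAt_id w).sub_const b
    have h2 := ((h1.pow 2).const_mul a).div_const 2
    have e : a * (w - b) = a * (((2 : ℕ) : ℂ) * (w - b) ^ (2 - 1) * 1) / 2 := by
      push_cast
      ring
    rw [e]
    exact h2
  have hP : ∀ σ, Continuous (P σ) := by
    intro σ
    fin_cases σ
    · change Continuous fun w => z1p * (w - z0p)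
      fun_prop
    · change Continuous fun w => ∑ j ∈ Finset.range (n+1), zc j * w ^ j
      fun_prop
    · change Continuous fun w => z1m * (w - z0m)
      fun_prop
  have hQ : ∀ σ w, HasDerivAt (Q σ) (P σ w) w := by
    intro σ w
    fin_cases σ
    · exact hquad z1p z0p w
    · exact hasDerivAt_primC n zc w
    · exact hquad z1m z0m w
  obtain ⟨A, hAd, hA, hA'⟩ := exists_line_poly n zc I
  obtain ⟨B, hBd, hB, -⟩ := exists_line_poly n zc (-I)
  rw [hfields]
  refine count hP hQ n A B hAd hBd (2 * z0p.re - 2 * z1p.re * (1 - z0p.im) / z1p.im)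
    (2 * z0m.re - 2 * z1m.re * (-1 - z0m.im) / z1m.im) hA' _ ?_
  rintro L ⟨z, hl, rfl, hT2, hB2, n0, n1, n2⟩
  exact cycle_data hP hQ _ _ (hasRefl_quad z1p z0p 1) (hasRefl_quad z1m z0m (-1)) A B hA hB hA'
    ⟨hl.1, fun t => n0 _ ⟨t, rfl⟩, fun t => n1 _ ⟨t, rfl⟩, fun t => n2 _ ⟨t, rfl⟩⟩ hl hT2 hB2
end

section
/- Let a, b, c, d, x₀, x₁ be real numbers with a < 0, c < 0, b > 0, d > 0, x₀ > 0 and x₁ > 0. Then the piecewise holomorphic system ż = (a+ib)(z − i + x₁) for z ∈ Σ_+, ż = iz for z ∈ Σ_c, ż = (c+id)(z + i − x₀) for z ∈ Σ_−, has a crossing limit cycle. -/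
open Complex Set

lemma lc_follow {w : ℝ → ℂ} (hw : Continuous w) {Z : Set ℂ} (hZ : IsOpen Z) (l p : ℂ)
    (hode : ∀ t, w t ∈ Z → HasDerivAt w (l * (w t - p)) t) (t0 L : ℝ)
    (hst : ∃ ε > 0, ∀ s ∈ Ioo t0 (t0 + ε), w s ∈ Z)
    (hF : ∀ s ∈ Ioo 0 L, p + Complex.exp (l * (s : ℝ)) * (w t0 - p) ∈ Z) :
    ∀ s ∈ Icc 0 L, w (t0 + s) = p + Complex.exp (l * (s : ℝ)) * (w t0 - p) := by
  set G : ℝ → ℂ := fun t => Complex.exp (-(l * ((t - t0 : ℝ) : ℂ))) * (w t - p) with hG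
  have hGc : Continuous G := by
    simp only [hG]; fun_prop
  have hGd : ∀ t, w t ∈ Z → HasDerivAt G 0 t := by
    intro t ht
    have h1 : HasDerivAt (fun t : ℝ => -(l * ((t - t0 : ℝ) : ℂ))) (-(l * ((1 : ℝ) : ℂ))) t :=
      ((((hasDerivAt_id t).sub_const t0).ofReal_comp).const_mul l).neg
    have h2 := h1.cexp.mul ((hode t ht).sub_const p)
    refine h2.congr_deriv ?_
    push_cast
    ring
  have key : ∀ τ, t0 < τ → (∀ s ∈ Ioo t0 τ, w s ∈ Z) → 
      w τ = p + Complex.exp (l * ((τ - t0 : ℝ) : ℂ)) * (w t0 - p) := by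
    intro τ hτ hs
    have h1 : ∀ s ∈ Ioo t0 τ, G s = G τ := by
      intro s hs'
      have : ∀ τ' ∈ Ioo s τ, G τ' = G s := by
        intro τ' hτ'
        refine constant_of_has_deriv_right_zero (a := s) (b := τ') hGc.continuousOn ?_ τ' ⟨hτ'.1.le, le_rfl⟩
        intro x hx
        exact (hGd x (hs x ⟨lt_of_lt_of_le hs'.1 hx.1, hx.2.trans hτ'.2⟩)).hasDerivWithinAt
      have hcl : IsClosed {x | G x = G s} := isClosed_eq hGc continuous_const
      have : Icc s τ ⊆ {x | G x = G s} := by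
        rw [← closure_Ioo hs'.2.ne]
        exact hcl.closure_subset_iff.2 this
      exact (this ⟨hs'.2.le, le_rfl⟩).symm
    have hcl : IsClosed {x | G x = G τ} := isClosed_eq hGc continuous_const
    have h2 : Icc t0 τ ⊆ {x | G x = G τ} := by
      rw [← closure_Ioo hτ.ne]
      exact hcl.closure_subset_iff.2 h1
    have h3 : G t0 = G τ := h2 ⟨le_rfl, hτ.le⟩
    simp only [hG, sub_self, Complex.ofReal_zero, mul_zero, neg_zero, Complex.exp_zero, one_mul] at h3
    rw [h3, ← mul_assoc, ← Complex.exp_add]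
    simp
  have hin : ∀ t ∈ Ioo t0 (t0 + L), w t ∈ Z := by
    intro t ht
    by_contra hbad
    obtain ⟨ε, hε, hst⟩ := hst
    have hge : t0 + ε ≤ t := by
      by_contra h
      exact hbad (hst t ⟨ht.1, not_le.1 h⟩)
    have hB : IsCompact (Icc (t0 + ε / 2) t ∩ w ⁻¹' Zᶜ) :=
      isCompact_Icc.inter_right (hZ.isClosed_compl.preimage hw)
    obtain ⟨m, ⟨hm1, hm2⟩, hm3⟩ := hB.exists_isLeast ⟨t, ⟨⟨by linarith, le_rfl⟩, hbad⟩⟩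
    have hm0 : t0 < m := by linarith [hm1.1]
    have h4 := key m hm0 (by
      intro s hs
      by_contra hc
      have : t0 + ε ≤ s := by
        by_contra h
        exact hc (hst s ⟨hs.1, not_le.1 h⟩)
      have := hm3 ⟨⟨by linarith, hs.2.le.trans hm1.2⟩, hc⟩
      linarith [hs.2])
    apply hm2
    rw [h4]
    exact hF _ ⟨by linarith, by linarith [hm1.2, ht.2]⟩
  intro s hs
  rcases hs.1.eq_or_lt with h | h
  · subst h; simp
  · have := key (t0 + s) (by linarith) (fun x hx => hin x ⟨hx.1, by linarith [hx.2, hs.2]⟩)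
    rw [this]; simp

lemma lc_slope {w : ℝ → ℂ} (hw : Continuous w) (f : ℂ → ℂ) (hf : Continuous f) (t : ℝ)
    {ε : ℝ} (hε : 0 < ε) (hd : ∀ s ∈ Ioo t (t + ε), HasDerivAt w (f (w s)) s)
    (σ : ℝ) (hpos : 0 < σ * (f (w t)).im)
    (hneg : ∀ s ∈ Ioo t (t + ε), σ * ((w s).im - (w t).im) < 0) : False := by
  have hc : Continuous fun s => σ * (f (w s)).im := by fun_prop
  have hev : ∀ᶠ s in nhds t, 0 < σ * (f (w s)).im := hc.continuousAt.eventually (lt_mem_nhds hpos)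
  obtain ⟨δ, hδ, hev⟩ := Metric.eventually_nhds_iff.1 hev
  set s := t + min ε δ / 2 with hs
  have hm : 0 < min ε δ := lt_min hε hδ
  have hm1 : min ε δ ≤ ε := min_le_left _ _
  have hm2 : min ε δ ≤ δ := min_le_right _ _
  have hts : t < s := by linarith
  have hφ : ∀ x ∈ Ioo t (t + ε), HasDerivAt (fun x => σ * (w x).im) (σ * (f (w x)).im) x := by
    intro x hx
    have := (Complex.imCLM.hasFDerivAt.comp_hasDerivAt x (hd x hx))
    exact this.const_mul σ
  obtain ⟨ξ, hξ, he⟩ := exists_hasDerivAt_eq_slope (fun x => σ * (w x).im) (fun x => σ * (f (w x)).im) hts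
    (by fun_prop) (fun x hx => hφ x ⟨hx.1, by linarith [hx.2]⟩)
  have h1 : 0 < σ * (f (w ξ)).im := hev (by
    rw [Real.dist_eq, abs_lt]; constructor <;> linarith [hξ.1, hξ.2])
  rw [he] at h1
  have h2 := hneg s ⟨hts, by linarith⟩
  have h3 : (σ * (w s).im - σ * (w t).im) / (s - t) < 0 :=
    div_neg_of_neg_of_pos (by linarith) (by linarith)
  linarith

structure LCHalf (a b q : ℝ) (w : ℝ → ℂ) : Prop where
  cont : Continuous w
  up : ∀ t, 1 < (w t).im → HasDerivAt w (((a : ℂ) + (b : ℂ) * I) * (w t - (I - (q : ℂ)))) t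
  mid : ∀ t, |(w t).im| < 1 → HasDerivAt w (I * w t) t
  ne : ∀ t, (w t).im = 1 → (w t).re ≠ 0
  pos : ∀ t, (w t).im = 1 → 0 < (w t).re → ∃ ε > 0, ∀ s ∈ Ioo t (t + ε), 1 < (w s).im
  neg : ∀ t, (w t).im = 1 → (w t).re < 0 → ∃ ε > 0, ∀ s ∈ Ioo t (t + ε), |(w s).im| < 1

lemma LCHalf.mk' {a b q : ℝ} {w : ℝ → ℂ} (hc : Continuous w)
    (up : ∀ t, 1 < (w t).im → HasDerivAt w (((a : ℂ) + (b : ℂ) * I) * (w t - (I - (q : ℂ)))) t)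
    (mid : ∀ t, |(w t).im| < 1 → HasDerivAt w (I * w t) t)
    (raw : ∀ t, (w t).im = 1 → (w t).re ≠ 0 ∧ b * ((w t).re + q) ≠ 0 ∧
      (0 < (w t).re ↔ 0 < b * ((w t).re + q)) ∧
      ((∃ ε > 0, ∀ s ∈ Ioo t (t + ε), 1 < (w s).im) ∨
       (∃ ε > 0, ∀ s ∈ Ioo t (t + ε), |(w s).im| < 1))) : LCHalf a b q w := by
  refine ⟨hc, up, mid, fun t ht => (raw t ht).1, ?_, ?_⟩
  · intro t ht hp
    obtain ⟨-, -, -, h | ⟨ε, hε, h⟩⟩ := raw t ht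
    · exact h
    · exfalso
      refine lc_slope hc (fun z => I * z) (by fun_prop) t hε (fun s hs => mid s (h s hs)) 1 ?_ ?_
      · simpa using hp
      · intro s hs
        have := (abs_lt.1 (h s hs)).2
        rw [ht]; linarith
  · intro t ht hp
    obtain ⟨-, h1, h2, ⟨ε, hε, h⟩ | h⟩ := raw t ht
    · exfalso
      have h3 : b * ((w t).re + q) < 0 := by
        rcases lt_or_gt_of_ne h1 with h | h
        · exact h
        · linarith [h2.2 h]
      refine lc_slope hc (fun z => ((a : ℂ) + (b : ℂ) * I) * (z - (I - (q : ℂ)))) (by fun_prop) t hε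
        (fun s hs => up s (h s hs)) (-1) ?_ ?_
      · simp [ht]; linarith
      · intro s hs
        have := h s hs
        rw [ht]; linarith
    · exact h

noncomputable def lcXn (a b q X : ℝ) : ℝ := q + Real.exp (a * (Real.pi / b)) * (X + q)

noncomputable def lcH (a b q X t : ℝ) : ℂ :=
  if t ≤ Real.pi / b then (I - q) + Complex.exp (((a : ℂ) + (b : ℂ) * I) * (t : ℝ)) * ((X : ℂ) + q)
  else -(Complex.exp (I * ((t - Real.pi / b : ℝ) : ℂ)) * ((lcXn a b q X : ℝ) - I))

noncomputable def lcA (a b q X : ℝ) : ℝ := 2 * Real.arctan (1 / lcXn a b q X)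

noncomputable def lcD (a b q X : ℝ) : ℝ := Real.pi / b + lcA a b q X

lemma lcXn_pos {a b q X : ℝ} (hq : 0 < q) (hX : 0 < X) : 0 < lcXn a b q X := by
  unfold lcXn; positivity

lemma lcA_pos {a b q X : ℝ} (hq : 0 < q) (hX : 0 < X) : 0 < lcA a b q X := by
  have := lcXn_pos (a := a) (b := b) hq hX
  have : 0 < Real.arctan (1 / lcXn a b q X) := Real.arctan_pos.2 (by positivity)
  unfold lcA; linarith

lemma lcH_up {a b q X t : ℝ} (ht : t ≤ Real.pi / b) :
    lcH a b q X t = (I - q) + Complex.exp (((a : ℂ) + (b : ℂ) * I) * (t : ℝ)) * ((X : ℂ) + q) := by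
  simp [lcH, ht]

lemma lc_exp_at {a b : ℝ} (hb : 0 < b) :
    Complex.exp (((a : ℂ) + (b : ℂ) * I) * ((Real.pi / b : ℝ) : ℂ)) =
      -((Real.exp (a * (Real.pi / b)) : ℝ) : ℂ) := by
  have : ((a : ℂ) + (b : ℂ) * I) * ((Real.pi / b : ℝ) : ℂ) =
    ((a * (Real.pi / b) : ℝ) : ℂ) + Real.pi * I := by
    have : (b : ℂ) ≠ 0 := by exact_mod_cast hb.ne'
    push_cast; field_simp
  rw [this, Complex.exp_add, Complex.exp_pi_mul_I]
  push_cast; ring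

lemma lcH_mid {a b q X t : ℝ} (hb : 0 < b) (ht : Real.pi / b ≤ t) :
    lcH a b q X t = -(Complex.exp (I * ((t - Real.pi / b : ℝ) : ℂ)) * ((lcXn a b q X : ℝ) - I)) := by
  rcases ht.eq_or_lt with h | h
  · rw [← h, lcH_up le_rfl, lc_exp_at hb]
    simp [lcXn]; ring
  · simp [lcH, not_le.2 h]

lemma lcH_cont {a b q X : ℝ} (hb : 0 < b) : Continuous (lcH a b q X) := by
  refine Continuous.if_le ?_ ?_ continuous_id continuous_const ?_
  · fun_prop
  · fun_prop
  · intro x hx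
    have hx : x = Real.pi / b := hx
    have h1 := lcH_up (a := a) (b := b) (q := q) (X := X) hx.le
    have h2 := lcH_mid (a := a) (b := b) (q := q) (X := X) hb hx.ge
    rw [← h1, ← h2]

lemma lcH_zero {a b q X : ℝ} (hb : 0 < b) : lcH a b q X 0 = X + I := by
  rw [lcH_up (by positivity)]
  simp
  ring

lemma lcH_pi {a b q X : ℝ} (hb : 0 < b) : lcH a b q X (Real.pi / b) = -(lcXn a b q X : ℝ) + I := by
  rw [lcH_mid hb le_rfl]; simp; ring

lemma lc_up_im {a b q X : ℝ} (hb : 0 < b) (hq : 0 < q) (hX : 0 < X) {t : ℝ}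
    (ht : t ∈ Ioo 0 (Real.pi / b)) :
    1 < ((I - q) + Complex.exp (((a : ℂ) + (b : ℂ) * I) * (t : ℝ)) * ((X : ℂ) + q)).im := by
  have h1 : (((a : ℂ) + (b : ℂ) * I) * (t : ℝ)) = ((a * t : ℝ) : ℂ) + ((b * t : ℝ) : ℂ) * I := by
    push_cast; ring
  rw [h1, Complex.exp_add, ← Complex.ofReal_exp, Complex.exp_mul_I, ← Complex.ofReal_cos,
    ← Complex.ofReal_sin]
  have h2 : 0 < Real.sin (b * t) := Real.sin_pos_of_pos_of_lt_pi (mul_pos hb ht.1) (by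
    have := ht.2
    rw [lt_div_iff₀ hb] at this; linarith)
  have h3 : 0 < Real.exp (a * t) * Real.sin (b * t) * (X + q) := by positivity
  simp [-Complex.ofReal_exp, -Complex.ofReal_cos, -Complex.ofReal_sin]
  linarith

lemma lc_R (Y : ℝ) (hY : 0 < Y) : ∃ R : ℝ, 0 < R ∧ R * Real.cos (Real.arctan (1 / Y)) = Y ∧
    R * Real.sin (Real.arctan (1 / Y)) = 1 := by
  have hc : 0 < Real.cos (Real.arctan (1 / Y)) := Real.cos_arctan_pos _
  refine ⟨Y / Real.cos (Real.arctan (1 / Y)), by positivity, by field_simp, ?_⟩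
  have := Real.tan_arctan (1 / Y)
  rw [Real.tan_eq_sin_div_cos] at this
  rw [div_mul_eq_mul_div, mul_div_assoc, this]; field_simp

lemma lc_rot (Y t : ℝ) : Complex.exp (I * (t : ℂ)) * ((Y : ℂ) - I) =
    ((Y * Real.cos t + Real.sin t : ℝ) : ℂ) + ((Y * Real.sin t - Real.cos t : ℝ) : ℂ) * I := by
  rw [mul_comm I, Complex.exp_mul_I, ← Complex.ofReal_cos, ← Complex.ofReal_sin]
  apply Complex.ext <;> simp [-Complex.ofReal_cos, -Complex.ofReal_sin] <;> ring

lemma lc_mid_im (Y : ℝ) (hY : 0 < Y) {t : ℝ} (ht : t ∈ Ioo 0 (2 * Real.arctan (1 / Y))) :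
    |(-(Complex.exp (I * (t : ℂ)) * ((Y : ℂ) - I))).im| < 1 := by
  obtain ⟨R, hR, hcos, hsin⟩ := lc_R Y hY
  set α := Real.arctan (1 / Y)
  have hα : α < Real.pi / 2 := Real.arctan_lt_pi_div_two _
  rw [lc_rot]
  have h1 : Y * Real.sin t - Real.cos t = R * Real.sin (t - α) := by
    rw [Real.sin_sub]; linear_combination (-Real.sin t) * hcos + Real.cos t * hsin
  have h2 : Real.sin (t - α) < Real.sin α :=
    Real.sin_lt_sin_of_lt_of_le_pi_div_two (by linarith [ht.1]) (by linarith) (by linarith [ht.2])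
  have h3 : Real.sin (-α) < Real.sin (t - α) :=
    Real.sin_lt_sin_of_lt_of_le_pi_div_two (by linarith [ht.1]) (by linarith [ht.2]) (by linarith [ht.1])
  rw [Real.sin_neg] at h3
  have : (-(((Y * Real.cos t + Real.sin t : ℝ) : ℂ) + ((Y * Real.sin t - Real.cos t : ℝ) : ℂ) * I)).im
      = -(R * Real.sin (t - α)) := by
    rw [← h1]; simp [-Complex.ofReal_cos, -Complex.ofReal_sin]
  rw [this, abs_neg, abs_lt]
  constructor <;> nlinarith

lemma lc_mid_end (Y : ℝ) (hY : 0 < Y) :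
    Complex.exp (I * ((2 * Real.arctan (1 / Y) : ℝ) : ℂ)) * ((Y : ℂ) - I) = Y + I := by
  obtain ⟨R, hR, hcos, hsin⟩ := lc_R Y hY
  set α := Real.arctan (1 / Y)
  rw [lc_rot, Real.sin_two_mul, Real.cos_two_mul]
  have h4 := Real.sin_sq_add_cos_sq α
  have h1 : Y * (2 * Real.cos α ^ 2 - 1) + 2 * Real.sin α * Real.cos α = Y := by
    rw [← hcos]
    linear_combination (2 * Real.cos α * R) * h4 - 2 * Real.cos α * Real.sin α * hsin
  have h2 : Y * (2 * Real.sin α * Real.cos α) - (2 * Real.cos α ^ 2 - 1) = 1 := by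
    rw [← hcos]
    linear_combination (2 * Real.cos α ^ 2) * hsin
  rw [h1, h2]; simp

lemma lcH_end {a b q X : ℝ} (hb : 0 < b) (hq : 0 < q) (hX : 0 < X) :
    lcH a b q X (lcD a b q X) = -((lcXn a b q X : ℝ) + I) := by
  have := lcA_pos (a := a) (b := b) hq hX
  rw [lcH_mid hb (by unfold lcD; linarith)]
  have h : lcD a b q X - Real.pi / b = 2 * Real.arctan (1 / lcXn a b q X) := by
    unfold lcD lcA; ring
  rw [h, lc_mid_end _ (lcXn_pos hq hX)]

lemma lcH_im_up {a b q X : ℝ} (hb : 0 < b) (hq : 0 < q) (hX : 0 < X) {t : ℝ}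
    (ht : t ∈ Ioo 0 (Real.pi / b)) : 1 < (lcH a b q X t).im := by
  rw [lcH_up ht.2.le]; exact lc_up_im hb hq hX ht

lemma lcH_im_mid {a b q X : ℝ} (hb : 0 < b) (hq : 0 < q) (hX : 0 < X) {t : ℝ}
    (ht : t ∈ Ioo (Real.pi / b) (lcD a b q X)) : |(lcH a b q X t).im| < 1 := by
  rw [lcH_mid hb ht.1.le]
  apply lc_mid_im _ (lcXn_pos hq hX)
  have h2 := ht.2
  unfold lcD lcA at h2
  exact ⟨by linarith [ht.1], by linarith⟩

lemma lcH_norm {a b q X : ℝ} (hb : 0 < b) (hq : 0 < q) (hX : 0 < X) {t : ℝ}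
    (ht : 0 ≤ t) : 1 < ‖lcH a b q X t‖ := by
  have key : ∀ Y : ℝ, 0 < Y → 1 < ‖(Y : ℂ) - I‖ ∧ 1 < ‖(Y : ℂ) + I‖ := by
    intro Y hY
    constructor <;>
    · rw [← one_lt_sq_iff₀ (norm_nonneg _), Complex.sq_norm, Complex.normSq_apply]
      simp; nlinarith
  rcases le_or_gt (Real.pi / b) t with h | h
  · rw [lcH_mid hb h, norm_neg, norm_mul, mul_comm I, Complex.norm_exp_ofReal_mul_I, one_mul]
    exact (key _ (lcXn_pos hq hX)).1
  · rcases ht.eq_or_lt with h0 | h0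
    · rw [← h0, lcH_zero hb]; exact (key _ hX).2
    · have h1 := lcH_im_up (a := a) hb hq hX ⟨h0, h⟩
      exact lt_of_lt_of_le h1 ((le_abs_self _).trans (Complex.abs_im_le_norm _))

lemma LCHalf.center {a b q : ℝ} {w : ℝ → ℂ} (h : LCHalf a b q w) {t0 Y : ℝ} (hY : 0 < Y)
    (h0 : w t0 = -(Y : ℂ) + I) : ∀ s ∈ Icc 0 (2 * Real.arctan (1 / Y)),
      w (t0 + s) = -(Complex.exp (I * (s : ℂ)) * ((Y : ℂ) - I)) := by
  have hF := lc_follow h.cont (Z := {z | |z.im| < 1})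
    (isOpen_lt (by fun_prop) continuous_const) I 0
    (fun t ht => by simpa using h.mid t ht) t0 (2 * Real.arctan (1 / Y))
    (h.neg t0 (by simp [h0]) (by simp [h0, hY]))
    (by
      intro s hs
      have := lc_mid_im Y hY hs
      rw [h0, mem_ofPred_eq]
      convert this using 3
      ring)
  intro s hs
  rw [hF s hs, h0]; ring

lemma LCHalf.arc {a b q : ℝ} {w : ℝ → ℂ} (h : LCHalf a b q w) (hb : 0 < b) (hq : 0 < q) {t0 X : ℝ}
    (hX : 0 < X) (h0 : w t0 = (X : ℂ) + I) :
    ∀ s ∈ Icc 0 (lcD a b q X), w (t0 + s) = lcH a b q X s := by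
  have hF := lc_follow h.cont (Z := {z | 1 < z.im})
    (isOpen_lt continuous_const (by fun_prop)) ((a : ℂ) + (b : ℂ) * I) (I - q)
    (fun t ht => h.up t ht) t0 (Real.pi / b)
    (h.pos t0 (by simp [h0]) (by simp [h0, hX]))
    (by
      intro s hs
      have := lc_up_im (a := a) hb hq hX hs
      rw [h0, mem_ofPred_eq]
      convert this using 3
      ring)
  have hF' : ∀ s ∈ Icc 0 (Real.pi / b), w (t0 + s) = lcH a b q X s := by
    intro s hs
    rw [hF s hs, h0, lcH_up hs.2]; ring
  have h1 := hF' (Real.pi / b) ⟨by positivity, le_rfl⟩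
  rw [lcH_pi hb] at h1
  have h2 := h.center (lcXn_pos hq hX) h1
  intro s hs
  rcases le_or_gt s (Real.pi / b) with h3 | h3
  · exact hF' s ⟨hs.1, h3⟩
  · have := h2 (s - Real.pi / b) ⟨by linarith, by
      have := hs.2
      unfold lcD lcA at this; linarith⟩
    rw [lcH_mid hb h3.le, ← this]; congr 1; ring

noncomputable abbrev lcF (a b c d x0 x1 : ℝ) : Fin 3 → ℂ → ℂ :=
      ![fun w => ((a : ℂ) + (b : ℂ) * Complex.I) * (w - Complex.I + (x1 : ℂ)),
        fun w => Complex.I * w,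
        fun w => ((c : ℂ) + (d : ℂ) * Complex.I) * (w + Complex.I - (x0 : ℂ))]

lemma lc_fderiv_sub (z v : ℂ) : fderiv ℝ (fun z : ℂ => z.im - 1) z v = v.im := by
  have : HasFDerivAt (fun z : ℂ => z.im - 1) Complex.imCLM z :=
    (Complex.imCLM.hasFDerivAt).sub_const 1
  rw [this.fderiv]; rfl

lemma lc_fderiv_add (z v : ℂ) : fderiv ℝ (fun z : ℂ => z.im + 1) z v = v.im := by
  have : HasFDerivAt (fun z : ℂ => z.im + 1) Complex.imCLM z :=
    (Complex.imCLM.hasFDerivAt).add_const 1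
  rw [this.fderiv]; rfl

lemma lc_closure_right {w : ℝ → ℂ} (hw : Continuous w) {C : Set ℂ} (hC : IsClosed C) {t ε : ℝ}
    (hε : 0 < ε) (h : ∀ s ∈ Ioo t (t + ε), w s ∈ C) : w t ∈ C := by
  have h2 : Icc t (t + ε) ⊆ w ⁻¹' C := by
    rw [← closure_Ioo (by linarith : t ≠ t + ε).symm.symm]
    exact (hC.preimage hw).closure_subset_iff.2 h
  exact h2 ⟨le_rfl, by linarith⟩

lemma lc_closure_left {w : ℝ → ℂ} (hw : Continuous w) {C : Set ℂ} (hC : IsClosed C) {t ε : ℝ}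
    (hε : 0 < ε) (h : ∀ s ∈ Ioo (t - ε) t, w s ∈ C) : w t ∈ C := by
  have h2 : Icc (t - ε) t ⊆ w ⁻¹' C := by
    rw [← closure_Ioo (by linarith : t - ε < t).ne]
    exact (hC.preimage hw).closure_subset_iff.2 h
  exact h2 ⟨by linarith, le_rfl⟩

def lcK : Fin 3 → Set ℂ :=
  ![{z : ℂ | 1 ≤ z.im}, {z : ℂ | |z.im| ≤ 1}, {z : ℂ | z.im ≤ -1}]

lemma lcK_closed (σ : Fin 3) : IsClosed (lcK σ) := by
  fin_cases σ
  · exact isClosed_le continuous_const (by fun_prop)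
  · exact isClosed_le (by fun_prop) continuous_const
  · exact isClosed_le (by fun_prop) continuous_const

lemma lcK_sub (σ : Fin 3) : zonesLines σ ⊆ lcK σ := by
  fin_cases σ <;> intro z hz
  · exact le_of_lt (show 1 < z.im from hz)
  · exact le_of_lt (show |z.im| < 1 from hz)
  · exact le_of_lt (show z.im < -1 from hz)

lemma lc_half_top {a b c d x0 x1 : ℝ} {w : ℝ → ℂ}
    (h : IsCrossingPeriodicOrbit zonesLines (lcF a b c d x0 x1) curvesLines w) :
    LCHalf a b x1 w := by
  obtain ⟨T, hT, hc, -, -, hode, -, hcr⟩ := h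
  refine LCHalf.mk' hc ?_ ?_ ?_
  · intro t ht
    refine (hode t 0 ht).congr_deriv ?_
    simp; ring_nf; simp
  · intro t ht
    exact hode t 1 ht
  · intro t ht
    obtain ⟨σ₁, σ₂, hne, ⟨ε, hε, hl, hr⟩, hg⟩ := hcr t ⟨fun z => z.im - 1, by simp [curvesLines], by simp [ht]⟩
    have hg := hg (fun z => z.im - 1) (by simp [curvesLines]) (by simp [ht])
    simp only [lc_fderiv_sub] at hg
    have k1 := lc_closure_left hc (lcK_closed σ₁) hε (fun s hs => lcK_sub _ (hl s hs))
    have k2 := lc_closure_right hc (lcK_closed σ₂) hε (fun s hs => lcK_sub _ (hr s hs))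
    have n2 : w t ∉ lcK 2 := by
      intro h
      have : (w t).im ≤ -1 := h
      linarith
    have e0 : (lcF a b c d x0 x1 0 (w t)).im = b * ((w t).re + x1) := by simp [lcF, ht]
    have e1 : (lcF a b c d x0 x1 1 (w t)).im = (w t).re := by simp [lcF]
    fin_cases σ₁ <;> fin_cases σ₂ <;> first | exact absurd rfl hne | exact absurd k1 n2 | exact absurd k2 n2 | skip
    · have hg : (lcF a b c d x0 x1 0 (w t)).im ≠ 0 ∧ (lcF a b c d x0 x1 1 (w t)).im ≠ 0 ∧ (0 < (lcF a b c d x0 x1 0 (w t)).im ↔ 0 < (lcF a b c d x0 x1 1 (w t)).im) := hg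
      rw [e0, e1] at hg
      exact ⟨hg.2.1, hg.1, hg.2.2.symm, Or.inr ⟨ε, hε, hr⟩⟩
    · have hg : (lcF a b c d x0 x1 1 (w t)).im ≠ 0 ∧ (lcF a b c d x0 x1 0 (w t)).im ≠ 0 ∧ (0 < (lcF a b c d x0 x1 1 (w t)).im ↔ 0 < (lcF a b c d x0 x1 0 (w t)).im) := hg
      rw [e0, e1] at hg
      exact ⟨hg.1, hg.2.1, hg.2.2, Or.inl ⟨ε, hε, hr⟩⟩

lemma lc_sign {u v : ℝ} (hu : u ≠ 0) (hv : v ≠ 0) (h : 0 < u ↔ 0 < v) : 0 < -u ↔ 0 < -v := by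
  constructor
  · intro h1
    have : ¬ 0 < v := fun h2 => by linarith [h.2 h2]
    have := lt_of_le_of_ne (not_lt.1 this) hv
    linarith
  · intro h1
    have : ¬ 0 < u := fun h2 => by linarith [h.1 h2]
    have := lt_of_le_of_ne (not_lt.1 this) hu
    linarith

lemma lc_half_bot {a b c d x0 x1 : ℝ} {w : ℝ → ℂ}
    (h : IsCrossingPeriodicOrbit zonesLines (lcF a b c d x0 x1) curvesLines w) :
    LCHalf c d x0 (fun t => - w t) := by
  obtain ⟨T, hT, hc, -, -, hode, -, hcr⟩ := h
  refine LCHalf.mk' (by fun_prop) ?_ ?_ ?_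
  · intro t ht
    have ht : 1 < (- w t).im := ht
    rw [Complex.neg_im] at ht
    refine (hode t 2 (by show (w t).im < -1; linarith)).neg.congr_deriv ?_
    simp; ring
  · intro t ht
    rw [Complex.neg_im, abs_neg] at ht
    exact (hode t 1 ht).neg.congr_deriv (by simp)
  · intro t ht
    rw [Complex.neg_im] at ht
    have ht : (w t).im = -1 := by linarith
    obtain ⟨σ₁, σ₂, hne, ⟨ε, hε, hl, hr⟩, hg⟩ := hcr t ⟨fun z => z.im + 1, by simp [curvesLines], by simp [ht]⟩
    have hg := hg (fun z => z.im + 1) (by simp [curvesLines]) (by simp [ht])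
    simp only [lc_fderiv_add] at hg
    have k1 := lc_closure_left hc (lcK_closed σ₁) hε (fun s hs => lcK_sub _ (hl s hs))
    have k2 := lc_closure_right hc (lcK_closed σ₂) hε (fun s hs => lcK_sub _ (hr s hs))
    have n2 : w t ∉ lcK 0 := by
      intro h
      have : 1 ≤ (w t).im := h
      linarith
    have e0 : (lcF a b c d x0 x1 2 (w t)).im = -(d * ((-w t).re + x0)) := by simp [lcF, ht]; ring
    have e1 : (lcF a b c d x0 x1 1 (w t)).im = -(-w t).re := by simp [lcF]
    fin_cases σ₁ <;> fin_cases σ₂ <;> first | exact absurd rfl hne | exact absurd k1 n2 | exact absurd k2 n2 | skip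
    · have hg : (lcF a b c d x0 x1 1 (w t)).im ≠ 0 ∧ (lcF a b c d x0 x1 2 (w t)).im ≠ 0 ∧ (0 < (lcF a b c d x0 x1 1 (w t)).im ↔ 0 < (lcF a b c d x0 x1 2 (w t)).im) := hg
      rw [e0, e1] at hg
      have := lc_sign hg.1 hg.2.1 hg.2.2
      rw [neg_neg, neg_neg] at this
      refine ⟨neg_ne_zero.1 hg.1, neg_ne_zero.1 hg.2.1, this, Or.inl ⟨ε, hε, ?_⟩⟩
      intro s hs
      have : (w s).im < -1 := hr s hs
      rw [Complex.neg_im]; linarith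
    · have hg : (lcF a b c d x0 x1 2 (w t)).im ≠ 0 ∧ (lcF a b c d x0 x1 1 (w t)).im ≠ 0 ∧ (0 < (lcF a b c d x0 x1 2 (w t)).im ↔ 0 < (lcF a b c d x0 x1 1 (w t)).im) := hg
      rw [e0, e1] at hg
      have := lc_sign hg.1 hg.2.1 hg.2.2
      rw [neg_neg, neg_neg] at this
      refine ⟨neg_ne_zero.1 hg.2.1, neg_ne_zero.1 hg.1, this.symm, Or.inr ⟨ε, hε, ?_⟩⟩
      intro s hs
      have : |(w s).im| < 1 := hr s hs
      rwa [Complex.neg_im, abs_neg]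

/-- information on an arc of the explicit curve -/
structure LCInfo (a b q X : ℝ) (z : ℝ → ℂ) (t0 : ℝ) : Prop where
  up : ∀ s ∈ Ioo 0 (Real.pi / b), 1 < (z (t0 + s)).im ∧
    HasDerivAt z (((a : ℂ) + (b : ℂ) * I) * (z (t0 + s) - (I - (q : ℂ)))) (t0 + s)
  mid : ∀ s ∈ Ioo (Real.pi / b) (lcD a b q X), |(z (t0 + s)).im| < 1 ∧
    HasDerivAt z (I * z (t0 + s)) (t0 + s)
  start : z t0 = X + I
  turn : z (t0 + Real.pi / b) = -(lcXn a b q X : ℝ) + I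
  fin : z (t0 + lcD a b q X) = -((lcXn a b q X : ℝ) + I)

lemma lc_info {a b q X : ℝ} (hb : 0 < b) (hq : 0 < q) (hX : 0 < X) {z : ℝ → ℂ} {t0 : ℝ}
    (hz : ∀ s ∈ Icc 0 (lcD a b q X), z (t0 + s) = lcH a b q X s) : LCInfo a b q X z t0 := by
  have hA := lcA_pos (a := a) (b := b) hq hX
  have hp : 0 < Real.pi / b := by positivity
  have hD : lcD a b q X = Real.pi / b + lcA a b q X := rfl
  refine ⟨?_, ?_, ?_, ?_, ?_⟩
  · intro s hs
    have e := hz s ⟨hs.1.le, by linarith [hs.2]⟩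
    refine ⟨by rw [e]; exact lcH_im_up hb hq hX hs, ?_⟩
    have h1 : HasDerivAt (fun t : ℝ => ((a : ℂ) + (b : ℂ) * I) * ((t - t0 : ℝ) : ℂ))
        (((a : ℂ) + (b : ℂ) * I) * ((1 : ℝ) : ℂ)) (t0 + s) :=
      ((((hasDerivAt_id (t0 + s)).sub_const t0).ofReal_comp).const_mul _)
    have h2 := (h1.cexp.mul_const ((X : ℂ) + q)).const_add (I - (q : ℂ))
    have h3 : z =ᶠ[nhds (t0 + s)] fun t : ℝ => (I - (q : ℂ)) +
        Complex.exp (((a : ℂ) + (b : ℂ) * I) * ((t - t0 : ℝ) : ℂ)) * ((X : ℂ) + q) := by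
      have : Ioo t0 (t0 + Real.pi / b) ∈ nhds (t0 + s) :=
        Ioo_mem_nhds (by linarith [hs.1]) (by linarith [hs.2])
      filter_upwards [this] with t ht
      have := hz (t - t0) ⟨by linarith [ht.1], by linarith [ht.2]⟩
      rw [lcH_up (by linarith [ht.2])] at this
      rw [← this]; congr 1; ring
    refine (h2.congr_of_eventuallyEq h3).congr_deriv ?_
    rw [e, lcH_up hs.2.le]
    simp only [add_sub_cancel_left]
    push_cast; ring
  · intro s hs
    have e := hz s ⟨by linarith [hs.1], hs.2.le⟩
    refine ⟨by rw [e]; exact lcH_im_mid hb hq hX hs, ?_⟩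
    have h1 : HasDerivAt (fun t : ℝ => I * ((t - t0 - Real.pi / b : ℝ) : ℂ))
        (I * ((1 : ℝ) : ℂ)) (t0 + s) :=
      (((((hasDerivAt_id (t0 + s)).sub_const t0).sub_const (Real.pi / b)).ofReal_comp).const_mul _)
    have h2 := (h1.cexp.mul_const ((lcXn a b q X : ℝ) - I)).neg
    have h3 : z =ᶠ[nhds (t0 + s)] -fun t : ℝ => 
        Complex.exp (I * ((t - t0 - Real.pi / b : ℝ) : ℂ)) * ((lcXn a b q X : ℝ) - I) := by
      have : Ioo (t0 + Real.pi / b) (t0 + lcD a b q X) ∈ nhds (t0 + s) :=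
        Ioo_mem_nhds (by linarith [hs.1]) (by linarith [hs.2])
      filter_upwards [this] with t ht
      have := hz (t - t0) ⟨by linarith [ht.1], by linarith [ht.2]⟩
      rw [lcH_mid hb (by linarith [ht.1])] at this
      rw [Pi.neg_apply, ← this]; congr 1; ring
    refine (h2.congr_of_eventuallyEq h3).congr_deriv ?_
    rw [e, lcH_mid hb hs.1.le]
    simp only [add_sub_cancel_left]
    push_cast; ring
  · have := hz 0 ⟨le_rfl, by linarith⟩
    rwa [add_zero, lcH_zero hb] at this
  · rw [hz _ ⟨hp.le, by linarith⟩, lcH_pi hb]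
  · rw [hz _ ⟨by linarith, le_rfl⟩, lcH_end hb hq hX]

/-- local classification of a point on the curve -/
def LCGood (a b q : ℝ) (z : ℝ → ℂ) (t : ℝ) : Prop :=
  (1 < (z t).im ∧ HasDerivAt z (((a : ℂ) + (b : ℂ) * I) * (z t - (I - (q : ℂ)))) t) ∨
  (|(z t).im| < 1 ∧ HasDerivAt z (I * z t) t) ∨
  ((z t).im = 1 ∧ 0 < (z t).re ∧ ∃ ε > 0, (∀ s ∈ Ioo (t - ε) t, |(z s).im| < 1) ∧
    (∀ s ∈ Ioo t (t + ε), 1 < (z s).im)) ∨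
  ((z t).im = 1 ∧ (z t).re < -q ∧ ∃ ε > 0, (∀ s ∈ Ioo (t - ε) t, 1 < (z s).im) ∧
    (∀ s ∈ Ioo t (t + ε), |(z s).im| < 1))

lemma lc_good {a b q X a' b' q' X' : ℝ} (hb : 0 < b) (hq : 0 < q) (hX : 0 < X)
    (hb' : 0 < b') (hq' : 0 < q') (hX' : 0 < X') {z : ℝ → ℂ} {t0 : ℝ}
    (h : LCInfo a b q X z t0)
    (h' : LCInfo a' b' q' X' (fun t => - z t) (t0 - lcD a' b' q' X'))
    {s : ℝ} (hs : s ∈ Ico 0 (lcD a b q X)) : LCGood a b q z (t0 + s) := by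
  have hA := lcA_pos (a := a) (b := b) hq hX
  have hp : 0 < Real.pi / b := by positivity
  have hD : lcD a b q X = Real.pi / b + lcA a b q X := rfl
  have hA' := lcA_pos (a := a') (b := b') hq' hX'
  have hp' : 0 < Real.pi / b' := by positivity
  have hD' : lcD a' b' q' X' = Real.pi / b' + lcA a' b' q' X' := rfl
  rcases hs.1.eq_or_lt with h0 | h0
  · right; right; left
    rw [← h0, add_zero, h.start]
    refine ⟨by simp, by simpa using hX, min (Real.pi / b) (lcA a' b' q' X'), lt_min hp hA', ?_, ?_⟩
    · intro x hx
      have hm : min (Real.pi / b) (lcA a' b' q' X') ≤ lcA a' b' q' X' := min_le_right _ _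
      have := (h'.mid (x - (t0 - lcD a' b' q' X')) ⟨by linarith [hx.1], by linarith [hx.2]⟩).1
      rw [Complex.neg_im, abs_neg] at this
      convert this using 4; ring
    · intro x hx
      have hm : min (Real.pi / b) (lcA a' b' q' X') ≤ Real.pi / b := min_le_left _ _
      have := (h.up (x - t0) ⟨by linarith [hx.1], by linarith [hx.2]⟩).1
      convert this using 3; ring
  · rcases lt_trichotomy s (Real.pi / b) with h1 | h1 | h1
    · left; exact h.up s ⟨h0, h1⟩
    · right; right; right
      rw [h1, h.turn]
      refine ⟨by simp, ?_, min (Real.pi / b) (lcA a b q X), lt_min hp hA, ?_, ?_⟩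
      · have : 0 < Real.exp (a * (Real.pi / b)) * (X + q) := by positivity
        simp only [Complex.add_re, Complex.neg_re, Complex.ofReal_re, Complex.I_re, lcXn]
        linarith
      · intro x hx
        have hm : min (Real.pi / b) (lcA a b q X) ≤ Real.pi / b := min_le_left _ _
        have := (h.up (x - t0) ⟨by linarith [hx.1], by linarith [hx.2]⟩).1
        convert this using 3; ring
      · intro x hx
        have hm : min (Real.pi / b) (lcA a b q X) ≤ lcA a b q X := min_le_right _ _
        have := (h.mid (x - t0) ⟨by linarith [hx.1], by linarith [hx.2]⟩).1
        convert this using 4; ring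
    · right; left; exact h.mid s ⟨h1, hs.2⟩

lemma lc_orbit {a b c d x0 x1 : ℝ} (hb : 0 < b) (hd : 0 < d) (hx0 : 0 < x0) (hx1 : 0 < x1)
    {z : ℝ → ℂ} {L : ℝ} (hL : 0 < L) (hc : Continuous z) (hper : Function.Periodic z L)
    (hnc : ∃ s t : ℝ, z s ≠ z t)
    (hgood : ∀ t, LCGood a b x1 z t ∨ LCGood c d x0 (fun t => - z t) t)
    (hfin : {t ∈ Set.Ico (0:ℝ) L | (z t).im = 1 ∨ (z t).im = -1}.Finite) :
    IsCrossingPeriodicOrbit zonesLines (lcF a b c d x0 x1) curvesLines z := by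
  have hcur : ∀ t, (∃ g ∈ curvesLines, g (z t) = 0) → (z t).im = 1 ∨ (z t).im = -1 := by
    rintro t ⟨g, hg, h0⟩
    rcases hg with rfl | rfl
    · left; have h0 : (z t).im - 1 = 0 := h0
      linarith
    · right; have h0 : (z t).im + 1 = 0 := h0
      linarith
  refine ⟨L, hL, hc, hper, hnc, ?_, hfin.subset (fun t ht => ⟨ht.1, hcur t ht.2⟩), ?_⟩
  · -- the differential equation
    have up : ∀ t, 1 < (z t).im →
        HasDerivAt z (((a : ℂ) + (b : ℂ) * I) * (z t - (I - (x1 : ℂ)))) t := by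
      intro t ht
      rcases hgood t with (h | h | h | h) | (h | h | h | h)
      · exact h.2
      · linarith [(abs_lt.1 h.1).2]
      · linarith [h.1]
      · linarith [h.1]
      · have := h.1
        rw [Complex.neg_im] at this; linarith
      · have := h.1
        rw [Complex.neg_im] at this; linarith [(abs_lt.1 this).1]
      · have := h.1
        rw [Complex.neg_im] at this; linarith
      · have := h.1
        rw [Complex.neg_im] at this; linarith
    have down : ∀ t, (z t).im < -1 →
        HasDerivAt (fun t => - z t) (((c : ℂ) + (d : ℂ) * I) * (-z t - (I - (x0 : ℂ)))) t := by
      intro t ht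
      rcases hgood t with (h | h | h | h) | (h | h | h | h)
      · linarith [h.1]
      · linarith [(abs_lt.1 h.1).1]
      · linarith [h.1]
      · linarith [h.1]
      · exact h.2
      · have := h.1
        rw [Complex.neg_im] at this; linarith [(abs_lt.1 this).2]
      · have := h.1
        rw [Complex.neg_im] at this; linarith
      · have := h.1
        rw [Complex.neg_im] at this; linarith
    have mid : ∀ t, |(z t).im| < 1 → HasDerivAt z (I * z t) t := by
      intro t ht
      rw [abs_lt] at ht
      rcases hgood t with (h | h | h | h) | (h | h | h | h)
      · linarith [h.1]
      · exact h.2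
      · linarith [h.1]
      · linarith [h.1]
      · have := h.1
        rw [Complex.neg_im] at this; linarith
      · have := h.2.neg
        have e : (-fun t => - z t) = z := by ext; simp
        rw [e] at this
        exact this.congr_deriv (by simp)
      · have := h.1
        rw [Complex.neg_im] at this; linarith
      · have := h.1
        rw [Complex.neg_im] at this; linarith
    intro t σ hσ
    fin_cases σ
    · refine (up t hσ).congr_deriv ?_
      simp; ring_nf; simp
    · exact mid t hσ
    · have := (down t hσ).neg
      have e : (-fun t => - z t) = z := by ext; simp
      rw [e] at this
      refine this.congr_deriv ?_
      simp; ring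
  · intro t ht
    have e0 : (z t).im = 1 → (lcF a b c d x0 x1 0 (z t)).im = b * ((z t).re + x1) := by
      intro h; simp [lcF, h]
    have e1 : (lcF a b c d x0 x1 1 (z t)).im = (z t).re := by simp [lcF]
    have e2 : (z t).im = -1 → (lcF a b c d x0 x1 2 (z t)).im = d * ((z t).re - x0) := by
      intro h; simp [lcF, h]
    have cur1 : (z t).im = 1 → ∀ σ₁ σ₂ : Fin 3,
        ((lcF a b c d x0 x1 σ₁ (z t)).im ≠ 0 ∧ (lcF a b c d x0 x1 σ₂ (z t)).im ≠ 0 ∧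
        (0 < (lcF a b c d x0 x1 σ₁ (z t)).im ↔ 0 < (lcF a b c d x0 x1 σ₂ (z t)).im)) →
        (∀ g ∈ curvesLines, g (z t) = 0 →
          fderiv ℝ g (z t) (lcF a b c d x0 x1 σ₁ (z t)) ≠ 0 ∧
          fderiv ℝ g (z t) (lcF a b c d x0 x1 σ₂ (z t)) ≠ 0 ∧
          (0 < fderiv ℝ g (z t) (lcF a b c d x0 x1 σ₁ (z t)) ↔
           0 < fderiv ℝ g (z t) (lcF a b c d x0 x1 σ₂ (z t)))) := by
      intro h1 σ₁ σ₂ h g hg h0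
      rcases hg with rfl | rfl
      · simpa only [lc_fderiv_sub] using h
      · simpa only [lc_fderiv_add] using h
    have cur2 : (z t).im = -1 → ∀ σ₁ σ₂ : Fin 3,
        ((lcF a b c d x0 x1 σ₁ (z t)).im ≠ 0 ∧ (lcF a b c d x0 x1 σ₂ (z t)).im ≠ 0 ∧
        (0 < (lcF a b c d x0 x1 σ₁ (z t)).im ↔ 0 < (lcF a b c d x0 x1 σ₂ (z t)).im)) →
        (∀ g ∈ curvesLines, g (z t) = 0 →
          fderiv ℝ g (z t) (lcF a b c d x0 x1 σ₁ (z t)) ≠ 0 ∧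
          fderiv ℝ g (z t) (lcF a b c d x0 x1 σ₂ (z t)) ≠ 0 ∧
          (0 < fderiv ℝ g (z t) (lcF a b c d x0 x1 σ₁ (z t)) ↔
           0 < fderiv ℝ g (z t) (lcF a b c d x0 x1 σ₂ (z t)))) := by
      intro h1 σ₁ σ₂ h g hg h0
      rcases hg with rfl | rfl
      · simpa only [lc_fderiv_sub] using h
      · simpa only [lc_fderiv_add] using h
    have pp : ∀ u v : ℝ, 0 < u → 0 < v → (u ≠ 0 ∧ v ≠ 0 ∧ (0 < u ↔ 0 < v)) :=
      fun u v hu hv => ⟨hu.ne', hv.ne', iff_of_true hu hv⟩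
    have nn : ∀ u v : ℝ, u < 0 → v < 0 → (u ≠ 0 ∧ v ≠ 0 ∧ (0 < u ↔ 0 < v)) :=
      fun u v hu hv => ⟨hu.ne, hv.ne, iff_of_false hu.not_gt hv.not_gt⟩
    have ht := hcur t ht
    rcases hgood t with (h | h | h | h) | (h | h | h | h)
    · exfalso; rcases ht with ht | ht <;> linarith [h.1]
    · exfalso; have := abs_lt.1 h.1
      rcases ht with ht | ht <;> linarith [this.1, this.2]
    · obtain ⟨h1, h2, ε, hε, hl, hr⟩ := h
      refine ⟨1, 0, by decide, ⟨ε, hε, hl, hr⟩, cur1 h1 _ _ ?_⟩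
      rw [e0 h1, e1]
      exact pp _ _ h2 (by positivity)
    · obtain ⟨h1, h2, ε, hε, hl, hr⟩ := h
      refine ⟨0, 1, by decide, ⟨ε, hε, hl, hr⟩, cur1 h1 _ _ ?_⟩
      rw [e0 h1, e1]
      exact nn _ _ (mul_neg_of_pos_of_neg hb (by linarith)) (by linarith)
    · exfalso; have := h.1
      rw [Complex.neg_im] at this
      rcases ht with ht | ht <;> linarith
    · exfalso; have := h.1
      rw [Complex.neg_im, abs_neg] at this
      have := abs_lt.1 this
      rcases ht with ht | ht <;> linarith [this.1, this.2]
    · obtain ⟨h1, h2, ε, hε, hl, hr⟩ := h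
      rw [Complex.neg_im] at h1
      rw [Complex.neg_re] at h2
      have h1 : (z t).im = -1 := by linarith
      refine ⟨1, 2, by decide, ⟨ε, hε, ?_, ?_⟩, cur2 h1 _ _ ?_⟩
      · intro s hs
        have := hl s hs
        rw [Complex.neg_im, abs_neg] at this
        exact this
      · intro s hs
        have := hr s hs
        rw [Complex.neg_im] at this
        show (z s).im < -1
        linarith
      · rw [e2 h1, e1]
        exact nn _ _ (by linarith) (mul_neg_of_pos_of_neg hd (by linarith))
    · obtain ⟨h1, h2, ε, hε, hl, hr⟩ := h
      rw [Complex.neg_im] at h1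
      rw [Complex.neg_re] at h2
      have h1 : (z t).im = -1 := by linarith
      refine ⟨2, 1, by decide, ⟨ε, hε, ?_, ?_⟩, cur2 h1 _ _ ?_⟩
      · intro s hs
        have := hl s hs
        rw [Complex.neg_im] at this
        show (z s).im < -1
        linarith
      · intro s hs
        have := hr s hs
        rw [Complex.neg_im, abs_neg] at this
        exact this
      · rw [e2 h1, e1]
        exact pp _ _ (mul_pos hd (by linarith)) (by linarith)

/-- gluing two curves into a periodic one -/
lemma lc_glue (f g : ℝ → ℂ) (hf : Continuous f) (hg : Continuous g) (D1 D2 : ℝ) (h1 : 0 < D1)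
    (h2 : 0 < D2) (hfg : f D1 = g 0) (hgf : g D2 = f 0) :
    ∃ z : ℝ → ℂ, Continuous z ∧ Function.Periodic z (D1 + D2) ∧
      (∀ s ∈ Icc 0 D1, ∀ n : ℤ, z (n * (D1 + D2) + s) = f s) ∧
      (∀ s ∈ Icc 0 D2, ∀ n : ℤ, z (n * (D1 + D2) + D1 + s) = g s) := by
  set L := D1 + D2 with hL
  have hL0 : 0 < L := by linarith
  set z0 : ℝ → ℂ := fun t => if t ≤ D1 then f t else g (t - D1) with hz0
  have hz0c : Continuous z0 := by
    refine Continuous.if_le hf (by fun_prop) continuous_id continuous_const ?_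
    intro x hx
    have hx : x = D1 := hx
    rw [hx, sub_self, hfg]
  set k : ℝ → ℂ := fun u => z0 (L * u) with hk
  have hkc : Continuous k := by simp only [hk]; fun_prop
  have hk01 : k 0 = k 1 := by
    have h3 : ¬ (L ≤ D1) := by linarith
    have h4 : L - D1 = D2 := by linarith
    simp only [hk, hz0, mul_zero, mul_one, h1.le, if_true, h3, if_false, h4, hgf]
  have hz := (hkc.continuousOn (s := Icc 0 1)).comp_fract'' hk01
  refine ⟨fun t => k (Int.fract (t / L)), ?_, ?_, ?_⟩
  · exact hz.comp (by fun_prop : Continuous fun t : ℝ => t / L)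
  · intro t
    have : (t + L) / L = t / L + 1 := by field_simp
    simp only [this, Int.fract_add_one]
  have base : ∀ s ∈ Ico 0 L, ∀ n : ℤ, k (Int.fract ((n * L + s) / L)) = z0 s := by
    intro s hs n
    have e : (n * L + s) / L = n + s / L := by field_simp
    have e2 : Int.fract (s / L) = s / L :=
      Int.fract_eq_self.2 ⟨div_nonneg hs.1 hL0.le, (div_lt_one hL0).2 hs.2⟩
    rw [e, Int.fract_intCast_add, e2]
    simp only [hk]
    congr 1; field_simp
  constructor
  · intro s hs n
    show k (Int.fract ((n * L + s) / L)) = f s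
    rw [base s ⟨hs.1, by linarith [hs.2]⟩]
    simp [hz0, hs.2]
  · intro s hs n
    show k (Int.fract ((n * L + D1 + s) / L)) = g s
    rcases hs.2.eq_or_lt with h | h
    · have e : n * L + D1 + s = ((n + 1 : ℤ) : ℝ) * L + 0 := by push_cast; rw [h]; ring
      rw [e, base 0 ⟨le_rfl, hL0⟩, h, hgf]
      simp [hz0, h1.le]
    · rw [add_assoc, base (D1 + s) ⟨by linarith [hs.1], by linarith⟩]
      rcases hs.1.eq_or_lt with h0 | h0
      · rw [← h0]; simp [hz0, hfg]
      · have : ¬ (D1 + s ≤ D1) := by linarith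
        simp only [hz0, this, if_false, add_sub_cancel_left]

lemma lc_side {f : ℝ → ℝ} (hf : Continuous f) (c : ℝ) (h : ∀ t, f t ≠ c) :
    (∀ t, c < f t) ∨ (∀ t, f t < c) := by
  by_contra hcon
  push Not at hcon
  obtain ⟨⟨t1, h1⟩, t2, h2⟩ := hcon
  obtain ⟨t, ht⟩ := mem_range_of_exists_le_of_exists_ge hf ⟨t1, h1⟩ ⟨t2, h2⟩
  exact h t ht

/-- an orbit cannot stay forever in the upper zone -/
lemma LCHalf.not_up {a b q : ℝ} {w : ℝ → ℂ} (h : LCHalf a b q w) (ha : a < 0) {T : ℝ} (hT : 0 < T)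
    (hper : Function.Periodic w T) (hup : ∀ t, 1 < (w t).im) : False := by
  have h1 := lc_follow h.cont isOpen_univ ((a : ℂ) + (b : ℂ) * I) (I - q)
    (fun t _ => h.up t (hup t)) 0 T ⟨1, one_pos, fun _ _ => trivial⟩ (fun _ _ => trivial) T
    ⟨hT.le, le_rfl⟩
  rw [hper 0] at h1
  have h2 : ‖Complex.exp (((a : ℂ) + (b : ℂ) * I) * (T : ℂ))‖ < 1 := by
    rw [Complex.norm_exp]
    simp
    exact mul_neg_of_neg_of_pos ha hT
  set E := Complex.exp (((a : ℂ) + (b : ℂ) * I) * (T : ℂ))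
  have h3 : (E - 1) * (w 0 - (I - q)) = 0 := by linear_combination -h1
  rcases mul_eq_zero.1 h3 with h4 | h4
  · rw [sub_eq_zero.1 h4] at h2
    simp at h2
  · have h5 := hup 0
    rw [sub_eq_zero.1 h4] at h5
    simp at h5

lemma LCHalf.not_mid {a b q : ℝ} {w : ℝ → ℂ} (h : LCHalf a b q w)
    (hn : 1 < ‖w 0‖) (hmid : ∀ t, |(w t).im| < 1) : False := by
  have hs : 0 ≤ Real.pi / 2 - (w 0).arg + 2 * Real.pi := by
    linarith [Complex.arg_le_pi (w 0), Real.pi_pos]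
  set s := Real.pi / 2 - (w 0).arg + 2 * Real.pi with hsdef
  have h1 := lc_follow h.cont isOpen_univ I 0
    (fun t _ => by simpa using h.mid t (hmid t)) 0 s ⟨1, one_pos, fun _ _ => trivial⟩
    (fun _ _ => trivial) s ⟨hs, le_rfl⟩
  have h2 : Complex.exp (I * (s : ℂ)) * w 0 = ‖w 0‖ * I := by
    conv_lhs => rw [← Complex.norm_mul_exp_arg_mul_I (w 0)]
    rw [mul_left_comm, ← Complex.exp_add]
    have : I * (s : ℂ) + (w 0).arg * I = Real.pi / 2 * I + 2 * Real.pi * I := by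
      rw [hsdef]; push_cast; ring
    rw [this, Complex.exp_add, Complex.exp_two_pi_mul_I, Complex.exp_pi_div_two_mul_I, mul_one]
  rw [zero_add, zero_add, sub_zero, h2] at h1
  have h3 := hmid s
  rw [h1] at h3
  simp at h3
  linarith

lemma lc_hit {a b c d x0 x1 : ℝ} (ha : a < 0) (hc : c < 0) (hd : 0 < d) (hx0 : 0 < x0)
    {w : ℝ → ℂ} (h1 : LCHalf a b x1 w) (h2 : LCHalf c d x0 (fun t => - w t)) {T : ℝ} (hT : 0 < T)
    (hper : Function.Periodic w T) (hn : 1 < ‖w 0‖) :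
    ∃ t X : ℝ, 0 < X ∧ w t = X + I := by
  have hB : (∃ t X : ℝ, 0 < X ∧ - w t = X + I) → ∃ t X : ℝ, 0 < X ∧ w t = X + I := by
    rintro ⟨t, X, hX, h0⟩
    have hA := lcA_pos (a := c) (b := d) hx0 hX
    have hp : 0 < Real.pi / d := by positivity
    have hD : lcD c d x0 X = Real.pi / d + lcA c d x0 X := rfl
    have := h2.arc hd hx0 hX h0 (lcD c d x0 X) ⟨by linarith, le_rfl⟩
    rw [lcH_end hd hx0 hX] at this
    exact ⟨_, _, lcXn_pos hx0 hX, neg_inj.1 this⟩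
  have hC : ∀ {a b q : ℝ} {v : ℝ → ℂ}, LCHalf a b q v → ∀ t, (v t).im = 1 →
      (∃ t X : ℝ, 0 < X ∧ v t = X + I) ∨ (∃ t X : ℝ, 0 < X ∧ - v t = X + I) := by
    intro a b q v hv t ht
    rcases lt_or_gt_of_ne (hv.ne t ht) with hr | hr
    · right
      have hY : 0 < -(v t).re := by linarith
      have := hv.center (t0 := t) hY (by apply Complex.ext <;> simp [ht]) (2 * Real.arctan (1 / (-(v t).re)))
        ⟨by have := Real.arctan_pos.2 (one_div_pos.2 hY); linarith, le_rfl⟩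
      rw [lc_mid_end _ hY] at this
      exact ⟨_, _, hY, by rw [this, neg_neg]⟩
    · left
      exact ⟨t, (v t).re, hr, by apply Complex.ext <;> simp [ht]⟩
  by_cases hex : ∃ t, (w t).im = 1
  · obtain ⟨t, ht⟩ := hex
    rcases hC h1 t ht with h | h
    · exact h
    · exact hB h
  by_cases hex' : ∃ t, (w t).im = -1
  · obtain ⟨t, ht⟩ := hex'
    rcases hC h2 t (by rw [Complex.neg_im, ht, neg_neg]) with h | h
    · exact hB h
    · simpa using h
  push Not at hex hex'
  exfalso
  have hi : Continuous fun t => (w t).im := by have := h1.cont; fun_prop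
  rcases lc_side hi 1 hex with h | h
  · exact h1.not_up ha hT hper h
  rcases lc_side hi (-1) hex' with h' | h'
  · exact h1.not_mid hn (fun t => abs_lt.2 ⟨h' t, h t⟩)
  · refine h2.not_up hc hT (fun t => by simp [hper t]) (fun t => ?_)
    have := h' t
    rw [Complex.neg_im]; linarith

/-- **Proposition.** If `a, c < 0`, `b, d > 0`, `x₀, x₁ > 0`, then the system
`ż = (a+ib)(z - i + x₁)` in `Σ₊`, `ż = iz` in `Σ_c`, `ż = (c+id)(z + i - x₀)` in `Σ₋`
has a crossing limit cycle. -/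
theorem limit_cycle_linear_center (a b c d x0 x1 : ℝ)
    (ha : a < 0) (hc : c < 0) (hb : 0 < b) (hd : 0 < d) (hx0 : 0 < x0) (hx1 : 0 < x1) :
    ∃ z : ℝ → ℂ, IsCrossingLimitCycle zonesLines
      ![fun w => ((a : ℂ) + (b : ℂ) * Complex.I) * (w - Complex.I + (x1 : ℂ)),
        fun w => Complex.I * w,
        fun w => ((c : ℂ) + (d : ℂ) * Complex.I) * (w + Complex.I - (x0 : ℂ))]
      curvesLines z := by
  -- the fixed point of the affine return map
  obtain ⟨X, hX, hfix, hP⟩ : ∃ X : ℝ, 0 < X ∧ lcXn c d x0 (lcXn a b x1 X) = X ∧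
      ∀ x, |lcXn c d x0 (lcXn a b x1 x) - X| < |x - X| ∨ x = X := by
    have hk1 : Real.exp (a * (Real.pi / b)) < 1 :=
      (by rw [Real.exp_lt_one_iff]; exact mul_neg_of_neg_of_pos ha (by positivity))
    have hl1 : Real.exp (c * (Real.pi / d)) < 1 :=
      (by rw [Real.exp_lt_one_iff]; exact mul_neg_of_neg_of_pos hc (by positivity))
    have hk0 := Real.exp_pos (a * (Real.pi / b))
    have hl0 := Real.exp_pos (c * (Real.pi / d))
    unfold lcXn
    set k := Real.exp (a * (Real.pi / b))
    set l := Real.exp (c * (Real.pi / d))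
    have hkl : l * k < 1 := by nlinarith
    have hkl' : 0 < 1 - l * k := by linarith
    have hfix : x0 + l * (x1 + k * ((x0 + l * (x1 + k * x1 + x0)) / (1 - l * k) + x1) + x0) =
        (x0 + l * (x1 + k * x1 + x0)) / (1 - l * k) := by
      field_simp; ring
    refine ⟨(x0 + l * (x1 + k * x1 + x0)) / (1 - l * k), by positivity, hfix, ?_⟩
    intro x
    set X := (x0 + l * (x1 + k * x1 + x0)) / (1 - l * k)
    by_cases hx : x = X
    · exact Or.inr hx
    · left
      have e : x0 + l * (x1 + k * (x + x1) + x0) - X = (l * k) * (x - X) := by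
        linear_combination hfix
      have : 0 < |x - X| := abs_pos.2 (sub_ne_zero.2 hx)
      have hp : 0 < l * k := by positivity
      rw [e, abs_mul, abs_of_pos hp]
      nlinarith
  set Y := lcXn a b x1 X with hYdef
  have hY : 0 < Y := lcXn_pos hx1 hX
  have hA1 := lcA_pos (a := a) (b := b) hx1 hX
  have hp1 : 0 < Real.pi / b := by positivity
  have hD1 : lcD a b x1 X = Real.pi / b + lcA a b x1 X := rfl
  have hA2 := lcA_pos (a := c) (b := d) hx0 hY
  have hp2 : 0 < Real.pi / d := by positivity
  have hD2 : lcD c d x0 Y = Real.pi / d + lcA c d x0 Y := rfl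
  have hcont1 := lcH_cont (a := a) (q := x1) (X := X) hb
  have hcont2 := lcH_cont (a := c) (q := x0) (X := Y) hd
  obtain ⟨z, hzc, hzp, hz1, hz2⟩ := lc_glue (lcH a b x1 X) (fun s => - lcH c d x0 Y s)
    hcont1 hcont2.neg (lcD a b x1 X) (lcD c d x0 Y) (by linarith) (by linarith)
    (by rw [lcH_end hb hx1 hX, lcH_zero hd])
    (by rw [lcH_end hd hx0 hY, lcH_zero hb, hfix, neg_neg])
  set D1 := lcD a b x1 X
  set D2 := lcD c d x0 Y
  set L := D1 + D2 with hL
  have hL0 : 0 < L := by linarith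
  have cover : ∀ t : ℝ, ∃ n : ℤ, ∃ s ∈ Ico 0 L, t = n * L + s := by
    intro t
    refine ⟨⌊t / L⌋, L * Int.fract (t / L), ⟨mul_nonneg hL0.le (Int.fract_nonneg _), ?_⟩, ?_⟩
    · have := Int.fract_lt_one (t / L); nlinarith
    · have := Int.floor_add_fract (t / L)
      have e : t = L * (t / L) := by field_simp
      conv_lhs => rw [e, ← this]
      ring
  have i1 : ∀ n : ℤ, LCInfo a b x1 X z (n * L) := fun n =>
    lc_info hb hx1 hX (fun s hs => hz1 s hs n)
  have i2 : ∀ n : ℤ, LCInfo c d x0 Y (fun t => - z t) (n * L + D1) := fun n =>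
    lc_info hd hx0 hY (fun s hs => by rw [hz2 s hs n, neg_neg])
  have hgood1 : ∀ (n : ℤ), ∀ s ∈ Ico 0 D1, LCGood a b x1 z (n * L + s) := by
    intro n s hs
    refine lc_good (a' := c) hb hx1 hX hd hx0 hY (i1 n) ?_ hs
    have := i2 (n - 1)
    convert this using 1
    push_cast; rw [hL]; ring
  have hgood2 : ∀ (n : ℤ), ∀ s ∈ Ico 0 D2, LCGood c d x0 (fun t => - z t) (n * L + D1 + s) := by
    intro n s hs
    refine lc_good (a' := a) hd hx0 hY hb hx1 hX (i2 n) ?_ hs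
    have := i1 n
    convert this using 1
    · ext t; simp
    · ring
  have horb : IsCrossingPeriodicOrbit zonesLines (lcF a b c d x0 x1) curvesLines z := by
    refine lc_orbit hb hd hx0 hx1 hL0 hzc hzp ⟨0, 0 + D1, ?_⟩ ?_ ?_
    · have e1 := (i1 0).start
      have e2 := (i1 0).fin
      simp only [Int.cast_zero, zero_mul] at e1 e2
      rw [e1, e2]
      intro h
      have := congrArg Complex.im h
      simp at this
      linarith
    · intro t
      obtain ⟨n, s, hs, rfl⟩ := cover t
      rcases lt_or_ge s D1 with h | h
      · left; exact hgood1 n s ⟨hs.1, h⟩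
      · right
        have := hgood2 n (s - D1) ⟨by linarith, by linarith [hs.2]⟩
        convert this using 1; ring
    · have : ({0, Real.pi / b, D1, D1 + Real.pi / d} : Set ℝ).Finite := by simp
      refine this.subset ?_
      rintro t ⟨ht, hline⟩
      have j1 := i1 0
      have j2 := i2 0
      simp only [Int.cast_zero, zero_mul] at j1 j2
      by_contra hne
      simp only [mem_insert_iff, mem_singleton_iff, not_or] at hne
      obtain ⟨n1, n2, n3, n4⟩ := hne
      have hn0 : 0 < t := lt_of_le_of_ne ht.1 (Ne.symm n1)
      rcases lt_or_gt_of_ne n3 with h | h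
      · rcases lt_or_gt_of_ne n2 with h' | h'
        · have := (j1.up t ⟨hn0, h'⟩).1
          rw [zero_add] at this
          rcases hline with h | h <;> linarith
        · have := (j1.mid t ⟨h', h⟩).1
          rw [zero_add] at this
          have := abs_lt.1 this
          rcases hline with h | h <;> linarith [this.1, this.2]
      · rcases lt_or_gt_of_ne n4 with h' | h'
        · have := (j2.up (t - D1) ⟨by linarith, by linarith⟩).1
          rw [zero_add, add_sub_cancel, Complex.neg_im] at this
          rcases hline with h | h <;> linarith
        · have := (j2.mid (t - D1) ⟨by linarith, by linarith [ht.2]⟩).1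
          rw [zero_add, add_sub_cancel, Complex.neg_im, abs_neg] at this
          have := abs_lt.1 this
          rcases hline with h | h <;> linarith [this.1, this.2]
  refine ⟨z, horb, {u | 1 < ‖u‖}, isOpen_lt continuous_const continuous_norm, ?_, ?_⟩
  · rintro _ ⟨t, rfl⟩
    obtain ⟨n, s, hs, rfl⟩ := cover t
    show 1 < ‖z (n * L + s)‖
    rcases lt_or_ge s D1 with h | h
    · rw [hz1 s ⟨hs.1, h.le⟩ n]; exact lcH_norm hb hx1 hX hs.1
    · have := hz2 (s - D1) ⟨by linarith, by linarith [hs.2]⟩ n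
      rw [add_assoc, add_sub_cancel] at this
      rw [this, norm_neg]; exact lcH_norm hd hx0 hY (by linarith)
  · intro w hw hU
    have w1 : LCHalf a b x1 w := lc_half_top hw
    have w2 : LCHalf c d x0 (fun t => - w t) := lc_half_bot hw
    obtain ⟨T, hT, -, hper, -, -, hfin, -⟩ := hw
    -- the return map
    have ret : ∀ (x t0 : ℝ), 0 < x → w t0 = x + I →
        (∀ s ∈ Icc 0 (lcD a b x1 x), w (t0 + s) = lcH a b x1 x s) ∧
        (∀ s ∈ Icc 0 (lcD c d x0 (lcXn a b x1 x)), w (t0 + lcD a b x1 x + s) =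
          - lcH c d x0 (lcXn a b x1 x) s) := by
      intro x t0 hx h0
      have r1 := w1.arc hb hx1 hx h0
      refine ⟨r1, ?_⟩
      have hA := lcA_pos (a := a) (b := b) hx1 hx
      have hD : lcD a b x1 x = Real.pi / b + lcA a b x1 x := rfl
      have r2 := r1 _ ⟨by linarith, le_rfl⟩
      rw [lcH_end hb hx1 hx] at r2
      have r3 := w2.arc hd hx0 (lcXn_pos (a := a) (b := b) hx1 hx) (by rw [r2, neg_neg])
      intro s hs
      rw [← r3 s hs, neg_neg]
    have ret2 : ∀ (x t0 : ℝ), 0 < x → w t0 = x + I →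
        w (t0 + lcD a b x1 x + lcD c d x0 (lcXn a b x1 x)) =
          (lcXn c d x0 (lcXn a b x1 x) : ℝ) + I := by
      intro x t0 hx h0
      have hx' := lcXn_pos (a := a) (b := b) hx1 hx
      have hA := lcA_pos (a := c) (b := d) hx0 hx'
      have hD : lcD c d x0 (lcXn a b x1 x) = Real.pi / d + lcA c d x0 (lcXn a b x1 x) := rfl
      rw [(ret x t0 hx h0).2 _ ⟨by linarith, le_rfl⟩, lcH_end hd hx0 hx', neg_neg]
    obtain ⟨t0, ht0⟩ : ∃ t0, w t0 = X + I := by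
      set S : Set ℝ := {x | 0 < x ∧ ∃ t, w t = (x : ℂ) + I} with hS
      have hSf : S.Finite := by
        refine (hfin.image (fun t => (w t).re)).subset ?_
        rintro x ⟨hx, t, ht⟩
        obtain ⟨t', ht', e⟩ := hper.exists_mem_Ico₀ hT t
        rw [ht] at e
        refine ⟨t', ⟨ht', fun z => z.im - 1, by simp [curvesLines], by simp [← e]⟩, by simp [← e]⟩
      obtain ⟨t, x, hx, htx⟩ := lc_hit ha hc hd hx0 w1 w2 hT hper (hU ⟨0, rfl⟩)
      obtain ⟨m, ⟨hm0, t, hmt⟩, hmin⟩ := Set.exists_min_image S (fun x => |x - X|) hSf ⟨x, hx, t, htx⟩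
      rcases hP m with h | h
      · exfalso
        have := hmin _ ⟨lcXn_pos hx0 (lcXn_pos (a := a) (b := b) hx1 hm0), _, ret2 m t hm0 hmt⟩
        linarith
      · exact ⟨t, by rw [← h]; exact hmt⟩
    have iter : ∀ n : ℕ, w (t0 + n * L) = X + I := by
      intro n
      induction n with
      | zero => simpa using ht0
      | succ n ih =>
        have := ret2 X _ hX ih
        rw [← hYdef, hfix] at this
        rw [← this]; congr 1; push_cast; rw [hL]; ring
    have agree : ∀ (n : ℕ) (m : ℤ), ∀ s ∈ Ico 0 L, w (t0 + n * L + s) = z (m * L + s) := by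
      intro n m s hs
      have r := ret X _ hX (iter n)
      rcases lt_or_ge s D1 with h | h
      · rw [r.1 s ⟨hs.1, h.le⟩, hz1 s ⟨hs.1, h.le⟩ m]
      · have hs' : s - D1 ∈ Icc 0 D2 := ⟨by linarith, by linarith [hs.2]⟩
        have e1 := r.2 (s - D1) hs'
        have e2 := hz2 (s - D1) hs' m
        rw [add_assoc, add_sub_cancel] at e1 e2
        rw [e1, e2]
    apply Set.Subset.antisymm
    · rintro _ ⟨t, rfl⟩
      obtain ⟨N, hN⟩ := exists_nat_gt ((t0 - t) / T)
      rw [div_lt_iff₀ hT] at hN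
      have e : w t = w (t + N * T) := (hper.nat_mul N t).symm
      obtain ⟨n, s, hs, hn⟩ := cover (t + N * T - t0)
      have hn0 : 0 ≤ n := by
        by_contra hneg
        have : n ≤ -1 := by omega
        have : (n : ℝ) ≤ -1 := by exact_mod_cast this
        nlinarith [hs.2]
      obtain ⟨n', rfl⟩ := Int.eq_ofNat_of_zero_le hn0
      refine ⟨(0 : ℤ) * L + s, ?_⟩
      rw [← agree n' 0 s hs, e]
      congr 1
      push_cast at hn
      linarith
    · rintro _ ⟨t, rfl⟩
      obtain ⟨n, s, hs, rfl⟩ := cover t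
      exact ⟨_, agree 0 n s hs⟩
end
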